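/- arXiv:1805.06859 — 2 statements merged into one kernel-verified Lean document; each statement's English description precedes it below -/
import Mathlib

section
/- Let n ≥ 1 and let P ⊆ ℝⁿ be a bounded DH-polytope. Then the limit L = lim_{ε→0⁺} μ_ε(P) exists, and if n is even then L is real (its imaginary part is 0), while if n is odd then L is purely imaginary (its real part is 0). (First part of Theorem 1.4.) -/
open MeasureTheory Filter Metric

variable {n : ℕ} [NeZero n]

/-- A *DH-half-space* in `ℝⁿ` (upper half-space model of the double hyperbolic space `DHⁿ`):
either a closed ball whose center has first coordinate `0`, or the complement of an open ball
whose center has first coordinate `0`, or a closed affine half-space whose normal vector is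
nonzero with first coordinate `0`. -/
def IsDHHalfSpace (H : Set (EuclideanSpace ℝ (Fin n))) : Prop :=
  (∃ (c : EuclideanSpace ℝ (Fin n)) (r : ℝ), 0 < r ∧ c 0 = 0 ∧ H = closedBall c r) ∨
  (∃ (c : EuclideanSpace ℝ (Fin n)) (r : ℝ), 0 < r ∧ c 0 = 0 ∧ H = (ball c r)ᶜ) ∨
  (∃ (v : EuclideanSpace ℝ (Fin n)) (t : ℝ), v ≠ 0 ∧ v 0 = 0 ∧
    H = {x | t ≤ inner v x (𝕜 := ℝ)})

/-- A *DH-polytope* in `ℝⁿ`: a finite intersection of DH-half-spaces. -/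
def IsDHPolytope (P : Set (EuclideanSpace ℝ (Fin n))) : Prop :=
  ∃ S : Finset (Set (EuclideanSpace ℝ (Fin n))), (∀ H ∈ S, IsDHHalfSpace H) ∧ P = ⋂₀ ↑S

/-- `μ_ε(P) = ∫_P (x₀ - εi)^{-n} dx`. -/
noncomputable def dhInt (n : ℕ) [NeZero n] (P : Set (EuclideanSpace ℝ (Fin n))) (ε : ℝ) : ℂ :=
  ∫ x in P, ((x 0 : ℂ) - (ε : ℂ) * Complex.I) ^ (-(n : ℤ))

open scoped Topology ContDiff

lemma tendsto_ofReal_sub_mul_I (t : ℝ) :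
    Tendsto (fun ε : ℝ => (t : ℂ) - (ε : ℂ) * Complex.I) (𝓝[>] 0) (𝓝 (t : ℂ)) := by
  have : Continuous fun ε : ℝ => (t : ℂ) - (ε : ℂ) * Complex.I := by fun_prop
  simpa using (this.tendsto 0).mono_left nhdsWithin_le_nhds

lemma ofReal_sub_mul_I_mem_slitPlane (t : ℝ) {ε : ℝ} (hε : 0 < ε) :
    (t : ℂ) - (ε : ℂ) * Complex.I ∈ Complex.slitPlane := by
  refine Or.inr ?_
  simp [hε.ne']

lemma ofReal_sub_mul_I_ne_zero (t : ℝ) {ε : ℝ} (hε : 0 < ε) :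
    (t : ℂ) - (ε : ℂ) * Complex.I ≠ 0 :=
  Complex.slitPlane_ne_zero (ofReal_sub_mul_I_mem_slitPlane t hε)

lemma abs_le_norm_ofReal_sub_mul_I (t ε : ℝ) : |t| ≤ ‖(t : ℂ) - (ε : ℂ) * Complex.I‖ := by
  simpa using Complex.abs_re_le_norm ((t : ℂ) - (ε : ℂ) * Complex.I)

lemma le_norm_ofReal_sub_mul_I (t ε : ℝ) : |ε| ≤ ‖(t : ℂ) - (ε : ℂ) * Complex.I‖ := by
  simpa using Complex.abs_im_le_norm ((t : ℂ) - (ε : ℂ) * Complex.I)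

lemma continuous_kernel {ε : ℝ} (hε : 0 < ε) (k : ℤ) :
    Continuous fun t : ℝ => ((t : ℂ) - (ε : ℂ) * Complex.I) ^ k := by
  refine continuous_iff_continuousAt.2 fun t => ?_
  refine ContinuousAt.zpow₀ (by fun_prop) _ (Or.inl (ofReal_sub_mul_I_ne_zero t hε))

lemma norm_kernel_le_of_abs {δ t : ℝ} (hδ : 0 < δ) (ht : δ ≤ |t|) (ε : ℝ) (n : ℕ) :
    ‖((t : ℂ) - (ε : ℂ) * Complex.I) ^ (-(n : ℤ))‖ ≤ (δ ^ n)⁻¹ := by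
  rw [zpow_neg, zpow_natCast, norm_inv, norm_pow]
  have := ht.trans (abs_le_norm_ofReal_sub_mul_I t ε)
  gcongr

lemma norm_kernel_le {ε : ℝ} (hε : 0 < ε) (t : ℝ) (n : ℕ) :
    ‖((t : ℂ) - (ε : ℂ) * Complex.I) ^ (-(n : ℤ))‖ ≤ (ε ^ n)⁻¹ := by
  rw [zpow_neg, zpow_natCast, norm_inv, norm_pow]
  have := (le_abs_self ε).trans (le_norm_ofReal_sub_mul_I t ε)
  gcongr

lemma tendsto_kernel {t : ℝ} (ht : t ≠ 0) (k : ℤ) :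
    Tendsto (fun ε : ℝ => ((t : ℂ) - (ε : ℂ) * Complex.I) ^ k) (𝓝[>] 0) (𝓝 ((t : ℂ) ^ k)) :=
  (tendsto_ofReal_sub_mul_I t).zpow₀ k (Or.inl (by exact_mod_cast ht))

lemma hasDerivAt_kernel (t : ℝ) {ε : ℝ} (hε : 0 < ε) (k : ℤ) :
    HasDerivAt (fun t : ℝ => ((t : ℂ) - (ε : ℂ) * Complex.I) ^ k)
      (k * ((t : ℂ) - (ε : ℂ) * Complex.I) ^ (k - 1)) t := by
  have h1 : HasDerivAt (fun t : ℝ => (t : ℂ) - (ε : ℂ) * Complex.I) 1 t :=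
    Complex.ofRealCLM.hasDerivAt.sub_const _
  have h2 := hasDerivAt_zpow k _ (Or.inl (ofReal_sub_mul_I_ne_zero t hε))
  have h3 := HasDerivAt.comp t h2 h1
  rw [mul_one] at h3
  exact h3

/-- The limit of `∫ (t - εi)⁻¹` over a symmetric interval. -/
lemma tendsto_integral_inv_kernel {δ : ℝ} (hδ : 0 < δ) :
    ∃ L : ℂ, Tendsto (fun ε : ℝ => ∫ t in -δ..δ, ((t : ℂ) - (ε : ℂ) * Complex.I) ^ (-1 : ℤ))
      (𝓝[>] 0) (𝓝 L) := by
  have hlog : Tendsto (fun ε : ℝ => Complex.log ((δ : ℂ) - (ε : ℂ) * Complex.I)) (𝓝[>] 0)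
      (𝓝 (Complex.log δ)) :=
    (tendsto_ofReal_sub_mul_I δ).clog (Complex.ofReal_mem_slitPlane.2 hδ)
  have hlog' : Tendsto (fun ε : ℝ => Complex.log (((-δ : ℝ) : ℂ) - (ε : ℂ) * Complex.I)) (𝓝[>] 0)
      (𝓝 (Real.log ‖((-δ : ℝ) : ℂ)‖ - Real.pi * Complex.I)) := by
    refine (Complex.tendsto_log_nhdsWithin_im_neg_of_re_neg_of_im_zero (by simpa using hδ)
      (by simp)).comp ?_
    refine tendsto_nhdsWithin_of_tendsto_nhds_of_eventually_within _
      (tendsto_ofReal_sub_mul_I _) ?_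
    filter_upwards [self_mem_nhdsWithin] with ε hε
    simpa using hε
  refine ⟨_, (hlog.sub hlog').congr' ?_⟩
  filter_upwards [self_mem_nhdsWithin] with ε hε
  rw [intervalIntegral.integral_eq_sub_of_hasDerivAt
    (f := fun t : ℝ => Complex.log ((t : ℂ) - (ε : ℂ) * Complex.I))]
  · intro t _
    have h1 : HasDerivAt (fun t : ℝ => (t : ℂ) - (ε : ℂ) * Complex.I) 1 t :=
      Complex.ofRealCLM.hasDerivAt.sub_const _
    simpa using h1.clog_real (ofReal_sub_mul_I_mem_slitPlane t hε)
  · exact (continuous_kernel hε _).intervalIntegrable _ _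

lemma tendsto_integral_smooth_mul_kernel {δ : ℝ} (hδ : 0 < δ) (j : ℕ) :
    ∀ φ : ℝ → ℂ, ContDiff ℝ (j + 1) φ →
    ∃ L : ℂ, Tendsto (fun ε : ℝ => ∫ t in -δ..δ,
      φ t * ((t : ℂ) - (ε : ℂ) * Complex.I) ^ (-((j + 1 : ℕ) : ℤ))) (𝓝[>] 0) (𝓝 L) := by
  induction j with
  | zero =>
    intro φ hφ
    simp only [Nat.cast_zero, zero_add] at hφ
    obtain ⟨C, hC⟩ : ∃ C, ∀ t ∈ Set.Icc (-δ) δ, ‖deriv φ t‖ ≤ C :=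
      isCompact_Icc.exists_bound_of_continuousOn (contDiff_one_iff_deriv.1 hφ).2.continuousOn
    have hlip : ∀ t ∈ Set.Icc (-δ) δ, ‖φ t - φ 0‖ ≤ C * |t| := by
      intro t ht
      simpa using (convex_Icc (-δ) δ).norm_image_sub_le_of_norm_deriv_le
        (fun x _ => (hφ.differentiable one_ne_zero) x) hC ⟨by linarith, hδ.le⟩ ht
    obtain ⟨L, hL⟩ := tendsto_integral_inv_kernel hδ
    have hdiff : Tendsto (fun ε : ℝ => ∫ t in -δ..δ,
        (φ t - φ 0) * ((t : ℂ) - (ε : ℂ) * Complex.I) ^ (-1 : ℤ)) (𝓝[>] 0)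
        (𝓝 (∫ t in -δ..δ, (φ t - φ 0) * (t : ℂ) ^ (-1 : ℤ))) := by
      refine intervalIntegral.tendsto_integral_filter_of_dominated_convergence (fun _ => C) ?_ ?_
        (by simp) ?_
      · filter_upwards [self_mem_nhdsWithin] with ε hε
        exact ((hφ.continuous.sub continuous_const).mul
          (continuous_kernel hε _)).aestronglyMeasurable
      · filter_upwards [self_mem_nhdsWithin] with ε hε
        filter_upwards with t ht
        rw [Set.uIoc_of_le (by linarith)] at ht
        have h1 := hlip t ⟨ht.1.le, ht.2⟩
        have h2 := abs_le_norm_ofReal_sub_mul_I t ε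
        have h3 : 0 < ‖(t : ℂ) - (ε : ℂ) * Complex.I‖ :=
          norm_pos_iff.2 (ofReal_sub_mul_I_ne_zero t hε)
        have hC0 : 0 ≤ C := (norm_nonneg _).trans (hC t ⟨ht.1.le, ht.2⟩)
        rw [norm_mul, zpow_neg_one, norm_inv, ← div_eq_mul_inv, div_le_iff₀ h3]
        exact h1.trans (by gcongr)
      · have : ∀ᵐ t : ℝ, t ≠ 0 := by simp [ae_iff, measure_singleton]
        filter_upwards [this] with t ht _
        exact tendsto_const_nhds.mul (tendsto_kernel ht _)
    refine ⟨_, (hdiff.add (hL.const_mul (φ 0))).congr' ?_⟩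
    filter_upwards [self_mem_nhdsWithin] with ε hε
    rw [← intervalIntegral.integral_const_mul, ← intervalIntegral.integral_add]
    · refine intervalIntegral.integral_congr fun t _ => ?_
      simp only [Nat.cast_one, zero_add]
      ring
    · exact ((hφ.continuous.sub continuous_const).mul
        (continuous_kernel hε _)).intervalIntegrable _ _
    · exact (continuous_const.mul (continuous_kernel hε _)).intervalIntegrable _ _
  | succ j ih =>
    intro φ hφ
    push_cast at hφ
    obtain ⟨hd, -, hφ'⟩ := contDiff_succ_iff_deriv.1 hφ
    obtain ⟨L, hL⟩ := ih (deriv φ) hφ'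
    have hj : (-((j + 1 : ℕ) : ℂ)) ≠ 0 := neg_ne_zero.2 (Nat.cast_ne_zero.2 j.succ_ne_zero)
    set m : ℤ := -((j + 1 : ℕ) : ℤ) with hm
    have hb := ((tendsto_kernel hδ.ne' m).const_mul (φ δ)).sub
      ((tendsto_kernel (neg_ne_zero.2 hδ.ne') m).const_mul (φ (-δ)))
    refine ⟨_, ((hb.sub hL).const_mul (m : ℂ)⁻¹).congr' ?_⟩
    filter_upwards [self_mem_nhdsWithin] with ε hε
    have hm0 : (m : ℂ) ≠ 0 := by rw [hm]; exact_mod_cast hj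
    have := intervalIntegral.integral_mul_deriv_eq_deriv_mul (a := -δ) (b := δ)
      (u := φ) (u' := deriv φ)
      (v := fun t : ℝ => ((t : ℂ) - (ε : ℂ) * Complex.I) ^ m)
      (v' := fun t : ℝ => m * ((t : ℂ) - (ε : ℂ) * Complex.I) ^ (m - 1))
      (fun t _ => (hd t).hasDerivAt) (fun t _ => hasDerivAt_kernel t hε m)
      (hφ'.continuous.intervalIntegrable _ _)
      ((continuous_const.mul (continuous_kernel hε _)).intervalIntegrable _ _)
    rw [← this, inv_mul_eq_iff_eq_mul₀ hm0, ← intervalIntegral.integral_const_mul]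
    refine intervalIntegral.integral_congr fun t _ => ?_
    have : -((j + 1 + 1 : ℕ) : ℤ) = m - 1 := by rw [hm]; push_cast; ring
    simp only [this]
    ring

/-- If an integrable function agrees near `0`, away from `0`, with a `Cⁿ` function, then its
integral against `(t - εi)⁻ⁿ` converges as `ε → 0⁺`. -/
lemma exists_tendsto_integral_mul_kernel {n : ℕ} (hn : n ≠ 0) {f : ℝ → ℝ} (hf : Integrable f)
    {φ : ℝ → ℝ} (hφ : ContDiff ℝ n φ) (hfφ : f =ᶠ[𝓝[≠] 0] φ) :
    ∃ L : ℂ, Tendsto (fun ε : ℝ => ∫ t, (f t : ℂ) * ((t : ℂ) - (ε : ℂ) * Complex.I) ^ (-(n : ℤ)))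
      (𝓝[>] 0) (𝓝 L) := by
  obtain ⟨δ, hδ, hδf⟩ : ∃ δ > 0, ∀ t : ℝ, |t| ≤ δ → t ≠ 0 → f t = φ t := by
    rw [EventuallyEq, eventually_nhdsWithin_iff, Metric.eventually_nhds_iff] at hfφ
    obtain ⟨δ, hδ, h⟩ := hfφ
    exact ⟨δ / 2, by positivity, fun t ht h0 => h (by simp; linarith) h0⟩
  obtain ⟨j, rfl⟩ := Nat.exists_eq_succ_of_ne_zero hn
  obtain ⟨L, hL⟩ := tendsto_integral_smooth_mul_kernel hδ j (fun t => (φ t : ℂ))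
    (Complex.ofRealCLM.contDiff.comp (by exact_mod_cast hφ))
  have hint : ∀ ε : ℝ, 0 < ε → Integrable fun t : ℝ =>
      (f t : ℂ) * ((t : ℂ) - (ε : ℂ) * Complex.I) ^ (-((j + 1 : ℕ) : ℤ)) := fun ε hε =>
    hf.ofReal.mul_bdd (continuous_kernel hε _).aestronglyMeasurable
      (ae_of_all _ fun t => norm_kernel_le hε t _)
  have hout : Tendsto (fun ε : ℝ => ∫ t in (Set.Ioc (-δ) δ)ᶜ,
      (f t : ℂ) * ((t : ℂ) - (ε : ℂ) * Complex.I) ^ (-((j + 1 : ℕ) : ℤ))) (𝓝[>] 0)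
      (𝓝 (∫ t in (Set.Ioc (-δ) δ)ᶜ, (f t : ℂ) * (t : ℂ) ^ (-((j + 1 : ℕ) : ℤ)))) := by
    have hge : ∀ t ∈ (Set.Ioc (-δ) δ)ᶜ, δ ≤ |t| := by
      intro t ht
      by_contra! h
      exact ht ⟨(abs_lt.1 h).1, (abs_lt.1 h).2.le⟩
    refine tendsto_integral_filter_of_dominated_convergence
      (fun t => ‖f t‖ * (δ ^ (j + 1))⁻¹) ?_ ?_ (hf.norm.mul_const _).integrableOn ?_
    · filter_upwards [self_mem_nhdsWithin] with ε hε
      exact (hint ε hε).aestronglyMeasurable.restrict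
    · filter_upwards with ε
      refine (ae_restrict_iff' measurableSet_Ioc.compl).2 (ae_of_all _ fun t ht => ?_)
      rw [norm_mul, Complex.norm_real]
      gcongr
      exact norm_kernel_le_of_abs hδ (hge t ht) _ _
    · refine (ae_restrict_iff' measurableSet_Ioc.compl).2 (ae_of_all _ fun t ht => ?_)
      exact tendsto_const_nhds.mul (tendsto_kernel (abs_pos.1 (hδ.trans_le (hge t ht))) _)
  refine ⟨_, (hL.add hout).congr' ?_⟩
  filter_upwards [self_mem_nhdsWithin] with ε hε
  rw [← integral_add_compl measurableSet_Ioc (hint ε hε),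
    intervalIntegral.integral_of_le (by linarith)]
  congr 1
  refine integral_congr_ae ((ae_restrict_iff' measurableSet_Ioc).2 ?_)
  have : ∀ᵐ t : ℝ, t ≠ 0 := by simp [ae_iff, measure_singleton]
  filter_upwards [this] with t ht0 ht
  rw [hδf t (abs_le.2 ⟨ht.1.le, ht.2⟩) ht0]

/-- `g` agrees on `s` near `x` with a function of class `C^k` on `ℝ`. -/
def SmoothGermWithin (s : Set ℝ) (k : ℕ) (g : ℝ → ℝ) (x : ℝ) : Prop :=
  ∃ φ : ℝ → ℝ, ContDiff ℝ k φ ∧ g =ᶠ[𝓝[s] x] φ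

lemma exists_contDiff_eventuallyEq {k : ℕ} {φ : ℝ → ℝ} {x : ℝ} (h : ContDiffAt ℝ k φ x) :
    ∃ ψ : ℝ → ℝ, ContDiff ℝ k ψ ∧ ψ =ᶠ[𝓝 x] φ := by
  obtain ⟨δ, hδ, hδφ⟩ := Metric.eventually_nhds_iff_ball.1 (h.eventually (by simp))
  let b : ContDiffBump x := ⟨δ / 4, δ / 2, by positivity, by linarith⟩
  refine ⟨fun t => b t * φ t, contDiff_iff_contDiffAt.2 fun t => ?_, ?_⟩
  · by_cases ht : t ∈ ball x δ
    · exact b.contDiffAt.mul (hδφ t ht)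
    · have hev : (fun t => b t * φ t) =ᶠ[𝓝 t] fun _ => 0 := by
        have : t ∉ tsupport b := by
          rw [b.tsupport_eq]
          intro h'
          refine ht (closedBall_subset_ball ?_ h')
          show δ / 2 < δ
          linarith
        filter_upwards [notMem_tsupport_iff_eventuallyEq.1 this] with u hu
        simp [hu]
      exact contDiffAt_const.congr_of_eventuallyEq hev
  · filter_upwards [b.eventuallyEq_one] with t ht
    simp [ht]

namespace SmoothGermWithin

variable {s t : Set ℝ} {k : ℕ} {g g' φ θ : ℝ → ℝ} {x : ℝ}

lemma of_contDiffAt (hφ : ContDiffAt ℝ k φ x) (h : g =ᶠ[𝓝[s] x] φ) :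
    SmoothGermWithin s k g x := by
  obtain ⟨ψ, hψ, hψφ⟩ := exists_contDiff_eventuallyEq hφ
  exact ⟨ψ, hψ, h.trans (hψφ.filter_mono nhdsWithin_le_nhds).symm⟩

lemma congr (h : SmoothGermWithin s k g x) (hg : g' =ᶠ[𝓝[s] x] g) :
    SmoothGermWithin s k g' x := by
  obtain ⟨φ, hφ, hgφ⟩ := h
  exact ⟨φ, hφ, hg.trans hgφ⟩

lemma add (h : SmoothGermWithin s k g x) (h' : SmoothGermWithin s k g' x) :
    SmoothGermWithin s k (fun w => g w + g' w) x := by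
  obtain ⟨φ, hφ, hgφ⟩ := h
  obtain ⟨φ', hφ', hgφ'⟩ := h'
  exact ⟨_, hφ.add hφ', hgφ.add hgφ'⟩

lemma mul (h : SmoothGermWithin s k g x) (h' : SmoothGermWithin s k g' x) :
    SmoothGermWithin s k (fun w => g w * g' w) x := by
  obtain ⟨φ, hφ, hgφ⟩ := h
  obtain ⟨φ', hφ', hgφ'⟩ := h'
  exact ⟨_, hφ.mul hφ', hgφ.mul hgφ'⟩

lemma comp (h : SmoothGermWithin t k g (θ x)) (hθ : ContDiffAt ℝ k θ x)
    (hst : Tendsto θ (𝓝[s] x) (𝓝[t] (θ x))) : SmoothGermWithin s k (fun w => g (θ w)) x := by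
  obtain ⟨φ, hφ, hgφ⟩ := h
  exact of_contDiffAt (hφ.contDiffAt.comp x hθ) (hst.eventually hgφ)

lemma integral_Ioi (hg : Integrable g) (h : SmoothGermWithin (Set.Ioi x) k g x) :
    SmoothGermWithin (Set.Ioi x) k (fun w => ∫ u in Set.Ioi w, g u) x := by
  obtain ⟨φ, hφ, hgφ⟩ := h
  have hder : ∀ w, HasDerivAt (fun w => ∫ u in x..w, φ u) (φ w) w := fun w =>
    intervalIntegral.integral_hasDerivAt_right (hφ.continuous.intervalIntegrable _ _)
      (hφ.continuous.stronglyMeasurableAtFilter _ _) hφ.continuous.continuousAt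
  have hprim : ContDiff ℝ (k + 1) fun w => ∫ u in x..w, φ u := by
    refine contDiff_succ_iff_deriv.2 ⟨fun w => (hder w).differentiableAt, by simp, ?_⟩
    rwa [show deriv (fun w => ∫ u in x..w, φ u) = φ from funext fun w => (hder w).deriv]
  refine ⟨fun w => (∫ u in Set.Ioi x, g u) - ∫ u in x..w, φ u,
    contDiff_const.sub (hprim.of_le (by exact_mod_cast Nat.le_succ k)), ?_⟩
  obtain ⟨b, hb, hbφ⟩ := mem_nhdsGT_iff_exists_Ioo_subset.1 hgφ
  filter_upwards [Ioo_mem_nhdsGT hb] with w hw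
  have heq : ∫ u in x..w, φ u = ∫ u in x..w, g u := by
    rw [intervalIntegral.integral_of_le hw.1.le, intervalIntegral.integral_of_le hw.1.le]
    exact setIntegral_congr_fun measurableSet_Ioc
      fun u hu => (hbφ ⟨hu.1, hu.2.trans_lt hw.2⟩ : g u = φ u).symm
  rw [heq, ← intervalIntegral.integral_Ioi_sub_Ioi hg.integrableOn hw.1.le]
  ring

end SmoothGermWithin

/-- The span of the products of an element of `C` and an element of `B`. -/
def productSpan {A : Type*} [CommRing A] [Algebra ℝ A] (C : Subalgebra ℝ A) (B : Set A) :
    Submodule ℝ A :=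
  Submodule.span ℝ {f | ∃ β ∈ C, ∃ b ∈ B, f = β * b}

section productSpan

variable {A : Type*} [CommRing A] [Algebra ℝ A] {C : Subalgebra ℝ A} {B B₁ B₂ : Set A}

lemma mul_mem_productSpan {β b : A} (hβ : β ∈ C) (hb : b ∈ B) : β * b ∈ productSpan C B :=
  Submodule.subset_span ⟨β, hβ, b, hb, rfl⟩

lemma mul_mem_productSpan_of_mem {β f : A} (hβ : β ∈ C) (hf : f ∈ productSpan C B) :
    β * f ∈ productSpan C B := by
  induction hf using Submodule.span_induction with
  | mem x hx =>
    obtain ⟨γ, hγ, b, hb, rfl⟩ := hx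
    rw [← mul_assoc]
    exact mul_mem_productSpan (mul_mem hβ hγ) hb
  | zero => simp
  | add x y _ _ hx hy => rw [mul_add]; exact add_mem hx hy
  | smul a x _ hx => rw [mul_smul_comm]; exact Submodule.smul_mem _ _ hx

lemma productSpan_mul_mem {B₃ : Set A}
    (h : ∀ b ∈ B₁, ∀ b' ∈ B₂, b * b' ∈ productSpan C B₃) {f g : A}
    (hf : f ∈ productSpan C B₁) (hg : g ∈ productSpan C B₂) : f * g ∈ productSpan C B₃ := by
  induction hf using Submodule.span_induction with
  | mem x hx =>
    obtain ⟨γ, hγ, b, hb, rfl⟩ := hx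
    rw [mul_assoc]
    refine mul_mem_productSpan_of_mem hγ ?_
    induction hg using Submodule.span_induction with
    | mem y hy =>
      obtain ⟨γ', hγ', b', hb', rfl⟩ := hy
      rw [mul_left_comm]
      exact mul_mem_productSpan_of_mem hγ' (h b hb b' hb')
    | zero => simp
    | add x y _ _ hx hy => rw [mul_add]; exact add_mem hx hy
    | smul a x _ hx => rw [mul_smul_comm]; exact Submodule.smul_mem _ _ hx
  | zero => simp
  | add x y _ _ hx hy => rw [add_mul]; exact add_mem hx hy
  | smul a x _ hx => rw [smul_mul_assoc]; exact Submodule.smul_mem _ _ hx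

/-- The pairwise products of elements of `B` reduce to `C`-convex combinations of the factors. -/
def ReducesProducts (C : Subalgebra ℝ A) (B : Set A) : Prop :=
  ∀ b ∈ B, ∀ b' ∈ B, ∃ η ∈ C, b * b' = η * b + (1 - η) * b'

lemma ReducesProducts.mul_mem (h : ReducesProducts C B) {b b' : A} (hb : b ∈ B) (hb' : b' ∈ B) :
    b * b' ∈ productSpan C B := by
  obtain ⟨η, hη, he⟩ := h b hb b' hb'
  rw [he]
  exact add_mem (mul_mem_productSpan hη hb) (mul_mem_productSpan (sub_mem (one_mem C) hη) hb')

lemma ReducesProducts.insert_one (h : ReducesProducts C B) : ReducesProducts C (insert 1 B) := by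
  rintro b (rfl | hb) b' (rfl | hb')
  · exact ⟨0, zero_mem _, by simp⟩
  · exact ⟨0, zero_mem _, by simp⟩
  · exact ⟨1, one_mem _, by simp⟩
  · exact h b hb b' hb'

end productSpan

lemma exists_mem_productSpan_ae_eq {E : Type*} [MeasurableSpace E] (μ : Measure E)
    {C : Subalgebra ℝ (E → ℝ)} {B G : Set (E → ℝ)} (hB : ReducesProducts C B)
    (hG : ∀ f ∈ G, ∃ g ∈ productSpan C (insert 1 B), f =ᵐ[μ] g) {f : E → ℝ}
    (hf : f ∈ Algebra.adjoin ℝ G) : ∃ g ∈ productSpan C (insert 1 B), f =ᵐ[μ] g := by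
  induction hf using Algebra.adjoin_induction with
  | mem x hx => exact hG x hx
  | algebraMap r =>
    refine ⟨_, ?_, ae_eq_refl _⟩
    rw [← mul_one (algebraMap ℝ (E → ℝ) r)]
    exact mul_mem_productSpan (Subalgebra.algebraMap_mem _ _) (Set.mem_insert _ _)
  | add x y _ _ hx hy =>
    obtain ⟨g, hg, hxg⟩ := hx
    obtain ⟨g', hg', hyg⟩ := hy
    exact ⟨_, add_mem hg hg', hxg.add hyg⟩
  | mul x y _ _ hx hy =>
    obtain ⟨g, hg, hxg⟩ := hx
    obtain ⟨g', hg', hyg⟩ := hy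
    exact ⟨_, productSpan_mul_mem (fun b hb b' hb' => hB.insert_one.mul_mem hb hb') hg hg',
      hxg.mul hyg⟩

open Module (finrank)

section Halfspaces

variable {E : Type*} [NormedAddCommGroup E] [InnerProductSpace ℝ E]

/-- The indicator function of the half-space `{y | t ≤ ⟪v, y⟫}`. -/
noncomputable def halfInd (v : E) (t : ℝ) : E → ℝ := Set.indicator {y | t ≤ inner ℝ v y} 1

lemma halfInd_apply (v : E) (t : ℝ) (y : E) [Decidable (t ≤ inner ℝ v y)] :
    halfInd v t y = if t ≤ inner ℝ v y then 1 else 0 := by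
  simp [halfInd, Set.indicator_apply]

variable (E) in
/-- The algebra generated by the indicator functions of affine half-spaces. -/
noncomputable def polyAlg : Subalgebra ℝ (E → ℝ) := Algebra.adjoin ℝ {f | ∃ v t, f = halfInd v t}

variable (E) in
/-- The algebra generated by the indicator functions of linear half-spaces. -/
noncomputable def coneAlg : Subalgebra ℝ (E → ℝ) := Algebra.adjoin ℝ {f | ∃ v, f = halfInd v 0}

/-- The algebra generated by the indicator functions of half-spaces parallel to `e`. -/
noncomputable def parallelAlg (e : E) : Subalgebra ℝ (E → ℝ) :=
  Algebra.adjoin ℝ {f | ∃ v t, inner ℝ v e = 0 ∧ f = halfInd v t}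

lemma halfInd_mem_polyAlg (v : E) (t : ℝ) : halfInd v t ∈ polyAlg E :=
  Algebra.subset_adjoin ⟨v, t, rfl⟩

lemma coneAlg_le_polyAlg : coneAlg E ≤ polyAlg E :=
  Algebra.adjoin_mono fun _ ⟨v, hv⟩ => ⟨v, 0, hv⟩

lemma parallelAlg_le_polyAlg (e : E) : parallelAlg e ≤ polyAlg E :=
  Algebra.adjoin_mono fun _ ⟨v, t, _, hv⟩ => ⟨v, t, hv⟩

lemma coneAlg_apply_smul {β : E → ℝ} (hβ : β ∈ coneAlg E) {r : ℝ} (hr : 0 < r) (y : E) :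
    β (r • y) = β y := by
  classical
  induction hβ using Algebra.adjoin_induction with
  | mem x hx =>
    obtain ⟨v, rfl⟩ := hx
    simp [halfInd_apply, inner_smul_right, mul_nonneg_iff_of_pos_left hr]
  | algebraMap r => rfl
  | add f g _ _ hf hg => simp [hf, hg]
  | mul f g _ _ hf hg => simp [hf, hg]

lemma parallelAlg_apply_add {e : E} {β : E → ℝ} (hβ : β ∈ parallelAlg e) (h : ℝ) (y : E) :
    β (h • e + y) = β y := by
  classical
  induction hβ using Algebra.adjoin_induction with
  | mem x hx =>
    obtain ⟨v, t, hv, rfl⟩ := hx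
    simp [halfInd_apply, inner_add_right, inner_smul_right, hv]
  | algebraMap r => rfl
  | add f g _ _ hf hg => simp [hf, hg]
  | mul f g _ _ hf hg => simp [hf, hg]

lemma exists_abs_le_of_mem_polyAlg {α : E → ℝ} (hα : α ∈ polyAlg E) : ∃ C, ∀ y, |α y| ≤ C := by
  classical
  induction hα using Algebra.adjoin_induction with
  | mem x hx =>
    obtain ⟨v, t, rfl⟩ := hx
    refine ⟨1, fun y => ?_⟩
    rw [halfInd_apply]
    split_ifs <;> simp
  | algebraMap r => exact ⟨|r|, fun y => le_rfl⟩
  | add f g _ _ hf hg =>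
    obtain ⟨C, hC⟩ := hf
    obtain ⟨D, hD⟩ := hg
    exact ⟨C + D, fun y => (abs_add_le _ _).trans (add_le_add (hC y) (hD y))⟩
  | mul f g _ _ hf hg =>
    obtain ⟨C, hC⟩ := hf
    obtain ⟨D, hD⟩ := hg
    refine ⟨C * D, fun y => ?_⟩
    rw [Pi.mul_apply, abs_mul]
    exact mul_le_mul (hC y) (hD y) (abs_nonneg _) ((abs_nonneg _).trans (hC y))

lemma measurable_of_mem_polyAlg [MeasurableSpace E] [BorelSpace E] {α : E → ℝ}
    (hα : α ∈ polyAlg E) : Measurable α := by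
  induction hα using Algebra.adjoin_induction with
  | mem x hx =>
    obtain ⟨v, t, rfl⟩ := hx
    refine measurable_one.indicator (isClosed_le continuous_const ?_).measurableSet
    fun_prop
  | algebraMap r => exact measurable_const
  | add f g _ _ hf hg => exact hf.add hg
  | mul f g _ _ hf hg => exact hf.mul hg

lemma comp_affine_mem_polyAlg {F : Type*} [NormedAddCommGroup F] [InnerProductSpace ℝ F]
    [CompleteSpace E] [CompleteSpace F] (p : E) (L : F →L[ℝ] E) {α : E → ℝ} (hα : α ∈ polyAlg E) :
    (fun z => α (p + L z)) ∈ polyAlg F := by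
  classical
  induction hα using Algebra.adjoin_induction with
  | mem x hx =>
    obtain ⟨v, t, rfl⟩ := hx
    convert! halfInd_mem_polyAlg (L.adjoint v) (t - inner ℝ v p) using 1
    ext z
    simp only [halfInd_apply, inner_add_right, ContinuousLinearMap.adjoint_inner_left,
      sub_le_iff_le_add']
  | algebraMap r => exact Subalgebra.algebraMap_mem _ r
  | add f g _ _ hf hg => exact add_mem hf hg
  | mul f g _ _ hf hg => exact mul_mem hf hg

lemma reducesProducts_halfInd_one :
    ReducesProducts (coneAlg E) {f | ∃ v, f = halfInd v 1} := by
  classical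
  rintro _ ⟨v, rfl⟩ _ ⟨u, rfl⟩
  refine ⟨halfInd (u - v) 0, Algebra.subset_adjoin ⟨_, rfl⟩, ?_⟩
  ext y
  simp only [Pi.mul_apply, Pi.add_apply, Pi.sub_apply, Pi.one_apply, halfInd_apply,
    inner_sub_left, sub_nonneg]
  split_ifs <;> first | (exfalso; linarith) | norm_num

lemma norm_sq_smul_add {e : E} (he : ‖e‖ = 1) (h : ℝ) (z : (ℝ ∙ e)ᗮ) :
    ‖h • e + (z : E)‖ ^ 2 = h ^ 2 + ‖z‖ ^ 2 := by
  have hz : inner ℝ e (z : E) = 0 := Submodule.mem_orthogonal_singleton_iff_inner_right.1 z.2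
  rw [norm_add_sq_real, inner_smul_left, hz, norm_smul, he]
  simp

lemma inner_smul_add {e : E} (he : ‖e‖ = 1) (h : ℝ) (z : (ℝ ∙ e)ᗮ) :
    inner ℝ e (h • e + (z : E)) = h := by
  have hz : inner ℝ e (z : E) = 0 := Submodule.mem_orthogonal_singleton_iff_inner_right.1 z.2
  rw [inner_add_right, inner_smul_right, hz, real_inner_self_eq_norm_sq, he]
  simp

variable [MeasurableSpace E] [BorelSpace E] [FiniteDimensional ℝ E]

lemma ae_inner_ne {v : E} (hv : v ≠ 0) (t : ℝ) : ∀ᵐ y : E, inner ℝ v y ≠ t := by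
  let s : AffineSubspace ℝ E := AffineSubspace.mk' ((t / ‖v‖ ^ 2) • v) (ℝ ∙ v)ᗮ
  have hs : s ≠ ⊤ := by
    intro h
    have h1 : s.direction = ⊤ := by rw [h, AffineSubspace.direction_top]
    rw [AffineSubspace.direction_mk'] at h1
    have h2 : v ∈ (ℝ ∙ v)ᗮ := h1 ▸ Submodule.mem_top
    rw [Submodule.mem_orthogonal_singleton_iff_inner_right, inner_self_eq_zero] at h2
    exact hv h2
  refine measure_mono_null (fun y hy => ?_) (Measure.addHaar_affineSubspace volume s hs)
  have hy : inner ℝ v y = t := by simpa using hy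
  have hv2 : ‖v‖ ^ 2 ≠ 0 := by positivity
  rw [SetLike.mem_coe, AffineSubspace.mem_mk', vsub_eq_sub,
    Submodule.mem_orthogonal_singleton_iff_inner_right, inner_sub_right, inner_smul_right, hy,
    real_inner_self_eq_norm_sq, div_mul_cancel₀ _ hv2, sub_self]

lemma exists_mem_productSpan_ae_eq_of_mem_polyAlg {α : E → ℝ} (hα : α ∈ polyAlg E) :
    ∃ g ∈ productSpan (coneAlg E) (insert 1 {f | ∃ v, f = halfInd v 1}), α =ᵐ[volume] g := by
  classical
  refine exists_mem_productSpan_ae_eq volume reducesProducts_halfInd_one ?_ hα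
  rintro _ ⟨v, t, rfl⟩
  rcases lt_trichotomy t 0 with ht | rfl | ht
  · refine ⟨1 * 1 - 1 * halfInd (t⁻¹ • v) 1, sub_mem
      (mul_mem_productSpan (one_mem _) (Set.mem_insert _ _))
      (mul_mem_productSpan (one_mem _) (Set.mem_insert_of_mem _ ⟨_, rfl⟩)), ?_⟩
    have hne : ∀ᵐ y : E, inner ℝ v y ≠ t := by
      rcases eq_or_ne v 0 with rfl | hv
      · simp [ht.ne']
      · exact ae_inner_ne hv t
    filter_upwards [hne] with y hy
    have : 1 ≤ t⁻¹ * inner ℝ v y ↔ ¬ t ≤ inner ℝ v y := by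
      rw [not_le, ← div_eq_inv_mul, one_le_div_of_neg ht]
      exact ⟨fun h => lt_of_le_of_ne h hy, le_of_lt⟩
    simp only [Pi.mul_apply, Pi.sub_apply, Pi.one_apply, halfInd_apply, inner_smul_left,
      RCLike.conj_to_real, this]
    split_ifs <;> simp
  · exact ⟨halfInd v 0 * 1, mul_mem_productSpan (Algebra.subset_adjoin ⟨v, rfl⟩)
      (Set.mem_insert _ _), by simp⟩
  · refine ⟨1 * halfInd (t⁻¹ • v) 1,
      mul_mem_productSpan (one_mem _) (Set.mem_insert_of_mem _ ⟨_, rfl⟩), ae_of_all _ fun y => ?_⟩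
    have : 1 ≤ t⁻¹ * inner ℝ v y ↔ t ≤ inner ℝ v y := by
      rw [← div_eq_inv_mul, one_le_div ht]
    simp only [Pi.mul_apply, Pi.one_apply, halfInd_apply, inner_smul_left,
      RCLike.conj_to_real, this, one_mul]

/-- The map `(h, z) ↦ h • e + z` identifies `ℝ × eᗮ` with the whole space. -/
lemma exists_measurableEquiv_orthogonal {e : E} (he : ‖e‖ = 1) :
    ∃ Φ : ℝ × (ℝ ∙ e)ᗮ ≃ᵐ E, MeasurePreserving Φ (volume.prod volume) volume ∧
      ∀ q, Φ q = q.1 • e + q.2 := by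
  let Φ₁ := (LinearIsometryEquiv.toSpanUnitSingleton (𝕜 := ℝ) e he).toMeasurableEquiv.prodCongr
    (MeasurableEquiv.refl (ℝ ∙ e)ᗮ)
  let Φ₂ := MeasurableEquiv.toLp 2 ((ℝ ∙ e) × (ℝ ∙ e)ᗮ)
  let Φ₃ := (ℝ ∙ e).orthogonalDecomposition.symm.toMeasurableEquiv
  refine ⟨Φ₁.trans (Φ₂.trans Φ₃), ?_, fun q => ?_⟩
  · refine MeasurePreserving.trans (μb := volume) ?_
      (MeasurePreserving.trans (WithLp.volume_preserving_toLp _ _)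
        (LinearIsometryEquiv.measurePreserving _))
    have hspan : MeasurePreserving (LinearIsometryEquiv.toSpanUnitSingleton (𝕜 := ℝ) e he) :=
      LinearIsometryEquiv.measurePreserving _
    exact hspan.prod (MeasurePreserving.id (volume : Measure (ℝ ∙ e)ᗮ))
  · simp only [Φ₁, Φ₂, Φ₃, MeasurableEquiv.trans_apply]
    simp
    rfl

lemma integral_eq_integral_slices {G : Type*} [NormedAddCommGroup G] [NormedSpace ℝ G] {e : E}
    (he : ‖e‖ = 1) {F : E → G} (hF : Integrable F) :
    Integrable (fun h : ℝ => ∫ z : (ℝ ∙ e)ᗮ, F (h • e + z)) ∧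
      ∫ y, F y = ∫ h : ℝ, ∫ z : (ℝ ∙ e)ᗮ, F (h • e + z) := by
  obtain ⟨Φ, hΦ, hΦe⟩ := exists_measurableEquiv_orthogonal he
  have hF' : Integrable (fun q : ℝ × (ℝ ∙ e)ᗮ => F (q.1 • e + q.2)) (volume.prod volume) := by
    have := (hΦ.integrable_comp_emb Φ.measurableEmbedding).2 hF
    simpa only [Function.comp_def, hΦe] using this
  refine ⟨hF'.integral_prod_left, ?_⟩
  rw [← hΦ.integral_comp Φ.measurableEmbedding]
  simp only [hΦe]
  exact integral_prod _ hF'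

end Halfspaces

lemma measurableSet_norm_sq_lt {E : Type*} [NormedAddCommGroup E] [MeasurableSpace E]
    [BorelSpace E] (w : ℝ) : MeasurableSet {y : E | ‖y‖ ^ 2 < w} :=
  (isOpen_lt (by fun_prop) continuous_const).measurableSet

section BallIntegral

variable {E : Type*} [NormedAddCommGroup E] [InnerProductSpace ℝ E] [MeasurableSpace E]
  [BorelSpace E] [FiniteDimensional ℝ E]

/-- The integral of `α` over the centered ball of squared radius `w`. -/
noncomputable def ballIntegral (α : E → ℝ) (w : ℝ) : ℝ := ∫ y in {y : E | ‖y‖ ^ 2 < w}, α y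

lemma volume_norm_sq_lt_ne_top (w : ℝ) : volume {y : E | ‖y‖ ^ 2 < w} ≠ ⊤ := by
  refine ne_top_of_le_ne_top (measure_closedBall_lt_top (x := (0 : E)) (r := √w)).ne
    (measure_mono fun y hy => ?_)
  rw [mem_closedBall_zero_iff]
  exact Real.le_sqrt_of_sq_le (le_of_lt hy)

lemma integrableOn_of_mem_polyAlg {α : E → ℝ} (hα : α ∈ polyAlg E) {s : Set E}
    (hs : volume s ≠ ⊤) : IntegrableOn α s := by
  obtain ⟨C, hC⟩ := exists_abs_le_of_mem_polyAlg hα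
  exact Measure.integrableOn_of_bounded hs (measurable_of_mem_polyAlg hα).aestronglyMeasurable
    (ae_of_all _ hC)

lemma ballIntegral_of_nonpos (α : E → ℝ) {w : ℝ} (hw : w ≤ 0) : ballIntegral α w = 0 := by
  have : {y : E | ‖y‖ ^ 2 < w} = ∅ :=
    Set.eq_empty_of_forall_notMem fun y hy => (hw.trans (sq_nonneg ‖y‖)).not_gt hy
  simp [ballIntegral, this]

open scoped Pointwise in
lemma ballIntegral_eq_sqrt_pow_mul (α : E → ℝ) {w : ℝ} (hw : 0 < w) :
    ballIntegral α w = √w ^ finrank ℝ E * ∫ y in {y : E | ‖y‖ ^ 2 < 1}, α (√w • y) := by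
  have hs : 0 < √w := Real.sqrt_pos.2 hw
  have hset : √w • {y : E | ‖y‖ ^ 2 < 1} = {y : E | ‖y‖ ^ 2 < w} := by
    ext y
    rw [Set.mem_smul_set_iff_inv_smul_mem₀ hs.ne', Set.mem_ofPred_eq, Set.mem_ofPred_eq,
      norm_smul, mul_pow, norm_inv, Real.norm_of_nonneg hs.le, inv_pow, Real.sq_sqrt hw.le,
      ← div_eq_inv_mul, div_lt_one hw]
  rw [Measure.setIntegral_comp_smul_of_pos _ _ _ hs, hset, smul_eq_mul,
    mul_inv_cancel_left₀ (pow_pos hs _).ne', ballIntegral]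

lemma slice_eq_pow_mul_ballIntegral {e : E} (he : ‖e‖ = 1) {β : E → ℝ} (hβ : β ∈ coneAlg E)
    {h : ℝ} (hh : 0 < h) :
    ∫ z : (ℝ ∙ e)ᗮ, {y : E | ‖y‖ ^ 2 < 1}.indicator β (h • e + z) =
      h ^ finrank ℝ (ℝ ∙ e)ᗮ *
        ballIntegral (fun z : (ℝ ∙ e)ᗮ => β (e + z)) ((h ^ 2)⁻¹ - 1) := by
  have hpt : ∀ z : (ℝ ∙ e)ᗮ, {y : E | ‖y‖ ^ 2 < 1}.indicator β (h • e + z) =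
      {z : (ℝ ∙ e)ᗮ | ‖z‖ ^ 2 < (h ^ 2)⁻¹ - 1}.indicator (fun z => β (e + z)) (h⁻¹ • z) := by
    intro z
    have hz : h • e + (z : E) = h • (e + (h⁻¹ • z : (ℝ ∙ e)ᗮ)) := by
      rw [smul_add, Submodule.coe_smul, smul_inv_smul₀ hh.ne']
    have hiff : (h • e + (z : E)) ∈ {y : E | ‖y‖ ^ 2 < 1} ↔
        h⁻¹ • z ∈ {z : (ℝ ∙ e)ᗮ | ‖z‖ ^ 2 < (h ^ 2)⁻¹ - 1} := by
      rw [Set.mem_ofPred_eq, Set.mem_ofPred_eq, norm_sq_smul_add he, norm_smul, mul_pow, norm_inv,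
        Real.norm_of_nonneg hh.le, inv_pow, lt_sub_iff_add_lt]
      have : (h ^ 2)⁻¹ * ‖z‖ ^ 2 + 1 = (h ^ 2)⁻¹ * (h ^ 2 + ‖z‖ ^ 2) := by
        field_simp
        ring
      rw [this, mul_lt_iff_lt_one_right (inv_pos.2 (pow_pos hh 2))]
    by_cases hm : (h • e + (z : E)) ∈ {y : E | ‖y‖ ^ 2 < 1}
    · rw [Set.indicator_of_mem hm, Set.indicator_of_mem (hiff.1 hm), hz, coneAlg_apply_smul hβ hh]
    · rw [Set.indicator_of_notMem hm, Set.indicator_of_notMem (fun h' => hm (hiff.2 h'))]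
  simp only [hpt]
  rw [Measure.integral_comp_inv_smul_of_nonneg _ _ hh.le,
    integral_indicator (measurableSet_norm_sq_lt _), smul_eq_mul, ballIntegral]

lemma integrable_indicator_ball {β : E → ℝ} (hβ : β ∈ polyAlg E) (w : ℝ) :
    Integrable ({y : E | ‖y‖ ^ 2 < w}.indicator β) :=
  (integrable_indicator_iff (measurableSet_norm_sq_lt w)).2
    (integrableOn_of_mem_polyAlg hβ (volume_norm_sq_lt_ne_top w))

lemma ballIntegral_mul_halfInd {e : E} (he : ‖e‖ = 1) {a : ℝ} (ha : 0 < a) {β : E → ℝ}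
    (hβ : β ∈ coneAlg E) {w : ℝ} (hw : 0 < w) :
    ballIntegral (β * halfInd (a • e) 1) w = √w ^ finrank ℝ E *
      ∫ h in Set.Ioi (√w * a)⁻¹,
        ∫ z : (ℝ ∙ e)ᗮ, {y : E | ‖y‖ ^ 2 < 1}.indicator β (h • e + z) := by
  classical
  have hs : 0 < √w := Real.sqrt_pos.2 hw
  set S : Set E := {y : E | ‖y‖ ^ 2 < 1}
  have hhalf : ∀ y : E, halfInd (a • e) 1 (√w • y) = halfInd e (√w * a)⁻¹ y := by
    intro y
    have : 1 ≤ √w * (a * inner ℝ e y) ↔ (√w * a)⁻¹ ≤ inner ℝ e y := by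
      rw [← mul_assoc, inv_le_iff_one_le_mul₀' (mul_pos hs ha)]
    simp [halfInd_apply, inner_smul_left, inner_smul_right, this]
  have hint : Integrable (fun y => S.indicator β y * halfInd e (√w * a)⁻¹ y) := by
    have := integrable_indicator_ball
      (mul_mem (coneAlg_le_polyAlg hβ) (halfInd_mem_polyAlg e (√w * a)⁻¹)) 1
    refine this.congr (ae_of_all _ fun y => ?_)
    exact Set.indicator_mul_left S β (halfInd e (√w * a)⁻¹)
  rw [ballIntegral_eq_sqrt_pow_mul _ hw, ← integral_indicator (measurableSet_norm_sq_lt 1)]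
  congr 1
  calc ∫ y, S.indicator (fun y => (β * halfInd (a • e) 1) (√w • y)) y
      = ∫ y, S.indicator β y * halfInd e (√w * a)⁻¹ y := by
        congr 1
        ext y
        rw [← Set.indicator_mul_left S β (halfInd e (√w * a)⁻¹)]
        simp only [Pi.mul_apply, hhalf, coneAlg_apply_smul hβ hs]
    _ = ∫ h : ℝ, (Set.Ici (√w * a)⁻¹).indicator
          (fun h => ∫ z : (ℝ ∙ e)ᗮ, S.indicator β (h • e + z)) h := by
        rw [(integral_eq_integral_slices he hint).2]
        congr 1
        ext h
        simp only [halfInd_apply, inner_smul_add he, integral_mul_const]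
        simp [Set.indicator_apply]
    _ = _ := by rw [integral_indicator measurableSet_Ici, integral_Ici_eq_integral_Ioi]

lemma smoothGermWithin_ballIntegral_mul_halfInd {e : E} (he : ‖e‖ = 1) {a : ℝ} (ha : 0 < a)
    {β : E → ℝ} (hβ : β ∈ coneAlg E) {k : ℕ}
    (ih : ∀ w, SmoothGermWithin (Set.Iio w) k
      (ballIntegral (fun z : (ℝ ∙ e)ᗮ => β (e + z))) w) {w : ℝ} (hw : 0 < w) :
    SmoothGermWithin (Set.Iio w) k (ballIntegral (β * halfInd (a • e) 1)) w := by
  have hsq : 0 < √w := Real.sqrt_pos.2 hw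
  set κ : ℝ → ℝ := fun h => ∫ z : (ℝ ∙ e)ᗮ, {y : E | ‖y‖ ^ 2 < 1}.indicator β (h • e + z)
  have hκ : Integrable κ := (integral_eq_integral_slices he
    (integrable_indicator_ball (coneAlg_le_polyAlg hβ) 1)).1
  set θ : ℝ → ℝ := fun w => (√w * a)⁻¹ with hθ
  have hθ0 : 0 < θ w := inv_pos.2 (mul_pos hsq ha)
  have hκgerm : SmoothGermWithin (Set.Ioi (θ w)) k κ (θ w) := by
    have hpow : SmoothGermWithin (Set.Ioi (θ w)) k (fun h => h ^ finrank ℝ (ℝ ∙ e)ᗮ) (θ w) :=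
      ⟨_, contDiff_id.pow _, EventuallyEq.rfl⟩
    have hcomp : SmoothGermWithin (Set.Ioi (θ w)) k (fun h =>
        ballIntegral (fun z : (ℝ ∙ e)ᗮ => β (e + z)) ((h ^ 2)⁻¹ - 1)) (θ w) := by
      have hsm : ContDiffAt ℝ k (fun h : ℝ => (h ^ 2)⁻¹ - 1) (θ w) :=
        ((contDiffAt_id.pow 2).inv (pow_pos hθ0 2).ne').sub contDiffAt_const
      refine (ih _).comp hsm (tendsto_nhdsWithin_of_tendsto_nhds_of_eventually_within _
        (hsm.continuousAt.tendsto.mono_left nhdsWithin_le_nhds) ?_)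
      filter_upwards [self_mem_nhdsWithin] with h hh
      have hh : θ w < h := hh
      show (h ^ 2)⁻¹ - 1 < (θ w ^ 2)⁻¹ - 1
      gcongr
    refine (hpow.mul hcomp).congr ?_
    filter_upwards [self_mem_nhdsWithin] with h hh
    exact slice_eq_pow_mul_ballIntegral he hβ (hθ0.trans hh)
  have hsqrt : ContDiffAt ℝ k (fun w => √w) w := Real.contDiffAt_sqrt hw.ne'
  have hθsm : ContDiffAt ℝ k θ w :=
    (hsqrt.mul contDiffAt_const).inv (mul_pos hsq ha).ne'
  have htail := (SmoothGermWithin.integral_Ioi hκ hκgerm).comp (s := Set.Iio w) hθsm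
    (tendsto_nhdsWithin_of_tendsto_nhds_of_eventually_within _
      (hθsm.continuousAt.tendsto.mono_left nhdsWithin_le_nhds) (by
        filter_upwards [Ioo_mem_nhdsLT hw] with u hu
        have h1 : 0 < √u := Real.sqrt_pos.2 hu.1
        have h2 : √u < √w := Real.sqrt_lt_sqrt hu.1.le hu.2
        show (√w * a)⁻¹ < (√u * a)⁻¹
        gcongr))
  refine ((SmoothGermWithin.of_contDiffAt (hsqrt.pow (finrank ℝ E))
    EventuallyEq.rfl).mul htail).congr ?_
  filter_upwards [Ioo_mem_nhdsLT hw] with u hu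
  exact ballIntegral_mul_halfInd he ha hβ hu.1

lemma smoothGermWithin_ballIntegral_of_mem_coneAlg {β : E → ℝ} (hβ : β ∈ coneAlg E) (k : ℕ)
    {w : ℝ} (hw : 0 < w) : SmoothGermWithin (Set.Iio w) k (ballIntegral β) w := by
  refine .of_contDiffAt (φ := fun w => √w ^ finrank ℝ E * ∫ y in {y : E | ‖y‖ ^ 2 < 1}, β y)
    (((Real.contDiffAt_sqrt hw.ne').pow _).mul contDiffAt_const) ?_
  filter_upwards [Ioo_mem_nhdsLT hw] with u hu
  rw [ballIntegral_eq_sqrt_pow_mul _ hu.1]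
  simp only [coneAlg_apply_smul hβ (Real.sqrt_pos.2 hu.1)]

lemma ballIntegral_add {α α' : E → ℝ} (hα : α ∈ polyAlg E) (hα' : α' ∈ polyAlg E) (w : ℝ) :
    ballIntegral (α + α') w = ballIntegral α w + ballIntegral α' w :=
  integral_add (integrableOn_of_mem_polyAlg hα (volume_norm_sq_lt_ne_top w))
    (integrableOn_of_mem_polyAlg hα' (volume_norm_sq_lt_ne_top w))

lemma ballIntegral_smul (c : ℝ) (α : E → ℝ) (w : ℝ) :
    ballIntegral (c • α) w = c * ballIntegral α w :=
  integral_const_mul c α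

lemma ballIntegral_congr_ae {α α' : E → ℝ} (h : α =ᵐ[volume] α') :
    ballIntegral α = ballIntegral α' :=
  funext fun _ => integral_congr_ae (ae_restrict_of_ae h)

end BallIntegral

/-- The integral of a polyhedral function over a centered ball is, as a function of the squared
radius, smooth from the left at every point. -/
theorem smoothGermWithin_ballIntegral (m : ℕ) : ∀ {E : Type*} [NormedAddCommGroup E]
    [InnerProductSpace ℝ E] [MeasurableSpace E] [BorelSpace E] [FiniteDimensional ℝ E],
    finrank ℝ E = m → ∀ {α : E → ℝ}, α ∈ polyAlg E → ∀ (k : ℕ) (w : ℝ),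
    SmoothGermWithin (Set.Iio w) k (ballIntegral α) w := by
  induction m using Nat.strong_induction_on with
  | _ m ih =>
  intro E _ _ _ _ _ hE α hα k w
  rcases le_or_gt w 0 with hw | hw
  · refine ⟨fun _ => 0, contDiff_const, ?_⟩
    filter_upwards [self_mem_nhdsWithin] with u hu
    exact ballIntegral_of_nonpos α (le_of_lt (lt_of_lt_of_le hu hw))
  obtain ⟨g, hg, hαg⟩ := exists_mem_productSpan_ae_eq_of_mem_polyAlg hα
  rw [ballIntegral_congr_ae hαg]
  clear hαg
  suffices g ∈ polyAlg E ∧ SmoothGermWithin (Set.Iio w) k (ballIntegral g) w from this.2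
  induction hg using Submodule.span_induction with
  | mem x hx =>
    obtain ⟨β, hβ, b, rfl | ⟨v, rfl⟩, rfl⟩ := hx
    · rw [mul_one]
      exact ⟨coneAlg_le_polyAlg hβ, smoothGermWithin_ballIntegral_of_mem_coneAlg hβ k hw⟩
    · refine ⟨mul_mem (coneAlg_le_polyAlg hβ) (halfInd_mem_polyAlg v 1), ?_⟩
      rcases eq_or_ne v 0 with rfl | hv
      · have h0 : β * halfInd (0 : E) 1 = 0 := by
          classical
          ext y
          simp [halfInd_apply]
        rw [h0]
        exact smoothGermWithin_ballIntegral_of_mem_coneAlg (zero_mem _) k hw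
      · have hv0 : 0 < ‖v‖ := norm_pos_iff.2 hv
        obtain ⟨e, he, hve⟩ : ∃ e : E, ‖e‖ = 1 ∧ v = ‖v‖ • e :=
          ⟨‖v‖⁻¹ • v, norm_smul_inv_norm (𝕜 := ℝ) hv, (smul_inv_smul₀ hv0.ne' v).symm⟩
        have he0 : e ≠ 0 := norm_ne_zero_iff.1 (by rw [he]; exact one_ne_zero)
        have hdim := (ℝ ∙ e).finrank_add_finrank_orthogonal
        rw [finrank_span_singleton he0, hE] at hdim
        rw [hve]
        exact smoothGermWithin_ballIntegral_mul_halfInd he hv0 hβ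
          (fun u => ih _ (by omega) rfl
            (comp_affine_mem_polyAlg e (ℝ ∙ e)ᗮ.subtypeL (coneAlg_le_polyAlg hβ)) k u) hw
  | zero =>
    exact ⟨zero_mem _, smoothGermWithin_ballIntegral_of_mem_coneAlg (zero_mem _) k hw⟩
  | add f g _ _ hf hg =>
    refine ⟨add_mem hf.1 hg.1, (hf.2.add hg.2).congr (Eventually.of_forall fun u => ?_)⟩
    exact ballIntegral_add hf.1 hg.1 u
  | smul c f _ hf =>
    refine ⟨Subalgebra.smul_mem _ hf.1 c, ?_⟩
    refine (SmoothGermWithin.mul ⟨fun _ => c, contDiff_const, EventuallyEq.rfl⟩ hf.2).congr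
      (Eventually.of_forall fun u => ?_)
    exact ballIntegral_smul c f u

section BallIndicators

variable {E : Type*} [NormedAddCommGroup E]

/-- The indicator function of the open ball with center `c` and squared radius `w`. -/
noncomputable def ballInd (c : E) (w : ℝ) : E → ℝ := Set.indicator {y | ‖y - c‖ ^ 2 < w} 1

lemma ballInd_apply (c : E) (w : ℝ) (y : E) [Decidable (‖y - c‖ ^ 2 < w)] :
    ballInd c w y = if ‖y - c‖ ^ 2 < w then 1 else 0 := by
  simp [ballInd, Set.indicator_apply]

lemma indicator_ball_eq_ballInd (c : E) {r : ℝ} (hr : 0 < r) :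
    (ball c r).indicator 1 = ballInd c (r ^ 2) := by
  have : ball c r = {y | ‖y - c‖ ^ 2 < r ^ 2} := by
    ext y
    rw [mem_ball, dist_eq_norm, Set.mem_ofPred_eq, sq_lt_sq₀ (norm_nonneg _) hr.le]
  rw [ballInd, this]

variable [InnerProductSpace ℝ E]

/-- The indicator functions of the balls whose center is orthogonal to `e`. -/
def centeredBalls (e : E) : Set (E → ℝ) := {f | ∃ c w, inner ℝ e c = 0 ∧ f = ballInd c w}

lemma reducesProducts_centeredBalls (e : E) :
    ReducesProducts (parallelAlg e) (centeredBalls e) := by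
  classical
  rintro _ ⟨c, w, hc, rfl⟩ _ ⟨c', w', hc', rfl⟩
  refine ⟨halfInd ((2 : ℝ) • (c' - c)) (w - w' + ‖c'‖ ^ 2 - ‖c‖ ^ 2), Algebra.subset_adjoin
    ⟨_, _, ?_, rfl⟩, ?_⟩
  · rw [real_inner_comm, inner_smul_right, inner_sub_right, hc, hc']
    simp
  · ext y
    have h1 := norm_sub_sq_real y c
    have h2 := norm_sub_sq_real y c'
    have h3 : inner ℝ ((2 : ℝ) • (c' - c)) y = 2 * (inner ℝ y c' - inner ℝ y c) := by
      rw [real_inner_comm, inner_smul_right, inner_sub_right]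
    simp only [Pi.mul_apply, Pi.add_apply, Pi.sub_apply, Pi.one_apply, halfInd_apply,
      ballInd_apply, h3]
    split_ifs <;> first | (exfalso; linarith) | norm_num

variable [MeasurableSpace E] [BorelSpace E] [FiniteDimensional ℝ E]

lemma integrable_mul_ballInd {β : E → ℝ} (hβ : β ∈ polyAlg E) (c : E) (w : ℝ) :
    Integrable (β * ballInd c w) := by
  have h := (integrable_indicator_ball (comp_affine_mem_polyAlg c (.id ℝ E) hβ) w).comp_sub_right c
  refine h.congr (ae_of_all _ fun y => ?_)
  classical
  simp [Set.indicator_apply, ballInd_apply]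

lemma integral_slice_mul_ballInd {e : E} (he : ‖e‖ = 1) {β : E → ℝ} (hβ : β ∈ parallelAlg e)
    (c : (ℝ ∙ e)ᗮ) (w h : ℝ) :
    ∫ z : (ℝ ∙ e)ᗮ, (β * ballInd (c : E) w) (h • e + z) =
      ballIntegral (fun z : (ℝ ∙ e)ᗮ => β (c + z)) (w - h ^ 2) := by
  classical
  rw [ballIntegral, ← integral_indicator (measurableSet_norm_sq_lt _),
    ← integral_add_left_eq_self (fun z : (ℝ ∙ e)ᗮ =>
      (β * ballInd (c : E) w) (h • e + z)) c]
  congr 1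
  ext z
  have hz : h • e + ((c : E) + z) - c = h • e + z := by abel
  simp only [Pi.mul_apply, parallelAlg_apply_add hβ, ballInd_apply, hz, norm_sq_smul_add he,
    Set.indicator_apply, Set.mem_ofPred_eq, lt_sub_iff_add_lt', Submodule.coe_add, mul_ite,
    mul_one, mul_zero]

lemma integrable_ofReal_mul_kernel (e : E) {f : E → ℝ} (hf : Integrable f) {ε : ℝ} (hε : 0 < ε)
    (k : ℕ) :
    Integrable fun x => (f x : ℂ) * ((inner ℝ e x : ℂ) - (ε : ℂ) * Complex.I) ^ (-(k : ℤ)) := by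
  refine hf.ofReal.mul_bdd (c := (ε ^ k)⁻¹) ?_ (ae_of_all _ fun x => norm_kernel_le hε _ k)
  have hinner : Continuous fun x : E => inner ℝ e x := by fun_prop
  exact ((continuous_kernel hε _).comp hinner).aestronglyMeasurable

lemma exists_tendsto_integral_mul_ballInd {e : E} (he : ‖e‖ = 1) {β : E → ℝ}
    (hβ : β ∈ parallelAlg e) {c : E} (hc : inner ℝ e c = 0) (w : ℝ) {k : ℕ} (hk : k ≠ 0) :
    ∃ L : ℂ, Tendsto (fun ε : ℝ => ∫ x, ((β * ballInd c w) x : ℂ) *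
      ((inner ℝ e x : ℂ) - (ε : ℂ) * Complex.I) ^ (-(k : ℤ))) (𝓝[>] 0) (𝓝 L) := by
  lift c to (ℝ ∙ e)ᗮ using Submodule.mem_orthogonal_singleton_iff_inner_right.2 hc
  have hint := integrable_mul_ballInd (parallelAlg_le_polyAlg e hβ) (c : E) w
  set f : ℝ → ℝ := fun h => ballIntegral (fun z : (ℝ ∙ e)ᗮ => β (c + z)) (w - h ^ 2)
  have hfint : Integrable f := by
    simpa only [integral_slice_mul_ballInd he hβ] using (integral_eq_integral_slices he hint).1
  obtain ⟨φ, hφ, hfφ⟩ : SmoothGermWithin {0}ᶜ k f 0 := by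
    have hsm : ContDiffAt ℝ k (fun h : ℝ => w - h ^ 2) 0 :=
      contDiffAt_const.sub (contDiffAt_id.pow 2)
    refine (smoothGermWithin_ballIntegral _ rfl (comp_affine_mem_polyAlg (c : E)
      (ℝ ∙ e)ᗮ.subtypeL (parallelAlg_le_polyAlg e hβ)) k _).comp hsm
      (tendsto_nhdsWithin_of_tendsto_nhds_of_eventually_within _
        (hsm.continuousAt.tendsto.mono_left nhdsWithin_le_nhds) ?_)
    filter_upwards [self_mem_nhdsWithin] with h hh
    have : 0 < h ^ 2 := sq_pos_of_ne_zero hh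
    show w - h ^ 2 < w - 0 ^ 2
    linarith
  obtain ⟨L, hL⟩ := exists_tendsto_integral_mul_kernel hk hfint hφ hfφ
  refine ⟨L, hL.congr' ?_⟩
  filter_upwards [self_mem_nhdsWithin] with ε hε
  rw [(integral_eq_integral_slices he (integrable_ofReal_mul_kernel e hint hε k)).2]
  congr 1
  ext h
  simp only [inner_smul_add he]
  rw [integral_mul_const, integral_complex_ofReal, integral_slice_mul_ballInd he hβ]

/-- The regularized integrals of the functions built from balls centered on `eᗮ` and from
half-spaces parallel to `e` converge. -/
lemma exists_tendsto_integral_of_mem_productSpan {e : E} (he : ‖e‖ = 1) {f : E → ℝ}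
    (hf : f ∈ productSpan (parallelAlg e) (centeredBalls e)) {k : ℕ} (hk : k ≠ 0) :
    Integrable f ∧ ∃ L : ℂ, Tendsto (fun ε : ℝ => ∫ x, (f x : ℂ) *
      ((inner ℝ e x : ℂ) - (ε : ℂ) * Complex.I) ^ (-(k : ℤ))) (𝓝[>] 0) (𝓝 L) := by
  induction hf using Submodule.span_induction with
  | mem x hx =>
    obtain ⟨β, hβ, _, ⟨c, w, hc, rfl⟩, rfl⟩ := hx
    exact ⟨integrable_mul_ballInd (parallelAlg_le_polyAlg e hβ) c w,
      exists_tendsto_integral_mul_ballInd he hβ hc w hk⟩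
  | zero => exact ⟨integrable_zero _ _ _, 0, by simp⟩
  | add f g _ _ hf hg =>
    obtain ⟨hfi, L, hL⟩ := hf
    obtain ⟨hgi, M, hM⟩ := hg
    refine ⟨hfi.add hgi, L + M, (hL.add hM).congr' ?_⟩
    filter_upwards [self_mem_nhdsWithin] with ε hε
    rw [← integral_add (integrable_ofReal_mul_kernel e hfi hε k)
      (integrable_ofReal_mul_kernel e hgi hε k)]
    simp only [Pi.add_apply, Complex.ofReal_add, add_mul]
  | smul a f _ hf =>
    obtain ⟨hfi, L, hL⟩ := hf
    refine ⟨hfi.smul a, a * L, (hL.const_mul (a : ℂ)).congr fun ε => ?_⟩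
    rw [← integral_const_mul]
    simp only [Pi.smul_apply, smul_eq_mul, Complex.ofReal_mul, mul_assoc]

end BallIndicators

section Polytopes

lemma inner_single_zero (x : EuclideanSpace ℝ (Fin n)) :
    inner ℝ (EuclideanSpace.single (0 : Fin n) (1 : ℝ)) x = x 0 := by
  simp [EuclideanSpace.inner_single_left]

lemma IsDHHalfSpace.measurableSet {H : Set (EuclideanSpace ℝ (Fin n))} (hH : IsDHHalfSpace H) :
    MeasurableSet H := by
  rcases hH with ⟨c, r, -, -, rfl⟩ | ⟨c, r, -, -, rfl⟩ | ⟨v, t, -, -, rfl⟩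
  · exact measurableSet_closedBall
  · exact measurableSet_ball.compl
  · exact (isClosed_le continuous_const (by fun_prop)).measurableSet

lemma IsDHPolytope.measurableSet {P : Set (EuclideanSpace ℝ (Fin n))} (hP : IsDHPolytope P) :
    MeasurableSet P := by
  obtain ⟨S, hS, rfl⟩ := hP
  exact .sInter S.countable_toSet fun H hH => (hS H hH).measurableSet

lemma IsDHHalfSpace.exists_mem_productSpan_ae_eq {H : Set (EuclideanSpace ℝ (Fin n))}
    (hH : IsDHHalfSpace H) :
    ∃ g ∈ productSpan (parallelAlg (EuclideanSpace.single (0 : Fin n) (1 : ℝ)))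
      (insert 1 (centeredBalls (EuclideanSpace.single (0 : Fin n) (1 : ℝ)))),
      H.indicator (1 : EuclideanSpace ℝ (Fin n) → ℝ) =ᵐ[volume] g := by
  have hball : ∀ (c : EuclideanSpace ℝ (Fin n)) (r : ℝ), 0 < r → c 0 = 0 →
      (ball c r).indicator (1 : EuclideanSpace ℝ (Fin n) → ℝ) ∈
        productSpan (parallelAlg (EuclideanSpace.single (0 : Fin n) (1 : ℝ)))
        (insert 1 (centeredBalls (EuclideanSpace.single (0 : Fin n) (1 : ℝ)))) := by
    intro c r hr hc
    rw [indicator_ball_eq_ballInd c hr, ← one_mul (ballInd c _)]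
    exact mul_mem_productSpan (one_mem _)
      (Set.mem_insert_of_mem _ ⟨c, _, (inner_single_zero c).trans hc, rfl⟩)
  rcases hH with ⟨c, r, hr, hc, rfl⟩ | ⟨c, r, hr, hc, rfl⟩ | ⟨v, t, -, hv, rfl⟩
  · refine ⟨_, hball c r hr hc, indicator_ae_eq_of_ae_eq_set ?_⟩
    rw [← ball_union_sphere]
    exact union_ae_eq_left_of_ae_eq_empty
      (ae_eq_empty.2 (Measure.addHaar_sphere_of_ne_zero volume c hr.ne'))
  · refine ⟨1 * 1 - (ball c r).indicator 1, sub_mem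
      (mul_mem_productSpan (one_mem _) (Set.mem_insert _ _)) (hball c r hr hc), ?_⟩
    rw [Set.indicator_compl, mul_one]
  · refine ⟨halfInd v t * 1, mul_mem_productSpan (Algebra.subset_adjoin ⟨v, t, ?_, rfl⟩)
      (Set.mem_insert _ _), by rw [mul_one]; rfl⟩
    rw [real_inner_comm, inner_single_zero, hv]

lemma indicator_sInter_mem_adjoin {X : Type*} {p : Set X → Prop} (S : Finset (Set X))
    (hS : ∀ H ∈ S, p H) : (⋂₀ (S : Set (Set X))).indicator (1 : X → ℝ) ∈
      Algebra.adjoin ℝ {f : X → ℝ | ∃ H, p H ∧ f = H.indicator 1} := by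
  classical
  induction S using Finset.induction_on with
  | empty => simp
  | insert H S _ ih =>
    rw [Finset.coe_insert, Set.sInter_insert, Set.inter_indicator_one]
    exact mul_mem (Algebra.subset_adjoin ⟨H, hS H (Finset.mem_insert_self H S), rfl⟩)
      (ih fun H' hH' => hS H' (Finset.mem_insert_of_mem hH'))

lemma IsDHPolytope.exists_mem_productSpan_ae_eq {P : Set (EuclideanSpace ℝ (Fin n))}
    (hP : IsDHPolytope P) (hPb : Bornology.IsBounded P) :
    ∃ g ∈ productSpan (parallelAlg (EuclideanSpace.single (0 : Fin n) (1 : ℝ)))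
      (centeredBalls (EuclideanSpace.single (0 : Fin n) (1 : ℝ))),
      P.indicator (1 : EuclideanSpace ℝ (Fin n) → ℝ) =ᵐ[volume] g := by
  obtain ⟨S, hS, rfl⟩ := hP
  set e := EuclideanSpace.single (0 : Fin n) (1 : ℝ)
  obtain ⟨g, hg, hPg⟩ := _root_.exists_mem_productSpan_ae_eq volume
    (reducesProducts_centeredBalls e)
    (by rintro _ ⟨H, hH, rfl⟩; exact hH.exists_mem_productSpan_ae_eq)
    (indicator_sInter_mem_adjoin S hS)
  obtain ⟨R, hR, hPR⟩ := hPb.subset_ball_lt 0 0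
  have hb : ballInd (0 : EuclideanSpace ℝ (Fin n)) (R ^ 2) ∈ centeredBalls e :=
    ⟨0, _, inner_zero_right _, rfl⟩
  refine ⟨g * ballInd 0 (R ^ 2), productSpan_mul_mem (B₂ := centeredBalls e) ?_ hg
    (by simpa using mul_mem_productSpan (one_mem (parallelAlg e)) hb), ?_⟩
  · rintro b (rfl | hb) b' hb'
    · exact mul_mem_productSpan (one_mem _) hb'
    · exact (reducesProducts_centeredBalls e).mul_mem hb hb'
  · rw [← indicator_ball_eq_ballInd _ hR]
    filter_upwards [hPg] with y hy
    rw [Pi.mul_apply, ← hy, ← Pi.mul_apply, ← Set.inter_indicator_one,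
      Set.inter_eq_self_of_subset_left hPR]

lemma exists_tendsto_dhInt {P : Set (EuclideanSpace ℝ (Fin n))} (hP : IsDHPolytope P)
    (hPb : Bornology.IsBounded P) : ∃ L : ℂ, Tendsto (fun ε => dhInt n P ε) (𝓝[>] 0) (𝓝 L) := by
  obtain ⟨g, hg, hPg⟩ := hP.exists_mem_productSpan_ae_eq hPb
  obtain ⟨-, L, hL⟩ := exists_tendsto_integral_of_mem_productSpan (by simp) hg (NeZero.ne n)
  refine ⟨L, hL.congr fun ε => ?_⟩
  rw [dhInt, ← integral_indicator hP.measurableSet]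
  refine integral_congr_ae ?_
  filter_upwards [hPg] with x hx
  rw [← hx, inner_single_zero]
  by_cases hxP : x ∈ P <;> simp [hxP]

lemma reflection_mem_iff_of_isDHHalfSpace {H : Set (EuclideanSpace ℝ (Fin n))}
    (hH : IsDHHalfSpace H) (x : EuclideanSpace ℝ (Fin n)) :
    (ℝ ∙ EuclideanSpace.single (0 : Fin n) (1 : ℝ))ᗮ.reflection x ∈ H ↔ x ∈ H := by
  set σ := (ℝ ∙ EuclideanSpace.single (0 : Fin n) (1 : ℝ))ᗮ.reflection
  have hfix : ∀ c : EuclideanSpace ℝ (Fin n), c 0 = 0 → σ c = c := fun c hc =>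
    Submodule.reflection_mem_subspace_eq_self
      (Submodule.mem_orthogonal_singleton_iff_inner_right.2 ((inner_single_zero c).trans hc))
  rcases hH with ⟨c, r, -, hc, rfl⟩ | ⟨c, r, -, hc, rfl⟩ | ⟨v, t, -, hv, rfl⟩
  · rw [mem_closedBall, mem_closedBall]
    nth_rewrite 1 [← hfix c hc]
    rw [σ.dist_map]
  · rw [Set.mem_compl_iff, Set.mem_compl_iff, mem_ball, mem_ball]
    nth_rewrite 1 [← hfix c hc]
    rw [σ.dist_map]
  · rw [Set.mem_ofPred_eq, Set.mem_ofPred_eq]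
    nth_rewrite 1 [← hfix v hv]
    rw [σ.inner_map_map]

lemma IsDHPolytope.reflection_preimage {P : Set (EuclideanSpace ℝ (Fin n))}
    (hP : IsDHPolytope P) :
    (ℝ ∙ EuclideanSpace.single (0 : Fin n) (1 : ℝ))ᗮ.reflection ⁻¹' P = P := by
  obtain ⟨S, hS, rfl⟩ := hP
  ext x
  simp only [Set.mem_preimage, Set.mem_sInter]
  exact forall₂_congr fun H hH => reflection_mem_iff_of_isDHHalfSpace (hS H hH) x

lemma dhInt_eq_neg_one_pow_mul_conj {P : Set (EuclideanSpace ℝ (Fin n))} (hP : IsDHPolytope P)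
    (ε : ℝ) : dhInt n P ε = (-1) ^ n * (starRingEnd ℂ) (dhInt n P ε) := by
  set σ := (ℝ ∙ EuclideanSpace.single (0 : Fin n) (1 : ℝ))ᗮ.reflection
  have hσ : ∀ x : EuclideanSpace ℝ (Fin n), σ x 0 = -x 0 := fun x => by
    rw [← inner_single_zero, ← inner_single_zero,
      ← σ.inner_map_map _ x, Submodule.reflection_orthogonalComplement_singleton_eq_neg,
      inner_neg_left, neg_neg]
  have h := σ.measurePreserving.setIntegral_preimage_emb σ.toMeasurableEquiv.measurableEmbedding
    (fun x => ((x 0 : ℂ) - (ε : ℂ) * Complex.I) ^ (-(n : ℤ))) P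
  rw [hP.reflection_preimage] at h
  rw [dhInt, ← integral_conj, ← integral_const_mul, ← h]
  congr 1
  ext x
  have hneg : ((-x 0 : ℝ) : ℂ) - (ε : ℂ) * Complex.I =
      -(starRingEnd ℂ) ((x 0 : ℂ) - (ε : ℂ) * Complex.I) := by
    simp
    ring
  rw [hσ, hneg, zpow_neg, zpow_neg, zpow_natCast, zpow_natCast, neg_pow, mul_inv, map_inv₀,
    map_pow, ← inv_pow, inv_neg_one]

end Polytopes

/-- **Theorem 1.4, first part**: for a bounded DH-polytope `P ⊆ ℝⁿ` the limit
`V_n(P) = lim_{ε→0⁺} μ_ε(P)` exists; it is real when `n` is even and purely imaginary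
when `n` is odd. -/
theorem dh_volume_real_or_imaginary (n : ℕ) [NeZero n]
    (P : Set (EuclideanSpace ℝ (Fin n)))
    (hP : IsDHPolytope P) (hPb : Bornology.IsBounded P) :
    ∃ L : ℂ, Tendsto (fun ε : ℝ => dhInt n P ε) (nhdsWithin 0 (Set.Ioi 0)) (nhds L) ∧
      (Even n → L.im = 0) ∧ (Odd n → L.re = 0) := by
  obtain ⟨L, hL⟩ := exists_tendsto_dhInt hP hPb
  have hsymm : L = (-1) ^ n * (starRingEnd ℂ) L :=
    tendsto_nhds_unique hL (((Complex.continuous_conj.tendsto L).comp hL).const_mul _ |>.congr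
      fun ε => (dhInt_eq_neg_one_pow_mul_conj hP ε).symm)
  refine ⟨L, hL, fun hn => ?_, fun hn => ?_⟩
  · rw [hn.neg_one_pow, one_mul] at hsymm
    exact Complex.conj_eq_iff_im.1 hsymm.symm
  · rw [hn.neg_one_pow, neg_one_mul] at hsymm
    have := congrArg Complex.re hsymm
    rw [Complex.neg_re, Complex.conj_re] at this
    linarith
end

section
/- Let n ≥ 1 be an odd integer and let P, P′ ⊆ ℝⁿ be bounded DH-polytopes such that P ∩ {x ∈ ℝⁿ : x₀ = 0} = P′ ∩ {x ∈ ℝⁿ : x₀ = 0}. Then lim_{ε→0⁺} μ_ε(P) = lim_{ε→0⁺} μ_ε(P′). (Second part of Theorem 1.4: for n odd, the volume V_n(P) is completely determined by the intersection of P with the boundary at infinity ∂Hⁿ, which in the upper half-space model is the hyperplane x₀ = 0.) -/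
open MeasureTheory Filter Metric

variable {n : ℕ} [NeZero n]

namespace DHVolume

open scoped Topology ContDiff

/-- The phase `u - i e (1 + c u²)`. -/
noncomputable def phase (c e u : ℝ) : ℂ := (u : ℂ) - ((e * (1 + c * u ^ 2) : ℝ) : ℂ) * Complex.I

/-- The functions `log z, z⁻¹, z⁻², …`; up to constants each is the derivative of the previous. -/
noncomputable def kern : ℕ → ℂ → ℂ
  | 0 => Complex.log
  | k + 1 => fun z => (z ^ (k + 1))⁻¹

section Phase

variable {c e u : ℝ}

lemma phase_re : (phase c e u).re = u := by
  simp only [phase, Complex.sub_re, Complex.ofReal_re, Complex.re_ofReal_mul, Complex.I_re]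
  ring

lemma phase_im : (phase c e u).im = -(e * (1 + c * u ^ 2)) := by
  simp only [phase, Complex.sub_im, Complex.ofReal_im, Complex.im_ofReal_mul, Complex.I_im]
  ring

lemma phase_im_neg (hc : 0 ≤ c) (he : 0 < e) : (phase c e u).im < 0 := by
  rw [phase_im]
  have : 0 < e * (1 + c * u ^ 2) := by positivity
  linarith

lemma abs_le_norm_phase : |u| ≤ ‖phase c e u‖ := by
  simpa [phase_re] using Complex.abs_re_le_norm (phase c e u)

lemma mul_le_norm_phase (hc : 0 ≤ c) (he : 0 < e) : e * (1 + c * u ^ 2) ≤ ‖phase c e u‖ := by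
  have h := Complex.abs_im_le_norm (phase c e u)
  rw [phase_im, abs_neg, abs_of_pos (by positivity)] at h
  exact h

lemma norm_phase_le (hc : 0 ≤ c) (he : 0 < e) : ‖phase c e u‖ ≤ |u| + e * (1 + c * u ^ 2) := by
  have h := Complex.norm_le_abs_re_add_abs_im (phase c e u)
  rwa [phase_re, phase_im, abs_neg, abs_of_pos (a := e * _) (by positivity)] at h

lemma phase_mem_slitPlane (hc : 0 ≤ c) (he : 0 < e) : phase c e u ∈ Complex.slitPlane :=
  Or.inr (phase_im_neg hc he).ne

lemma continuous_phase : Continuous (phase c e) := by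
  unfold phase
  fun_prop

lemma hasDerivAt_phase : HasDerivAt (phase c e) (1 - 2 * e * c * u * Complex.I) u := by
  have h1 : HasDerivAt (fun u : ℝ => (u : ℂ)) 1 u := Complex.ofRealCLM.hasDerivAt
  have h2 : HasDerivAt (fun u : ℝ => e * (1 + c * u ^ 2)) (e * (c * (2 * u))) u := by
    have := (((hasDerivAt_pow 2 u).const_mul c).const_add 1).const_mul e
    simpa using this
  have h3 := h1.sub (h2.ofReal_comp.mul_const Complex.I)
  refine h3.congr_deriv ?_
  push_cast
  ring

lemma one_sub_mul_I_ne_zero (x : ℝ) : (1 - x * Complex.I : ℂ) ≠ 0 := by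
  intro h
  have := congrArg Complex.re h
  simp at this

lemma tendsto_phase : Tendsto (fun e => phase c e u) (𝓝[>] 0) (𝓝 (u : ℂ)) := by
  have : Continuous (fun e => phase c e u) := by unfold phase; fun_prop
  have h := (this.tendsto 0).mono_left (nhdsWithin_le_nhds (s := Set.Ioi 0))
  simpa [phase] using h

end Phase

lemma continuous_kern_phase {c e : ℝ} (hc : 0 ≤ c) (he : 0 < e) (k : ℕ) :
    Continuous fun u => kern k (phase c e u) := by
  cases k with
  | zero => exact continuous_phase.clog fun u => phase_mem_slitPlane hc he
  | succ k =>
    exact (continuous_phase.pow _).inv₀ fun u =>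
      pow_ne_zero _ (Complex.slitPlane_ne_zero (phase_mem_slitPlane hc he))

lemma hasDerivAt_kern_zero {z : ℂ} (hz : z ∈ Complex.slitPlane) :
    HasDerivAt (kern 0) (kern 1 z) z := by
  simpa [kern] using Complex.hasDerivAt_log hz

lemma hasDerivAt_kern_succ {z : ℂ} (hz : z ≠ 0) (k : ℕ) :
    HasDerivAt (kern (k + 1)) (-(k + 1 : ℂ) * kern (k + 2) z) z := by
  have h := (hasDerivAt_pow (k + 1) z).inv (pow_ne_zero _ hz)
  refine h.congr_deriv ?_
  simp only [kern, Nat.add_sub_cancel]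
  push_cast
  field_simp
  ring

/-- The nonzero factor relating `kern (k + 1)` to the derivative of `kern k`. -/
noncomputable def kernFactor (k : ℕ) : ℂ := if k = 0 then 1 else -(k : ℂ)

lemma kernFactor_ne_zero (k : ℕ) : kernFactor k ≠ 0 := by
  unfold kernFactor
  split_ifs with h
  · exact one_ne_zero
  · simpa using h

lemma hasDerivAt_kern {z : ℂ} (hz : z ∈ Complex.slitPlane) (k : ℕ) :
    HasDerivAt (kern k) (kernFactor k * kern (k + 1) z) z := by
  cases k with
  | zero => simpa [kernFactor] using hasDerivAt_kern_zero hz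
  | succ k => simpa [kernFactor] using hasDerivAt_kern_succ (Complex.slitPlane_ne_zero hz) k

lemma norm_log_phase_le {c e u : ℝ} (hc : 0 ≤ c) (he : e ∈ Set.Ioc (0 : ℝ) 1) {R : ℝ}
    (hu : |u| ≤ R) (hu0 : u ≠ 0) :
    ‖Complex.log (phase c e u)‖ ≤ |Real.log u| + |Real.log (R + (1 + c * R ^ 2))| + Real.pi := by
  have hn : 0 < |u| := abs_pos.mpr hu0
  have h1 : |u| ≤ ‖phase c e u‖ := abs_le_norm_phase
  have hsq : u ^ 2 ≤ R ^ 2 := sq_le_sq' (by linarith [abs_le.mp hu]) (abs_le.mp hu).2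
  have h2 : ‖phase c e u‖ ≤ R + (1 + c * R ^ 2) := by
    refine (norm_phase_le hc he.1).trans (add_le_add hu ?_)
    have : 1 + c * u ^ 2 ≤ 1 + c * R ^ 2 := by gcongr
    have h0 : 0 ≤ 1 + c * u ^ 2 := by positivity
    nlinarith [he.1, he.2]
  have h3 : ‖Complex.log (phase c e u)‖ ≤ |Real.log ‖phase c e u‖| + Real.pi := by
    refine (Complex.norm_le_abs_re_add_abs_im _).trans ?_
    rw [Complex.log_re, Complex.log_im]
    exact add_le_add le_rfl (Complex.abs_arg_le_pi _)
  have h4 : |Real.log ‖phase c e u‖| ≤ |Real.log u| + |Real.log (R + (1 + c * R ^ 2))| := by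
    have a1 := Real.log_le_log hn h1
    have a2 := Real.log_le_log (hn.trans_le h1) h2
    rw [Real.log_abs] at a1
    rw [abs_le]
    constructor
    · linarith [neg_abs_le (Real.log u), abs_nonneg (Real.log (R + (1 + c * R ^ 2)))]
    · linarith [le_abs_self (Real.log (R + (1 + c * R ^ 2))), abs_nonneg (Real.log u)]
  linarith

lemma integrableOn_abs_log (R C : ℝ) :
    IntegrableOn (fun u => |Real.log u| + C) (Set.Icc (-R) R) := by
  by_cases hR : -R ≤ R
  · rw [integrableOn_Icc_iff_integrableOn_Ioc]
    have h : IntervalIntegrable Real.log volume (-R) R := intervalIntegral.intervalIntegrable_log'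
    exact ((intervalIntegrable_iff_integrableOn_Ioc_of_le hR).1 h).abs.add
      (integrableOn_const (by simp))
  · simp [Set.Icc_eq_empty hR]

lemma tendsto_log_phase {c u : ℝ} (hc : 0 ≤ c) (hu : u ≠ 0) :
    ∃ L, Tendsto (fun e => Complex.log (phase c e u)) (𝓝[>] 0) (𝓝 L) := by
  rcases lt_or_gt_of_ne hu with h | h
  · refine ⟨_, (Complex.tendsto_log_nhdsWithin_im_neg_of_re_neg_of_im_zero (z := (u : ℂ))
      (by simpa using h) (by simp)).comp ?_⟩
    refine tendsto_nhdsWithin_iff.2 ⟨tendsto_phase, ?_⟩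
    filter_upwards [self_mem_nhdsWithin] with e he
    exact phase_im_neg hc he
  · exact ⟨_, tendsto_phase.clog (by simp [h])⟩

section Oscillatory

variable {Y : Type*} [NormedAddCommGroup Y] [NormedSpace ℝ Y]

/-- The amplitude left over after one integration by parts. -/
noncomputable def stepAmp (c : ℝ) (Ψ : Y × ℝ × ℝ → ℂ) (p : Y × ℝ × ℝ) : ℂ :=
  fderiv ℝ (fun q : Y × ℝ × ℝ => Ψ q * (1 - ((2 * q.2.1 * c * q.2.2 : ℝ) : ℂ) * Complex.I)⁻¹) p
    (0, 0, 1)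

lemma contDiff_amp {c : ℝ} {Ψ : Y × ℝ × ℝ → ℂ} (hΨ : ContDiff ℝ ∞ Ψ) :
    ContDiff ℝ ∞ (fun q : Y × ℝ × ℝ =>
      Ψ q * (1 - ((2 * q.2.1 * c * q.2.2 : ℝ) : ℂ) * Complex.I)⁻¹) := by
  refine hΨ.mul (ContDiff.inv ?_ fun q => one_sub_mul_I_ne_zero _)
  refine contDiff_const.sub (ContDiff.mul ?_ contDiff_const)
  have h : ContDiff ℝ ∞ fun q : Y × ℝ × ℝ => 2 * q.2.1 * c * q.2.2 := by fun_prop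
  exact Complex.ofRealCLM.contDiff.comp h

lemma contDiff_stepAmp {c : ℝ} {Ψ : Y × ℝ × ℝ → ℂ} (hΨ : ContDiff ℝ ∞ Ψ) :
    ContDiff ℝ ∞ (stepAmp c Ψ) :=
  ((contDiff_amp hΨ).fderiv_right (m := ∞) (by simp)).clm_apply contDiff_const

lemma stepAmp_eq_zero {c R : ℝ} {Ψ : Y × ℝ × ℝ → ℂ} (hsupp : ∀ y e u, R < |u| → Ψ (y, e, u) = 0)
    (y : Y) (e u : ℝ) (hu : R < |u|) : stepAmp c Ψ (y, e, u) = 0 := by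
  have hopen : IsOpen {q : Y × ℝ × ℝ | R < |q.2.2|} := isOpen_lt (by fun_prop) (by fun_prop)
  have : (fun q : Y × ℝ × ℝ => Ψ q * (1 - ((2 * q.2.1 * c * q.2.2 : ℝ) : ℂ) * Complex.I)⁻¹)
      =ᶠ[𝓝 (y, e, u)] fun _ => 0 := by
    filter_upwards [hopen.mem_nhds hu] with q hq
    rw [show q = (q.1, q.2.1, q.2.2) from rfl, hsupp _ _ _ hq, zero_mul]
  rw [stepAmp, this.fderiv_eq]
  simp

lemma hasCompactSupport_of_abs {R : ℝ} {f : ℝ → ℂ} (hf : ∀ u, R < |u| → f u = 0) :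
    HasCompactSupport f :=
  HasCompactSupport.intro (isCompact_Icc (a := -R) (b := R)) fun u hu => hf u (by
    by_contra! h
    exact hu (abs_le.1 h))

lemma integral_amp_mul_kern_succ {c R e : ℝ} (hc : 0 ≤ c) (he : 0 < e) {Ψ : Y × ℝ × ℝ → ℂ}
    (hΨ : ContDiff ℝ ∞ Ψ) (hsupp : ∀ y e u, R < |u| → Ψ (y, e, u) = 0) (k : ℕ) (y : Y) :
    ∫ u, Ψ (y, e, u) * kern (k + 1) (phase c e u) =
      -(kernFactor k)⁻¹ * ∫ u, stepAmp c Ψ (y, e, u) * kern k (phase c e u) := by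
  set A : ℝ → ℂ := fun u => Ψ (y, e, u) * (1 - ((2 * e * c * u : ℝ) : ℂ) * Complex.I)⁻¹ with hA
  have hAd : ∀ u, HasDerivAt A (stepAmp c Ψ (y, e, u)) u := by
    intro u
    have h1 := ((contDiff_amp (c := c) hΨ).differentiable (by simp) (y, e, u)).hasFDerivAt
    have h2 : HasDerivAt (fun u : ℝ => ((y, e, u) : Y × ℝ × ℝ)) (0, 0, 1) u :=
      (hasDerivAt_const u y).prodMk ((hasDerivAt_const u e).prodMk (hasDerivAt_id u))
    exact h1.comp_hasDerivAt u h2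
  have hBd : ∀ u, HasDerivAt (fun u => kern k (phase c e u))
      (kernFactor k * kern (k + 1) (phase c e u) * (1 - 2 * e * c * u * Complex.I)) u := by
    intro u
    exact (hasDerivAt_kern (phase_mem_slitPlane hc he) k).comp u hasDerivAt_phase
  have hAc : Continuous A := continuous_iff_continuousAt.2 fun u => (hAd u).continuousAt
  have hA0 : ∀ u, R < |u| → A u = 0 := fun u hu => by simp [hA, hsupp y e u hu]
  have hA'0 : ∀ u, R < |u| → stepAmp c Ψ (y, e, u) = 0 := fun u hu => stepAmp_eq_zero hsupp y e u hu
  have hA'c : Continuous fun u => stepAmp c Ψ (y, e, u) :=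
    (contDiff_stepAmp hΨ).continuous.comp (by fun_prop)
  have hBc := continuous_kern_phase hc he k
  have hB1c := continuous_kern_phase hc he (k + 1)
  have key := integral_mul_deriv_eq_deriv_mul_of_integrable (u := A)
    (v := fun u => kern k (phase c e u)) (fun x _ => hAd x) (fun x _ => hBd x)
    ((hAc.mul (by fun_prop)).integrable_of_hasCompactSupport
      ((hasCompactSupport_of_abs hA0).mul_right))
    ((hA'c.mul hBc).integrable_of_hasCompactSupport ((hasCompactSupport_of_abs hA'0).mul_right))
    ((hAc.mul hBc).integrable_of_hasCompactSupport ((hasCompactSupport_of_abs hA0).mul_right))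
  have hrw : ∀ u, A u * (kernFactor k * kern (k + 1) (phase c e u) *
      (1 - 2 * e * c * u * Complex.I)) =
      kernFactor k * (Ψ (y, e, u) * kern (k + 1) (phase c e u)) := by
    intro u
    have h := one_sub_mul_I_ne_zero (2 * e * c * u)
    simp only [hA]
    push_cast at h ⊢
    field_simp
  simp only [hrw] at key
  rw [integral_const_mul] at key
  have hk := kernFactor_ne_zero k
  rw [neg_mul, ← mul_neg, ← key, inv_mul_cancel_left₀ hk]

/-- Oscillatory integrals against negative powers of `u - i e (1 + c u²)` are bounded uniformly in
`e ∈ (0, 1]` and converge as `e → 0⁺`. -/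
theorem oscillatory {c R : ℝ} (hc : 0 ≤ c) (k : ℕ) {Ψ : Y × ℝ × ℝ → ℂ}
    (hΨ : ContDiff ℝ ∞ Ψ) (hsupp : ∀ y e u, R < |u| → Ψ (y, e, u) = 0) :
    (∀ S : Set Y, IsCompact S → ∃ C, ∀ y ∈ S, ∀ e ∈ Set.Ioc (0 : ℝ) 1,
      ‖∫ u, Ψ (y, e, u) * kern k (phase c e u)‖ ≤ C) ∧
    ∀ y, ∃ L, Tendsto (fun e => ∫ u, Ψ (y, e, u) * kern k (phase c e u)) (𝓝[>] 0) (𝓝 L) := by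
  induction k generalizing Ψ with
  | zero =>
    set D : ℝ := |Real.log (R + (1 + c * R ^ 2))| + Real.pi with hD
    have hbound : ∀ S : Set Y, IsCompact S → ∃ M, 0 ≤ M ∧ ∀ y ∈ S, ∀ e ∈ Set.Ioc (0 : ℝ) 1,
        ∀ u, u ≠ 0 → ‖Ψ (y, e, u) * kern 0 (phase c e u)‖ ≤
          (Set.Icc (-R) R).indicator (fun u => M * (|Real.log u| + D)) u := by
      intro S hS
      obtain ⟨M, hM⟩ := (hS.prod ((isCompact_Icc (a := (0 : ℝ)) (b := 1)).prod
        (isCompact_Icc (a := -R) (b := R)))).exists_bound_of_continuousOn hΨ.continuous.continuousOn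
      refine ⟨max M 0, le_max_right _ _, fun y hy e he u hu0 => ?_⟩
      by_cases hu : u ∈ Set.Icc (-R) R
      · rw [Set.indicator_of_mem hu, norm_mul]
        refine mul_le_mul ((hM (y, e, u) ⟨hy, ⟨he.1.le, he.2⟩, hu⟩).trans (le_max_left _ _)) ?_
          (norm_nonneg _) (le_max_right _ _)
        have := norm_log_phase_le hc he (abs_le.2 hu) hu0
        rw [hD, ← add_assoc]
        exact this
      · rw [Set.indicator_of_notMem hu, hsupp y e u, zero_mul, norm_zero]
        by_contra! h
        exact hu (abs_le.1 h)
    have hint : ∀ M : ℝ, Integrable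
        ((Set.Icc (-R) R).indicator (fun u => M * (|Real.log u| + D))) := fun M =>
      (integrable_indicator_iff measurableSet_Icc).2 ((integrableOn_abs_log R D).const_mul M)
    have hne : ∀ᵐ u : ℝ, u ≠ 0 := by simp [ae_iff, measure_singleton]
    constructor
    · intro S hS
      obtain ⟨M, -, hM⟩ := hbound S hS
      refine ⟨_, fun y hy e he => norm_integral_le_of_norm_le (hint M) ?_⟩
      filter_upwards [hne] with u hu using hM y hy e he u hu
    · intro y
      obtain ⟨M, -, hM⟩ := hbound {y} isCompact_singleton
      have hlim : ∀ u : ℝ, ∃ L, u ≠ 0 →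
          Tendsto (fun e => Ψ (y, e, u) * kern 0 (phase c e u)) (𝓝[>] 0) (𝓝 L) := by
        intro u
        by_cases hu : u = 0
        · exact ⟨0, fun h => absurd hu h⟩
        · obtain ⟨L, hL⟩ := tendsto_log_phase hc hu
          refine ⟨Ψ (y, 0, u) * L, fun _ => Tendsto.mul ?_ hL⟩
          have : Continuous fun e => Ψ (y, e, u) := hΨ.continuous.comp (by fun_prop)
          exact (this.tendsto 0).mono_left nhdsWithin_le_nhds
      choose L hL using hlim
      have hIoc : ∀ᶠ e in 𝓝[>] (0 : ℝ), e ∈ Set.Ioc (0 : ℝ) 1 := Ioc_mem_nhdsGT one_pos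
      refine ⟨∫ u, L u, tendsto_integral_filter_of_dominated_convergence _ ?_ ?_ (hint M) ?_⟩
      · filter_upwards [hIoc] with e he
        have : Continuous fun u => Ψ (y, e, u) := hΨ.continuous.comp (by fun_prop)
        exact (this.mul (continuous_kern_phase hc he.1 0)).aestronglyMeasurable
      · filter_upwards [hIoc] with e he
        filter_upwards [hne] with u hu using hM y rfl e he u hu
      · filter_upwards [hne] with u hu using hL u hu
  | succ k ih =>
    obtain ⟨ih1, ih2⟩ := ih (contDiff_stepAmp (c := c) hΨ) (stepAmp_eq_zero hsupp)
    constructor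
    · intro S hS
      obtain ⟨C, hC⟩ := ih1 S hS
      refine ⟨‖-(kernFactor k)⁻¹‖ * C, fun y hy e he => ?_⟩
      rw [integral_amp_mul_kern_succ hc he.1 hΨ hsupp, norm_mul]
      exact mul_le_mul_of_nonneg_left (hC y hy e he) (norm_nonneg _)
    · intro y
      obtain ⟨L, hL⟩ := ih2 y
      refine ⟨-(kernFactor k)⁻¹ * L, (hL.const_mul _).congr' ?_⟩
      filter_upwards [self_mem_nhdsWithin] with e he
      exact (integral_amp_mul_kern_succ hc he hΨ hsupp k y).symm

end Oscillatory

section HorosphericalCoordinates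

variable {E : Type*} [NormedAddCommGroup E] [InnerProductSpace ℝ E]

/-- Coordinates `(u, y)` on `ℝ × E` in which the spheres through the origin centred on the boundary
hyperplane become vertical: `u` is the slope of the point and `y` lies on its boundary sphere. -/
noncomputable def horoMap (p : ℝ × E) : ℝ × E :=
  (p.1 * ‖p.2‖ / (1 + p.1 ^ 2), (1 + p.1 ^ 2)⁻¹ • p.2)

/-- The Jacobian of `horoMap`. -/
noncomputable def horoJac (p : ℝ × E) : ℝ :=
  ((1 + p.1 ^ 2)⁻¹) ^ (Module.finrank ℝ E + 1) * ‖p.2‖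

lemma horoJac_nonneg (p : ℝ × E) : 0 ≤ horoJac p := by
  unfold horoJac
  positivity

lemma continuous_horoMap : Continuous (horoMap (E := E)) := by
  unfold horoMap
  have h : ∀ p : ℝ × E, 1 + p.1 ^ 2 ≠ 0 := fun p => by positivity
  refine Continuous.prodMk (Continuous.div (by fun_prop) (by fun_prop) h) ?_
  exact (Continuous.inv₀ (by fun_prop) h).smul continuous_snd

lemma continuous_horoJac : Continuous (horoJac (E := E)) := by
  unfold horoJac
  have h : ∀ p : ℝ × E, 1 + p.1 ^ 2 ≠ 0 := fun p => by positivity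
  exact ((Continuous.inv₀ (by fun_prop) h).pow _).mul (by fun_prop)

variable [FiniteDimensional ℝ E] [MeasurableSpace E] [BorelSpace E]

lemma lintegral_comp_smul (μ : Measure E) [μ.IsAddHaarMeasure] {f : E → ENNReal}
    (hf : Measurable f) {r : ℝ} (hr : 0 < r) :
    ∫⁻ x, f x ∂μ = ENNReal.ofReal (r ^ Module.finrank ℝ E) * ∫⁻ x, f (r • x) ∂μ := by
  have hpow : 0 < r ^ Module.finrank ℝ E := by positivity
  rw [← lintegral_map hf (measurable_const_smul r), Measure.map_addHaar_smul μ hr.ne',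
    lintegral_smul_measure, abs_of_pos (inv_pos.2 hpow), smul_eq_mul, ← mul_assoc,
    ← ENNReal.ofReal_mul hpow.le, mul_inv_cancel₀ hpow.ne', ENNReal.ofReal_one, one_mul]

lemma lintegral_horo [Nontrivial E] {F : ℝ × E → ENNReal} (hF : Measurable F) :
    ∫⁻ p, F p = ∫⁻ p, ENNReal.ofReal (horoJac p) * F (horoMap p) := by
  have hne : ∀ᵐ y : E, y ≠ 0 := by simp [ae_iff, measure_singleton]
  have hmeas : Measurable fun p : ℝ × E => ENNReal.ofReal ‖p.2‖ * F (p.1 * ‖p.2‖, p.2) := by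
    refine Measurable.mul (by fun_prop) (hF.comp (by fun_prop))
  calc ∫⁻ p, F p = ∫⁻ y : E, ∫⁻ x : ℝ, F (x, y) := lintegral_prod_symm _ hF.aemeasurable
    _ = ∫⁻ y : E, ∫⁻ u : ℝ, ENNReal.ofReal ‖y‖ * F (u * ‖y‖, y) := by
      refine lintegral_congr_ae ?_
      filter_upwards [hne] with y hy
      have hFy : Measurable fun x : ℝ => F (x, y) := hF.comp (by fun_prop)
      have h := lintegral_comp_smul volume hFy (norm_pos_iff.2 hy)
      simp only [Module.finrank_self, pow_one, smul_eq_mul] at h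
      have hFy' : Measurable fun x : ℝ => F (‖y‖ * x, y) := hF.comp (by fun_prop)
      rw [h, ← lintegral_const_mul _ hFy']
      simp only [mul_comm]
    _ = ∫⁻ u : ℝ, ∫⁻ y : E, ENNReal.ofReal ‖y‖ * F (u * ‖y‖, y) :=
      (lintegral_lintegral_swap (f := fun (u : ℝ) (y : E) =>
        ENNReal.ofReal ‖y‖ * F (u * ‖y‖, y)) hmeas.aemeasurable).symm
    _ = ∫⁻ u : ℝ, ∫⁻ y : E, ENNReal.ofReal (horoJac (u, y)) * F (horoMap (u, y)) := by
      refine lintegral_congr fun u => ?_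
      have hr : 0 < (1 + u ^ 2)⁻¹ := by positivity
      have hFu : Measurable fun y : E => ENNReal.ofReal ‖y‖ * F (u * ‖y‖, y) :=
        Measurable.mul (by fun_prop) (hF.comp (by fun_prop))
      rw [lintegral_comp_smul volume hFu hr,
        ← lintegral_const_mul _ (by
          refine (Measurable.mul (by fun_prop) (hF.comp ?_))
          fun_prop)]
      refine lintegral_congr fun y => ?_
      rw [← mul_assoc, ← ENNReal.ofReal_mul (by positivity), norm_smul, Real.norm_of_nonneg hr.le]
      simp only [horoJac, horoMap]
      congr 1
      · congr 1
        ring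
      · congr 2
        ring
    _ = ∫⁻ p, ENNReal.ofReal (horoJac p) * F (horoMap p) := by
      refine (lintegral_prod (fun p : ℝ × E => ENNReal.ofReal (horoJac p) * F (horoMap p))
        (Measurable.aemeasurable ?_)).symm
      exact (continuous_horoJac.measurable.ennreal_ofReal).mul
        (hF.comp continuous_horoMap.measurable)

lemma map_horoMap [Nontrivial E] :
    Measure.map horoMap ((volume : Measure (ℝ × E)).withDensity
      fun p => ENNReal.ofReal (horoJac p)) = volume := by
  refine Measure.ext_of_lintegral _ fun F hF => ?_
  rw [lintegral_map hF continuous_horoMap.measurable,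
    lintegral_withDensity_eq_lintegral_mul _ continuous_horoJac.measurable.ennreal_ofReal
      (g := fun p => F (horoMap p)) (hF.comp continuous_horoMap.measurable), lintegral_horo hF]
  rfl

lemma integrable_horo [Nontrivial E] {F : ℝ × E → ℂ} (hF : Integrable F) :
    Integrable fun p => horoJac p • F (horoMap p) := by
  have h := hF
  rw [← map_horoMap, integrable_map_measure (by rw [map_horoMap]; exact hF.1)
    continuous_horoMap.measurable.aemeasurable,
    integrable_withDensity_iff_integrable_smul' continuous_horoJac.measurable.ennreal_ofReal
      (by simp)] at h
  simpa only [Function.comp, ENNReal.toReal_ofReal (horoJac_nonneg _)] using h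

lemma integral_horo [Nontrivial E] {F : ℝ × E → ℂ} (hF : Integrable F) :
    ∫ p, F p = ∫ p, horoJac p • F (horoMap p) := by
  conv_lhs => rw [← map_horoMap]
  rw [integral_map continuous_horoMap.measurable.aemeasurable (by rw [map_horoMap]; exact hF.1),
    integral_withDensity_eq_integral_toReal_smul continuous_horoJac.measurable.ennreal_ofReal
      (by simp)]
  simp only [ENNReal.toReal_ofReal (horoJac_nonneg _)]

end HorosphericalCoordinates

section Cusp

variable {E : Type*} [NormedAddCommGroup E] [InnerProductSpace ℝ E]
  [MeasurableSpace E] [BorelSpace E]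

lemma measurableSet_slab (a : E) (r t : ℝ) :
    MeasurableSet {y : E | ‖y‖ ≤ r ∧ |inner ℝ a y| ≤ t} := by
  have h1 : IsClosed {y : E | ‖y‖ ≤ r} := isClosed_le (by fun_prop) (by fun_prop)
  have h2 : IsClosed {y : E | |inner ℝ a y| ≤ t} := isClosed_le (by fun_prop) (by fun_prop)
  exact (h1.inter h2).measurableSet

variable [FiniteDimensional ℝ E]

/-- A slab of width `t` in a ball of radius `r` has volume `O(r ^ (N - 1) t)`. -/
lemma volume_slab_le {a : E} (ha : a ≠ 0) : ∃ C : NNReal, ∀ r t : ℝ, 0 < r → 0 ≤ t →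
    volume {y : E | ‖y‖ ≤ r ∧ |inner ℝ a y| ≤ t} ≤
      C * ENNReal.ofReal (r ^ Module.finrank ℝ E * t / r) := by
  have hna : 0 < ‖a‖ := norm_pos_iff.2 ha
  obtain ⟨V, hV⟩ : ∃ V : NNReal, (V : ENNReal) = volume (closedBall (0 : E) 1) :=
    ⟨_, ENNReal.coe_toNNReal measure_closedBall_lt_top.ne⟩
  set c : ℝ := 2 / ‖a‖ ^ 2 * (1 + ‖a‖) ^ Module.finrank ℝ E with hc
  refine ⟨c.toNNReal * V, fun r t hr ht => ?_⟩
  set A := {y : E | ‖y‖ ≤ r ∧ |inner ℝ a y| ≤ t} with hA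
  have hAm : MeasurableSet A := measurableSet_slab a r t
  set ρ : ℝ := r * (1 + ‖a‖) with hρ
  have hinner : ∀ y : E, ∫⁻ s in Set.Icc (0 : ℝ) 1, A.indicator (fun _ => (1 : ENNReal))
      (y + (s * r) • a) ≤ (closedBall (0 : E) ρ).indicator
        (fun _ => ENNReal.ofReal (2 * t / (r * ‖a‖ ^ 2))) y := by
    intro y
    by_cases hy : y ∈ closedBall (0 : E) ρ
    · rw [Set.indicator_of_mem hy]
      set q : ℝ := r * ‖a‖ ^ 2 with hq
      have hq0 : 0 < q := by positivity
      have hsub : ∀ s : ℝ, A.indicator (fun _ => (1 : ENNReal)) (y + (s * r) • a) ≤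
          (Set.Icc ((-t - inner ℝ a y) / q) ((t - inner ℝ a y) / q)).indicator 1 s := by
        intro s
        refine Set.indicator_apply_le' (fun h => ?_) fun _ => zero_le
        have h2 := abs_le.1 h.2
        rw [inner_add_right, inner_smul_right, real_inner_self_eq_norm_sq] at h2
        rw [Set.indicator_of_mem]
        · rfl
        · rw [Set.mem_Icc, div_le_iff₀ hq0, le_div_iff₀ hq0, hq]
          constructor <;> linarith [h2.1, h2.2]
      refine (setLIntegral_le_lintegral _ _).trans ((lintegral_mono hsub).trans ?_)
      rw [lintegral_indicator_one measurableSet_Icc, Real.volume_Icc]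
      refine ENNReal.ofReal_le_ofReal (le_of_eq ?_)
      field_simp
      ring
    · rw [Set.indicator_of_notMem hy]
      refine le_of_eq ((setLIntegral_congr_fun measurableSet_Icc fun s hs => ?_).trans
        lintegral_zero)
      refine Set.indicator_of_notMem (fun h => hy ?_) _
      rw [mem_closedBall_zero_iff]
      have h1 : ‖y‖ ≤ ‖y + (s * r) • a‖ + ‖(s * r) • a‖ := by
        simpa using norm_sub_le (y + (s * r) • a) ((s * r) • a)
      have h2 : ‖(s * r) • a‖ ≤ r * ‖a‖ := by
        rw [norm_smul, Real.norm_of_nonneg (mul_nonneg hs.1 hr.le)]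
        have : s * r ≤ r := by nlinarith [hs.2]
        gcongr
      have h3 := h.1
      rw [hρ]
      linarith
  have hmeas : Measurable fun p : ℝ × E =>
      A.indicator (fun _ => (1 : ENNReal)) (p.2 + (p.1 * r) • a) :=
    (measurable_const.indicator hAm).comp (by fun_prop)
  calc volume A = ∫⁻ _s in Set.Icc (0 : ℝ) 1, volume A := by simp
    _ = ∫⁻ s in Set.Icc (0 : ℝ) 1, ∫⁻ y : E, A.indicator (fun _ => (1 : ENNReal))
          (y + (s * r) • a) := by
      refine lintegral_congr fun s => ?_
      rw [lintegral_add_right_eq_self (fun y => A.indicator (fun _ => (1 : ENNReal)) y)]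
      simp [hAm]
    _ = ∫⁻ y : E, ∫⁻ s in Set.Icc (0 : ℝ) 1, A.indicator (fun _ => (1 : ENNReal))
          (y + (s * r) • a) := lintegral_lintegral_swap (f := fun (s : ℝ) (y : E) =>
            A.indicator (fun _ => (1 : ENNReal)) (y + (s * r) • a)) hmeas.aemeasurable
    _ ≤ ∫⁻ y : E, (closedBall (0 : E) ρ).indicator
        (fun _ => ENNReal.ofReal (2 * t / (r * ‖a‖ ^ 2))) y := lintegral_mono hinner
    _ = ENNReal.ofReal (2 * t / (r * ‖a‖ ^ 2)) *
        (ENNReal.ofReal (ρ ^ Module.finrank ℝ E) * V) := by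
      rw [lintegral_indicator_const measurableSet_closedBall,
        Measure.addHaar_closedBall' _ _ (by positivity), hV]
    _ = (c.toNNReal * V : NNReal) * ENNReal.ofReal (r ^ Module.finrank ℝ E * t / r) := by
      rw [ENNReal.coe_mul, mul_right_comm, ← mul_assoc, ← ENNReal.ofReal_mul (by positivity)]
      congr 1
      rw [← ENNReal.ofReal, ← ENNReal.ofReal_mul (by positivity)]
      congr 1
      rw [hc, hρ, mul_pow]
      field_simp

lemma integrableOn_cusp {a : E} (ha : a ≠ 0) {β R : ℝ} (hβ : 0 ≤ β) :
    IntegrableOn (fun y : E => (‖y‖ ^ Module.finrank ℝ E)⁻¹)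
      {y | ‖y‖ ≤ R ∧ |inner ℝ a y| ≤ β * ‖y‖ ^ 2} := by
  obtain ⟨C, hC⟩ := volume_slab_le ha
  set N := Module.finrank ℝ E with hN
  have : Nontrivial E := ⟨a, 0, ha⟩
  set S := {y : E | ‖y‖ ≤ R ∧ |inner ℝ a y| ≤ β * ‖y‖ ^ 2} with hS
  have hSm : MeasurableSet S := by
    have h1 : IsClosed {y : E | ‖y‖ ≤ R} := isClosed_le (by fun_prop) (by fun_prop)
    have h2 : IsClosed {y : E | |inner ℝ a y| ≤ β * ‖y‖ ^ 2} :=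
      isClosed_le (by fun_prop) (by fun_prop)
    exact (h1.inter h2).measurableSet
  have hne : ∀ᵐ y : E, y ≠ 0 := by simp [ae_iff, measure_singleton]
  refine ⟨(by fun_prop : Measurable _).aestronglyMeasurable, ?_⟩
  set G : ℝ → E → ENNReal := fun r y =>
    {q : ℝ × E | q.1 ∈ Set.Ioc 0 (2 * R) ∧ q.2 ∈ S ∧ ‖q.2‖ ≤ q.1 ∧ q.1 ≤ 2 * ‖q.2‖}.indicator
      (fun q => ENNReal.ofReal ((q.1 ^ (N + 1))⁻¹)) (r, y) with hG
  have hGm : Measurable (Function.uncurry G) := by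
    refine Measurable.indicator (by fun_prop) ?_
    refine (measurable_fst measurableSet_Ioc).inter ((measurable_snd hSm).inter ?_)
    have h1 : IsClosed {q : ℝ × E | ‖q.2‖ ≤ q.1} := isClosed_le (by fun_prop) (by fun_prop)
    have h2 : IsClosed {q : ℝ × E | q.1 ≤ 2 * ‖q.2‖} := isClosed_le (by fun_prop) (by fun_prop)
    exact (h1.inter h2).measurableSet
  have hlow : ∀ y ∈ S, y ≠ 0 → ‖(‖y‖ ^ N)⁻¹‖ₑ ≤
      ENNReal.ofReal (2 ^ (N + 1)) * ∫⁻ r, G r y := by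
    intro y hy hy0
    have hyn : 0 < ‖y‖ := norm_pos_iff.2 hy0
    have h1 : ∀ r ∈ Set.Icc ‖y‖ (2 * ‖y‖),
        ENNReal.ofReal (((2 * ‖y‖) ^ (N + 1))⁻¹) ≤ G r y := by
      intro r hr
      have hmem : (r, y) ∈
          {q : ℝ × E | q.1 ∈ Set.Ioc 0 (2 * R) ∧ q.2 ∈ S ∧ ‖q.2‖ ≤ q.1 ∧ q.1 ≤ 2 * ‖q.2‖} :=
        ⟨⟨hyn.trans_le hr.1, hr.2.trans (by linarith [hy.1])⟩, hy, hr.1, hr.2⟩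
      simp only [hG]
      rw [Set.indicator_of_mem hmem]
      have : 0 < r := hyn.trans_le hr.1
      refine ENNReal.ofReal_le_ofReal (inv_anti₀ (by positivity) ?_)
      gcongr
      exact hr.2
    have h2 : ENNReal.ofReal (((2 * ‖y‖) ^ (N + 1))⁻¹) * ENNReal.ofReal ‖y‖ ≤ ∫⁻ r, G r y := by
      calc _ = ∫⁻ _r in Set.Icc ‖y‖ (2 * ‖y‖), ENNReal.ofReal (((2 * ‖y‖) ^ (N + 1))⁻¹) := by
            rw [setLIntegral_const, Real.volume_Icc]
            congr 2
            ring
        _ ≤ ∫⁻ r in Set.Icc ‖y‖ (2 * ‖y‖), G r y := setLIntegral_mono' measurableSet_Icc h1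
        _ ≤ _ := setLIntegral_le_lintegral _ _
    refine le_trans (le_of_eq ?_) (mul_le_mul_right h2 _)
    rw [← ENNReal.ofReal_mul (by positivity), ← ENNReal.ofReal_mul (by positivity),
      Real.enorm_of_nonneg (by positivity)]
    congr 1
    field_simp
    ring
  have hup : ∀ r, ∫⁻ y, G r y ≤
      (Set.Ioc 0 (2 * R)).indicator (fun _ => (C : ENNReal) * ENNReal.ofReal β) r := by
    intro r
    by_cases hr : r ∈ Set.Ioc 0 (2 * R)
    · have hr0 : 0 < r := hr.1
      rw [Set.indicator_of_mem hr]
      calc ∫⁻ y, G r y ≤ ∫⁻ y, {y : E | ‖y‖ ≤ r ∧ |inner ℝ a y| ≤ β * r ^ 2}.indicator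
            (fun _ => ENNReal.ofReal ((r ^ (N + 1))⁻¹)) y := by
            refine lintegral_mono fun y => ?_
            simp only [hG]
            refine Set.indicator_apply_le' (fun h => ?_) fun _ => zero_le
            rw [Set.indicator_of_mem]
            obtain ⟨-, h1, h2, -⟩ := h
            refine ⟨h2, h1.2.trans ?_⟩
            dsimp only at h2
            gcongr
        _ ≤ ENNReal.ofReal ((r ^ (N + 1))⁻¹) * (C * ENNReal.ofReal (r ^ N * (β * r ^ 2) / r)) := by
            rw [lintegral_indicator_const (measurableSet_slab _ _ _)]
            exact mul_le_mul_right (hC r (β * r ^ 2) hr0 (by positivity)) _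
        _ = C * ENNReal.ofReal β := by
            rw [mul_left_comm, ← ENNReal.ofReal_mul (by positivity)]
            congr 2
            field_simp
            ring
    · rw [Set.indicator_of_notMem hr]
      refine le_of_eq ((lintegral_congr fun y => ?_).trans lintegral_zero)
      exact Set.indicator_of_notMem (fun h => hr h.1) _
  rw [hasFiniteIntegral_iff_enorm]
  calc ∫⁻ y in S, ‖(‖y‖ ^ N)⁻¹‖ₑ
      ≤ ∫⁻ y in S, ENNReal.ofReal (2 ^ (N + 1)) * ∫⁻ r, G r y := by
        refine lintegral_mono_ae ((ae_restrict_iff' hSm).2 ?_)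
        filter_upwards [hne] with y h0 hy using hlow y hy h0
    _ ≤ ∫⁻ y, ENNReal.ofReal (2 ^ (N + 1)) * ∫⁻ r, G r y := setLIntegral_le_lintegral _ _
    _ = ENNReal.ofReal (2 ^ (N + 1)) * ∫⁻ r, ∫⁻ y, G r y := by
        rw [lintegral_const_mul' _ _ ENNReal.ofReal_ne_top,
          lintegral_lintegral_swap hGm.aemeasurable]
    _ ≤ ENNReal.ofReal (2 ^ (N + 1)) * ∫⁻ r, (Set.Ioc 0 (2 * R)).indicator
          (fun _ => (C : ENNReal) * ENNReal.ofReal β) r :=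
        mul_le_mul_right (lintegral_mono hup) _
    _ < ⊤ := by
        rw [lintegral_indicator_const measurableSet_Ioc, Real.volume_Ioc]
        exact ENNReal.mul_lt_top ENNReal.ofReal_lt_top (ENNReal.mul_lt_top
          (ENNReal.mul_lt_top ENNReal.coe_lt_top ENNReal.ofReal_lt_top) ENNReal.ofReal_lt_top)

end Cusp

section Kernel

lemma norm_kern_succ (k : ℕ) (z : ℂ) : ‖kern (k + 1) z‖ = (‖z‖ ^ (k + 1))⁻¹ := by
  simp [kern]

lemma norm_kern_phase_le_abs (k : ℕ) {c e u : ℝ} (hu : u ≠ 0) :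
    ‖kern (k + 1) (phase c e u)‖ ≤ (|u| ^ (k + 1))⁻¹ := by
  rw [norm_kern_succ]
  have := abs_pos.2 hu
  exact inv_anti₀ (by positivity) (pow_le_pow_left₀ (abs_nonneg u) abs_le_norm_phase _)

lemma norm_kern_phase_le (k : ℕ) {c e u : ℝ} (hc : 0 ≤ c) (he : 0 < e) :
    ‖kern (k + 1) (phase c e u)‖ ≤ ((e * (1 + c * u ^ 2)) ^ (k + 1))⁻¹ := by
  rw [norm_kern_succ]
  exact inv_anti₀ (by positivity) (pow_le_pow_left₀ (by positivity) (mul_le_norm_phase hc he) _)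

lemma tendsto_kern_phase (k : ℕ) {c u : ℝ} (hu : u ≠ 0) :
    Tendsto (fun e => kern (k + 1) (phase c e u)) (𝓝[>] 0) (𝓝 (((u : ℂ) ^ (k + 1))⁻¹)) :=
  (tendsto_phase.pow _).inv₀ (pow_ne_zero _ (Complex.ofReal_ne_zero.2 hu))

end Kernel

section Vertical

lemma exists_norm_le {E : Type*} [NormedAddCommGroup E]
    {φ : ℝ × E → ℂ} (hφ : HasCompactSupport φ) :
    ∃ δ, 0 < δ ∧ ∀ p, φ p ≠ 0 → ‖p‖ ≤ δ := by
  obtain ⟨δ, hδ, h⟩ := hφ.isBounded.exists_pos_norm_le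
  exact ⟨δ, hδ, fun p hp => h p (subset_tsupport _ hp)⟩

variable {E : Type*} [NormedAddCommGroup E] [InnerProductSpace ℝ E] [FiniteDimensional ℝ E]
  [MeasurableSpace E] [BorelSpace E]

lemma integrable_mul_kern (k : ℕ) {e : ℝ} (he : 0 < e) {φ : ℝ × E → ℂ} (hφ : Integrable φ) :
    Integrable fun p : ℝ × E => φ p * kern (k + 1) (phase 0 e p.1) := by
  refine hφ.mul_bdd (c := (e ^ (k + 1))⁻¹)
    ((continuous_kern_phase le_rfl he (k + 1)).comp continuous_fst).aestronglyMeasurable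
    (ae_of_all _ fun p => ?_)
  simpa using norm_kern_phase_le k (c := 0) (u := p.1) le_rfl he

/-- The regularised integral over a set invariant under vertical translations converges. -/
lemma exists_tendsto_vertical (k : ℕ) {φ : ℝ × E → ℂ} (hφ : ContDiff ℝ ∞ φ)
    (hφc : HasCompactSupport φ) {S : Set E} (hS : MeasurableSet S) :
    ∃ L, Tendsto (fun e => ∫ p : ℝ × E, (Prod.snd ⁻¹' S).indicator
      (fun p => φ p * kern (k + 1) (phase 0 e p.1)) p) (𝓝[>] 0) (𝓝 L) := by
  obtain ⟨δ, hδ, hsupp⟩ := exists_norm_le hφc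
  set Ψ : E × ℝ × ℝ → ℂ := fun q => φ (q.2.2, q.1) with hΨ
  obtain ⟨hbd, hlim⟩ := oscillatory (c := 0) (R := δ) le_rfl (k + 1) (Ψ := Ψ)
    (hφ.comp (by fun_prop)) (fun y e u hu => by
      by_contra h
      have := hsupp _ h
      exact absurd ((norm_fst_le (u, y)).trans this) (not_le.2 hu))
  obtain ⟨C, hC⟩ := hbd (closedBall 0 δ) (isCompact_closedBall 0 δ)
  choose L hL using hlim
  have hint : ∀ e, 0 < e → Integrable (fun p : ℝ × E => (Prod.snd ⁻¹' S).indicator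
      (fun p => φ p * kern (k + 1) (phase 0 e p.1)) p) := fun e he =>
    (integrable_mul_kern k he (hφ.continuous.integrable_of_hasCompactSupport hφc)).indicator
      (measurable_snd hS)
  have hin : ∀ e y, ∫ x : ℝ, (Prod.snd ⁻¹' S).indicator
      (fun p : ℝ × E => φ p * kern (k + 1) (phase 0 e p.1)) (x, y) =
      S.indicator (fun y => ∫ u, Ψ (y, e, u) * kern (k + 1) (phase 0 e u)) y := by
    intro e y
    by_cases hy : y ∈ S <;> simp [Set.indicator, hy, hΨ]
  have hpos : ∀ᶠ e in 𝓝[>] (0 : ℝ), e ∈ Set.Ioc (0 : ℝ) 1 := Ioc_mem_nhdsGT one_pos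
  refine ⟨∫ y, S.indicator L y, ?_⟩
  have key : Tendsto (fun e => ∫ y : E, S.indicator
      (fun y => ∫ u, Ψ (y, e, u) * kern (k + 1) (phase 0 e u)) y) (𝓝[>] 0)
      (𝓝 (∫ y, S.indicator L y)) := by
    refine tendsto_integral_filter_of_dominated_convergence
      ((closedBall (0 : E) δ).indicator fun _ => max C 0) ?_ ?_ ?_ ?_
    · filter_upwards [hpos] with e he
      simpa only [hin] using (hint e he.1).integral_prod_right.aestronglyMeasurable
    · filter_upwards [hpos] with e he
      refine ae_of_all _ fun y => ?_
      refine (norm_indicator_le_norm_self _ y).trans ?_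
      by_cases hy : y ∈ closedBall (0 : E) δ
      · rw [Set.indicator_of_mem hy]
        exact (hC y hy e he).trans (le_max_left _ _)
      · rw [Set.indicator_of_notMem hy]
        have h0 : ∀ u, Ψ (y, e, u) = 0 := fun u => by
          by_contra h
          exact hy (mem_closedBall_zero_iff.2 ((norm_snd_le (u, y)).trans (hsupp _ h)))
        simp [h0]
    · exact (integrable_indicator_iff measurableSet_closedBall).2
        (integrableOn_const measure_closedBall_lt_top.ne)
    · refine ae_of_all _ fun y => ?_
      by_cases hy : y ∈ S
      · simpa [Set.indicator, hy] using hL y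
      · simp [Set.indicator, hy]
  refine key.congr' ?_
  filter_upwards [hpos] with e he
  rw [Measure.volume_eq_prod, integral_prod_symm _
    (by simpa [Measure.volume_eq_prod] using hint e he.1)]
  simp only [hin]

end Vertical

section HoroIntegral

lemma inv_pow_le_of_one_le {u : ℝ} (hu : 1 ≤ |u|) {k : ℕ} (hk : 1 ≤ k) :
    (|u| ^ (k + 1))⁻¹ ≤ 2 * (1 + u ^ 2)⁻¹ := by
  have h1 : |u| ^ 2 ≤ |u| ^ (k + 1) := pow_le_pow_right₀ hu (by omega)
  have h2 : 1 ≤ u ^ 2 := by nlinarith [sq_abs u]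
  rw [sq_abs] at h1
  rw [← div_eq_mul_inv, inv_eq_one_div, div_le_div_iff₀ (by positivity) (by positivity)]
  linarith

lemma inv_cube_le {u : ℝ} (hu : 1 ≤ |u|) {k : ℕ} (hk : 2 ≤ k) :
    (|u| ^ (k + 1))⁻¹ ≤ 2 * (1 + u ^ 2)⁻¹ * |u|⁻¹ := by
  have h0 : 0 < |u| := by linarith
  obtain ⟨j, rfl⟩ : ∃ j, k = j + 1 := ⟨k - 1, by omega⟩
  rw [pow_succ, mul_inv]
  exact mul_le_mul_of_nonneg_right (inv_pow_le_of_one_le hu (by omega)) (by positivity)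

variable {E : Type*} [NormedAddCommGroup E] [InnerProductSpace ℝ E]

/-- The integral of `φ` against the kernel along the arc of `horoMap` with label `y`. -/
noncomputable def horoInt (φ : ℝ × E → ℂ) (k : ℕ) (y : E) (e : ℝ) : ℂ :=
  ∫ u : ℝ, φ (horoMap (u, y)) * kern (k + 1) (phase 1 e u)

lemma horoInt_norm_le_and_tendsto {φ : ℝ × E → ℂ} (hφ : ContDiff ℝ ∞ φ)
    (hφc : HasCompactSupport φ) [FiniteDimensional ℝ E] {k : ℕ} (hk : 1 ≤ k) :
    (∀ R, ∃ C, ∀ y, ‖y‖ ≤ R → ∀ e, 0 < e → ‖horoInt φ k y e‖ ≤ C) ∧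
    ∀ y, ∃ L, Tendsto (horoInt φ k y) (𝓝[>] 0) (𝓝 L) := by
  obtain ⟨M, hM⟩ := hφ.continuous.bounded_above_of_compact_support hφc
  have hM0 : 0 ≤ M := (norm_nonneg _).trans (hM 0)
  let χ : ContDiffBump (0 : ℝ) := ⟨1, 2, one_pos, one_lt_two⟩
  have hχ0 : ∀ u, 2 < |u| → χ u = 0 := fun u hu =>
    χ.zero_of_le_dist (by simpa [χ] using hu.le)
  have hχ1 : ∀ u, |u| ≤ 1 → χ u = 1 := fun u hu =>
    χ.one_of_mem_closedBall (by simpa [χ] using hu)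
  set Ψ : (ℝ × E) × ℝ × ℝ → ℂ := fun q => (χ q.2.2 : ℂ) *
    φ (q.2.2 * q.1.1 / (1 + q.2.2 ^ 2), (1 + q.2.2 ^ 2)⁻¹ • q.1.2) with hΨ
  have hne : ∀ q : (ℝ × E) × ℝ × ℝ, 1 + q.2.2 ^ 2 ≠ 0 := fun q => by positivity
  have hΨs : ContDiff ℝ ∞ Ψ := by
    refine ContDiff.mul ?_ (hφ.comp ?_)
    · exact Complex.ofRealCLM.contDiff.comp (χ.contDiff.comp (by fun_prop))
    · refine ContDiff.prodMk ?_ ?_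
      · exact ContDiff.div (by fun_prop) (by fun_prop) hne
      · exact (ContDiff.inv (by fun_prop) hne).smul (by fun_prop)
  obtain ⟨hbd, hlim⟩ := oscillatory (c := 1) (R := 2) zero_le_one (k + 1) hΨs
    (fun y e u hu => by simp [hΨ, hχ0 u hu])
  have hcont : ∀ y : E, Continuous fun u : ℝ => φ (horoMap (u, y)) := fun y =>
    hφ.continuous.comp (continuous_horoMap.comp (by fun_prop))
  have hχc : Continuous fun u => (χ u : ℂ) := Complex.continuous_ofReal.comp χ.continuous
  have hkc : ∀ e, 0 < e → Continuous fun u => kern (k + 1) (phase 1 e u) := fun e he =>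
    continuous_kern_phase zero_le_one he _
  have hfar : ∀ (y : E) (e u : ℝ), ‖(1 - (χ u : ℂ)) * φ (horoMap (u, y)) *
      kern (k + 1) (phase 1 e u)‖ ≤ M * (2 * (1 + u ^ 2)⁻¹) := by
    intro y e u
    by_cases hu : |u| ≤ 1
    · simp only [hχ1 u hu, Complex.ofReal_one, sub_self, zero_mul, norm_zero]
      positivity
    · have hu1 : 1 ≤ |u| := (not_le.1 hu).le
      have hu0 : u ≠ 0 := fun h => by simp [h] at hu1; linarith
      have h1 : ‖1 - (χ u : ℂ)‖ ≤ 1 := by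
        rw [← Complex.ofReal_one, ← Complex.ofReal_sub, Complex.norm_real, Real.norm_eq_abs,
          abs_le]
        constructor <;> linarith [χ.nonneg (x := u), χ.le_one (x := u)]
      rw [norm_mul, norm_mul]
      have h2 := (norm_kern_phase_le_abs k (c := 1) (e := e) hu0).trans
        (inv_pow_le_of_one_le hu1 hk)
      calc _ ≤ 1 * M * (2 * (1 + u ^ 2)⁻¹) := by gcongr; exact hM _
        _ = _ := by ring
  have hdom : Integrable fun u : ℝ => M * (2 * (1 + u ^ 2)⁻¹) :=
    (integrable_inv_one_add_sq.const_mul _).const_mul _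
  have hfarc : ∀ (y : E) (e : ℝ), 0 < e → Continuous fun u =>
      (1 - (χ u : ℂ)) * φ (horoMap (u, y)) * kern (k + 1) (phase 1 e u) := fun y e he =>
    ((continuous_const.sub hχc).mul (hcont y)).mul (hkc e he)
  have hsplit : ∀ (y : E) (e : ℝ), 0 < e → horoInt φ k y e =
      (∫ u, Ψ ((‖y‖, y), e, u) * kern (k + 1) (phase 1 e u)) +
      ∫ u, (1 - (χ u : ℂ)) * φ (horoMap (u, y)) * kern (k + 1) (phase 1 e u) := by
    intro y e he
    rw [← integral_add]
    · refine integral_congr_ae (ae_of_all _ fun u => ?_)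
      simp only [hΨ, horoMap]
      ring
    · refine Continuous.integrable_of_hasCompactSupport
        ((hΨs.continuous.comp (by fun_prop)).mul (hkc e he)) ?_
      exact (hasCompactSupport_of_abs (R := 2)
        fun u hu => by simp [hΨ, hχ0 u hu]).mul_right
    · exact hdom.mono' (hfarc y e he).aestronglyMeasurable (ae_of_all _ (hfar y e))
  constructor
  · intro R
    obtain ⟨C, hC⟩ := hbd (closedBall 0 R) (isCompact_closedBall 0 R)
    refine ⟨max (C + ∫ u : ℝ, M * (2 * (1 + u ^ 2)⁻¹)) (∫ u : ℝ, M * (2 * (1 + u ^ 2)⁻¹)),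
      fun y hy e he => ?_⟩
    rcases le_or_gt e 1 with he1 | he1
    · refine le_trans ?_ (le_max_left _ _)
      rw [hsplit y e he]
      refine (norm_add_le _ _).trans (add_le_add (hC _ ?_ e ⟨he, he1⟩) ?_)
      · rw [mem_closedBall_zero_iff, Prod.norm_def]
        simpa using hy
      · exact norm_integral_le_of_norm_le hdom (ae_of_all _ (hfar y e))
    · refine le_trans ?_ (le_max_right _ _)
      refine norm_integral_le_of_norm_le hdom (ae_of_all _ fun u => ?_)
      rw [norm_mul]
      refine mul_le_mul (hM _) ((norm_kern_phase_le k zero_le_one he).trans ?_)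
        (norm_nonneg _) hM0
      have h1 : 1 + u ^ 2 ≤ (e * (1 + 1 * u ^ 2)) ^ (k + 1) := by
        have h2 : 1 + u ^ 2 ≤ e * (1 + 1 * u ^ 2) := by nlinarith [sq_nonneg u]
        have h3 : 1 ≤ e * (1 + 1 * u ^ 2) := by nlinarith [sq_nonneg u]
        exact h2.trans (le_self_pow₀ h3 (by omega))
      have h4 := inv_anti₀ (by positivity) h1
      have h5 : 0 ≤ (1 + u ^ 2)⁻¹ := by positivity
      linarith
  · intro y
    obtain ⟨L, hL⟩ := hlim (‖y‖, y)
    refine ⟨L + ∫ u : ℝ, (1 - (χ u : ℂ)) * φ (horoMap (u, y)) * ((u : ℂ) ^ (k + 1))⁻¹, ?_⟩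
    have h2 : Tendsto (fun e => ∫ u, (1 - (χ u : ℂ)) * φ (horoMap (u, y)) *
        kern (k + 1) (phase 1 e u)) (𝓝[>] 0) (𝓝 (∫ u : ℝ, (1 - (χ u : ℂ)) *
          φ (horoMap (u, y)) * ((u : ℂ) ^ (k + 1))⁻¹)) := by
      refine tendsto_integral_filter_of_dominated_convergence _ ?_
        (Eventually.of_forall fun e => ae_of_all _ (hfar y e)) hdom ?_
      · filter_upwards [self_mem_nhdsWithin] with e he using (hfarc y e he).aestronglyMeasurable
      · have hne0 : ∀ᵐ u : ℝ, u ≠ 0 := by simp [ae_iff, measure_singleton]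
        filter_upwards [hne0] with u hu using (tendsto_kern_phase k hu).const_mul _
    refine (hL.add h2).congr' ?_
    filter_upwards [self_mem_nhdsWithin] with e he using (hsplit y e he).symm

lemma horoInt_norm_le_of_large {φ : ℝ × E → ℂ} (hφ : Continuous φ)
    (hφc : HasCompactSupport φ) {k : ℕ} (hk : 2 ≤ k) :
    ∃ R C, 1 ≤ R ∧ ∀ y, R ≤ ‖y‖ → ∀ e, ‖horoInt φ k y e‖ ≤ C / √‖y‖ := by
  obtain ⟨M, hM⟩ := hφ.bounded_above_of_compact_support hφc
  have hM0 : 0 ≤ M := (norm_nonneg _).trans (hM 0)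
  obtain ⟨δ, hδ, hsupp⟩ := exists_norm_le hφc
  have hdom : Integrable fun u : ℝ => M * (2 * (1 + u ^ 2)⁻¹) :=
    (integrable_inv_one_add_sq.const_mul _).const_mul _
  refine ⟨2 * δ + 1, (∫ u : ℝ, M * (2 * (1 + u ^ 2)⁻¹)) * √(2 * δ), by linarith,
    fun y hy e => ?_⟩
  have hy0 : 0 < ‖y‖ := by linarith
  rw [mul_div_assoc, ← Real.sqrt_div (by positivity), ← integral_mul_const]
  refine norm_integral_le_of_norm_le (hdom.mul_const _) (ae_of_all _ fun u => ?_)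
  by_cases h0 : φ (horoMap (u, y)) = 0
  · simp only [h0, zero_mul, norm_zero]
    positivity
  have h1 : ‖y‖ ≤ δ * (1 + u ^ 2) := by
    have h := (norm_snd_le _).trans (hsupp _ h0)
    rw [horoMap, norm_smul, Real.norm_of_nonneg (by positivity)] at h
    rwa [inv_mul_le_iff₀ (by positivity), mul_comm] at h
  have h2 : 1 ≤ |u| := by
    rw [← one_le_sq_iff_one_le_abs]
    nlinarith
  have hu0 : u ≠ 0 := fun h => by simp [h] at h2; linarith
  have h3 : |u|⁻¹ ≤ √(2 * δ / ‖y‖) := by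
    refine Real.le_sqrt_of_sq_le ?_
    rw [inv_pow, sq_abs, inv_eq_one_div, div_le_div_iff₀ (by positivity) hy0]
    have : 1 ≤ u ^ 2 := (one_le_sq_iff_one_le_abs u).2 h2
    nlinarith
  rw [norm_mul, mul_assoc M]
  refine mul_le_mul (hM _) ?_ (norm_nonneg _) hM0
  refine ((norm_kern_phase_le_abs k hu0).trans (inv_cube_le h2 hk)).trans ?_
  gcongr

end HoroIntegral

section Cone

variable {E : Type*} [NormedAddCommGroup E] [InnerProductSpace ℝ E]

/-- The region bounded by finitely many spheres and hyperplanes through the origin. -/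
def cone (A : Finset (E × ℝ)) : Set (ℝ × E) :=
  {p | ∀ t ∈ A, 0 ≤ inner ℝ t.1 p.2 + t.2 * (‖p.2‖ ^ 2 + p.1 ^ 2)}

/-- The intersection of `cone A` with the boundary hyperplane. -/
def coneTrace (A : Finset (E × ℝ)) : Set E :=
  {y | ∀ t ∈ A, 0 ≤ inner ℝ t.1 y + t.2 * ‖y‖ ^ 2}

/-- The tangent cone of `coneTrace A` at the origin. -/
def coneTangent (A : Finset (E × ℝ)) : Set E :=
  {y | ∀ t ∈ A, 0 ≤ inner ℝ t.1 y}

lemma isClosed_cone (A : Finset (E × ℝ)) : IsClosed (cone A) := by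
  simp only [cone, Set.ofPred_forall]
  exact isClosed_iInter fun t => isClosed_iInter fun _ => isClosed_le (by fun_prop) (by fun_prop)

lemma isClosed_coneTangent (A : Finset (E × ℝ)) : IsClosed (coneTangent A) := by
  simp only [coneTangent, Set.ofPred_forall]
  exact isClosed_iInter fun t => isClosed_iInter fun _ => isClosed_le (by fun_prop) (by fun_prop)

lemma norm_sq_horoMap (u : ℝ) (y : E) :
    ‖(horoMap (u, y)).2‖ ^ 2 + (horoMap (u, y)).1 ^ 2 = (1 + u ^ 2)⁻¹ * ‖y‖ ^ 2 := by
  simp only [horoMap, norm_smul, norm_inv, Real.norm_of_nonneg (by positivity : 0 ≤ 1 + u ^ 2)]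
  field_simp

lemma horoMap_mem_cone {A : Finset (E × ℝ)} (u : ℝ) (y : E) :
    horoMap (u, y) ∈ cone A ↔ y ∈ coneTrace A := by
  refine forall₂_congr fun t _ => ?_
  rw [norm_sq_horoMap]
  have h : 0 < (1 + u ^ 2)⁻¹ := by positivity
  rw [← mul_nonneg_iff_of_pos_left h (b := inner ℝ t.1 y + t.2 * ‖y‖ ^ 2)]
  simp only [horoMap, inner_smul_right]
  ring_nf

lemma horoMap_snd_mem_coneTangent {A : Finset (E × ℝ)} (u : ℝ) (y : E) :
    (horoMap (u, y)).2 ∈ coneTangent A ↔ y ∈ coneTangent A := by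
  refine forall₂_congr fun t _ => ?_
  have h : 0 < (1 + u ^ 2)⁻¹ := by positivity
  rw [← mul_nonneg_iff_of_pos_left h (b := inner ℝ t.1 y)]
  simp only [horoMap, inner_smul_right]

lemma exists_abs_inner_le {A : Finset (E × ℝ)} {y : E}
    (h : ¬(y ∈ coneTrace A ↔ y ∈ coneTangent A)) :
    ∃ t ∈ A, |inner ℝ t.1 y| ≤ |t.2| * ‖y‖ ^ 2 := by
  by_contra! hc
  refine h (forall₂_congr fun t ht => ?_)
  have h1 := hc t ht
  have h2 : |t.2 * ‖y‖ ^ 2| = |t.2| * ‖y‖ ^ 2 := by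
    rw [abs_mul, abs_of_nonneg (by positivity : 0 ≤ ‖y‖ ^ 2)]
  rw [← h2] at h1
  have h3 := neg_abs_le (t.2 * ‖y‖ ^ 2)
  have h4 := le_abs_self (t.2 * ‖y‖ ^ 2)
  rcases lt_abs.1 h1 with h5 | h5 <;> constructor <;> intro <;> linarith

lemma phase_horoMap {e u : ℝ} {y : E} (hy : y ≠ 0) :
    phase 0 e (horoMap (u, y)).1 =
      ((‖y‖ / (1 + u ^ 2) : ℝ) : ℂ) * phase 1 (e / ‖y‖) u := by
  have h1 : ‖y‖ ≠ 0 := norm_ne_zero_iff.2 hy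
  have h2 : (1 + u ^ 2) ≠ 0 := by positivity
  apply Complex.ext
  · rw [Complex.re_ofReal_mul, phase_re, phase_re, horoMap]
    field_simp
  · rw [Complex.im_ofReal_mul, phase_im, phase_im]
    field_simp
    ring



lemma horoJac_mul_kern {e u : ℝ} {y : E} (hy : y ≠ 0) :
    (horoJac (u, y) : ℂ) * kern (Module.finrank ℝ E + 1) (phase 0 e (horoMap (u, y)).1) =
      ((‖y‖ ^ Module.finrank ℝ E)⁻¹ : ℝ) *
        kern (Module.finrank ℝ E + 1) (phase 1 (e / ‖y‖) u) := by
  have h1 : ‖y‖ ≠ 0 := norm_ne_zero_iff.2 hy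
  have h2 : (1 + u ^ 2) ≠ 0 := by positivity
  rw [phase_horoMap hy]
  simp only [kern]
  rw [mul_pow, mul_inv, ← mul_assoc, ← Complex.ofReal_pow, ← Complex.ofReal_inv,
    ← Complex.ofReal_mul]
  congr 2
  simp only [horoJac]
  rw [div_pow, inv_pow]
  field_simp
  ring

variable [FiniteDimensional ℝ E] [MeasurableSpace E] [BorelSpace E]

/-- The regularised integrals over `cone A` and over its tangent cone differ by a quantity with a
limit. -/
lemma exists_tendsto_cone_sub (hN : 2 ≤ Module.finrank ℝ E) {A : Finset (E × ℝ)}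
    (hA : ∀ t ∈ A, t.1 ≠ 0) {φ : ℝ × E → ℂ} (hφ : ContDiff ℝ ∞ φ) (hφc : HasCompactSupport φ) :
    ∃ L, Tendsto (fun e => ∫ p : ℝ × E,
      ((cone A).indicator 1 p - (Prod.snd ⁻¹' coneTangent A).indicator 1 p) *
        (φ p * kern (Module.finrank ℝ E + 1) (phase 0 e p.1))) (𝓝[>] 0) (𝓝 L) := by
  set N := Module.finrank ℝ E with hNdef
  have : Nontrivial E := Module.nontrivial_of_finrank_pos (R := ℝ) (by omega)
  obtain ⟨hbd, hlim⟩ := horoInt_norm_le_and_tendsto hφ hφc (k := N) (by omega)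
  obtain ⟨R, C₂, hR, hC₂⟩ := horoInt_norm_le_of_large hφ.continuous hφc hN
  obtain ⟨C₁, hC₁⟩ := hbd R
  choose L hL using hlim
  have hne : ∀ᵐ y : E, y ≠ 0 := by simp [ae_iff, measure_singleton]
  have hpos : ∀ᶠ e in 𝓝[>] (0 : ℝ), 0 < e := self_mem_nhdsWithin
  set Q : ℝ × E → ℂ := fun p =>
    (cone A).indicator 1 p - (Prod.snd ⁻¹' coneTangent A).indicator 1 p with hQ
  set q : E → ℂ := fun y => (coneTrace A).indicator 1 y - (coneTangent A).indicator 1 y with hq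
  have hQq : ∀ u y, Q (horoMap (u, y)) = q y := by
    intro u y
    have h1 := horoMap_mem_cone (A := A) u y
    have h2 := horoMap_snd_mem_coneTangent (A := A) u y
    by_cases hy1 : y ∈ coneTrace A <;> by_cases hy2 : y ∈ coneTangent A <;>
      simp [hQ, hq, h1, h2, hy1, hy2]
  have hQm : AEStronglyMeasurable Q :=
    ((aestronglyMeasurable_one.indicator (isClosed_cone A).measurableSet).sub
      (aestronglyMeasurable_one.indicator
        (measurable_snd (isClosed_coneTangent A).measurableSet)))
  have hind : ∀ (α : Type _) (S T : Set α) (x : α),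
      ‖(S.indicator 1 x - T.indicator 1 x : ℂ)‖ ≤ 1 := by
    intro α S T x
    by_cases h1 : x ∈ S <;> by_cases h2 : x ∈ T <;> simp [h1, h2]
  set F : ℝ → ℝ × E → ℂ := fun e p => Q p * (φ p * kern (N + 1) (phase 0 e p.1)) with hF
  have hFint : ∀ e, 0 < e → Integrable (F e) := fun e he =>
    (integrable_mul_kern N he (hφ.continuous.integrable_of_hasCompactSupport hφc)).bdd_mul
      (c := 1) hQm (ae_of_all _ fun p => hind _ _ _ _)
  have hinner : ∀ e, ∀ y ≠ 0, ∫ u : ℝ, horoJac (u, y) • F e (horoMap (u, y)) =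
      ((‖y‖ ^ N)⁻¹ : ℝ) * q y * horoInt φ N y (e / ‖y‖) := by
    intro e y hy
    rw [horoInt, ← integral_const_mul]
    congr 1 with u
    simp only [hF, hQq, Complex.real_smul]
    have := horoJac_mul_kern (e := e) (u := u) hy
    linear_combination (q y * φ (horoMap (u, y))) * this
  set S : E × ℝ → Set E := fun t => {y | ‖y‖ ≤ R ∧ |inner ℝ t.1 y| ≤ |t.2| * ‖y‖ ^ 2} with hS
  have hSm : ∀ t, MeasurableSet (S t) := by
    intro t
    have h1 : IsClosed {y : E | ‖y‖ ≤ R} := isClosed_le (by fun_prop) (by fun_prop)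
    have h2 : IsClosed {y : E | |inner ℝ t.1 y| ≤ |t.2| * ‖y‖ ^ 2} :=
      isClosed_le (by fun_prop) (by fun_prop)
    exact (h1.inter h2).measurableSet
  set g : E → ℝ := fun y =>
    |C₁| * ∑ t ∈ A, (S t).indicator (fun y => (‖y‖ ^ N)⁻¹) y +
      |C₂| * 2 ^ (N + 1 / 2 : ℝ) * (1 + ‖y‖) ^ (-(N + 1 / 2 : ℝ)) with hg
  have hgi : Integrable g := by
    refine ((integrable_finsetSum _ fun t ht => ?_).const_mul _).add
      ((integrable_one_add_norm (by rw [← hNdef]; linarith)).const_mul _)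
    exact (integrable_indicator_iff (hSm t)).2 (integrableOn_cusp (hA t ht) (abs_nonneg _))
  have hdom : ∀ e, 0 < e → ∀ y ≠ 0,
      ‖((‖y‖ ^ N)⁻¹ : ℝ) * q y * horoInt φ N y (e / ‖y‖)‖ ≤ g y := by
    intro e he y hy
    have hy0 : 0 < ‖y‖ := norm_pos_iff.2 hy
    have hsum0 : ∀ t ∈ A, 0 ≤ (S t).indicator (fun y => (‖y‖ ^ N)⁻¹) y := fun t _ =>
      Set.indicator_nonneg (fun _ _ => by positivity) _
    rw [norm_mul, norm_mul, Complex.norm_real, Real.norm_of_nonneg (by positivity)]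
    rcases le_or_gt ‖y‖ R with hyR | hyR
    · refine le_add_of_le_of_nonneg ?_ (by positivity)
      by_cases hqy : y ∈ coneTrace A ↔ y ∈ coneTangent A
      · have : q y = 0 := by
          by_cases h : y ∈ coneTangent A <;> simp [hq, h, hqy]
        rw [this, norm_zero, mul_zero, zero_mul]
        exact mul_nonneg (abs_nonneg _) (Finset.sum_nonneg hsum0)
      · obtain ⟨t, htA, ht⟩ := exists_abs_inner_le hqy
        have h1 : (‖y‖ ^ N)⁻¹ ≤ ∑ t ∈ A, (S t).indicator (fun y => (‖y‖ ^ N)⁻¹) y := by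
          refine le_trans (le_of_eq ?_) (Finset.single_le_sum hsum0 htA)
          rw [Set.indicator_of_mem]
          exact ⟨hyR, ht⟩
        have h2 : ‖horoInt φ N y (e / ‖y‖)‖ ≤ |C₁| :=
          (hC₁ y hyR _ (by positivity)).trans (le_abs_self _)
        calc _ ≤ (∑ t ∈ A, (S t).indicator (fun y => (‖y‖ ^ N)⁻¹) y) * 1 * |C₁| := by
              gcongr
              · exact mul_nonneg (Finset.sum_nonneg hsum0) zero_le_one
              · exact Finset.sum_nonneg hsum0
              · exact hind _ _ _ _
          _ = _ := by ring
    · refine le_add_of_nonneg_of_le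
        (mul_nonneg (abs_nonneg _) (Finset.sum_nonneg hsum0)) ?_
      have hs : 0 < √‖y‖ := Real.sqrt_pos.2 hy0
      have h2 : ‖horoInt φ N y (e / ‖y‖)‖ ≤ |C₂| / √‖y‖ :=
        (hC₂ y hyR.le _).trans (by gcongr; exact le_abs_self _)
      have h3 : (1 + ‖y‖) ^ (N + 1 / 2 : ℝ) ≤ 2 ^ (N + 1 / 2 : ℝ) * (‖y‖ ^ N * √‖y‖) := by
        rw [Real.sqrt_eq_rpow, ← Real.rpow_natCast, ← Real.rpow_add hy0,
          ← Real.mul_rpow (by norm_num) hy0.le]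
        exact Real.rpow_le_rpow (by positivity) (by linarith) (by positivity)
      calc _ ≤ (‖y‖ ^ N)⁻¹ * 1 * (|C₂| / √‖y‖) := by
            gcongr
            exact hind _ _ _ _
        _ = |C₂| * (‖y‖ ^ N * √‖y‖)⁻¹ := by
            rw [mul_inv]
            ring
        _ ≤ |C₂| * (2 ^ (N + 1 / 2 : ℝ) * ((1 + ‖y‖) ^ (N + 1 / 2 : ℝ))⁻¹) := by
            gcongr
            rw [← div_eq_mul_inv, inv_eq_one_div, div_le_div_iff₀ (by positivity) (by positivity)]
            linarith
        _ = _ := by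
            rw [Real.rpow_neg (by positivity)]
            ring
  refine ⟨∫ y, ((‖y‖ ^ N)⁻¹ : ℝ) * q y * L y, ?_⟩
  have key : Tendsto (fun e => ∫ y : E, ∫ u : ℝ, horoJac (u, y) • F e (horoMap (u, y)))
      (𝓝[>] 0) (𝓝 (∫ y, ((‖y‖ ^ N)⁻¹ : ℝ) * q y * L y)) := by
    refine tendsto_integral_filter_of_dominated_convergence g ?_ ?_ hgi ?_
    · filter_upwards [hpos] with e he
      exact (integrable_horo (hFint e he)).integral_prod_right.aestronglyMeasurable
    · filter_upwards [hpos] with e he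
      filter_upwards [hne] with y hy
      rw [hinner e y hy]
      exact hdom e he y hy
    · filter_upwards [hne] with y hy
      simp only [hinner _ y hy]
      refine ((hL y).comp ?_).const_mul _
      refine tendsto_nhdsWithin_iff.2 ⟨?_, ?_⟩
      · have : Tendsto (fun e : ℝ => e / ‖y‖) (𝓝 0) (𝓝 (0 / ‖y‖)) := tendsto_id.div_const _
        rw [zero_div] at this
        exact this.mono_left nhdsWithin_le_nhds
      · filter_upwards [hpos] with e he using div_pos he (norm_pos_iff.2 hy)
  refine key.congr' ?_
  filter_upwards [hpos] with e he
  rw [integral_horo (hFint e he), Measure.volume_eq_prod,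
    integral_prod_symm _ (by simpa [Measure.volume_eq_prod] using integrable_horo (hFint e he))]

/-- The regularised integral of a bump function over `cone A` converges. -/
theorem exists_tendsto_cone {A : Finset (E × ℝ)} (hN : A.Nonempty → 2 ≤ Module.finrank ℝ E)
    (hA : ∀ t ∈ A, t.1 ≠ 0) {φ : ℝ × E → ℂ} (hφ : ContDiff ℝ ∞ φ) (hφc : HasCompactSupport φ) :
    ∃ L, Tendsto (fun e => ∫ p in cone A,
      φ p * kern (Module.finrank ℝ E + 1) (phase 0 e p.1)) (𝓝[>] 0) (𝓝 L) := by
  have hCm := (isClosed_cone A).measurableSet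
  obtain ⟨L, hL⟩ := exists_tendsto_vertical (Module.finrank ℝ E) hφ hφc
    (isClosed_coneTangent A).measurableSet
  rcases A.eq_empty_or_nonempty with rfl | hne
  · refine ⟨L, hL.congr fun e => ?_⟩
    simp [cone, coneTangent]
  · obtain ⟨L', hL'⟩ := exists_tendsto_cone_sub (hN hne) hA hφ hφc
    refine ⟨L' + L, (hL'.add hL).congr' ?_⟩
    filter_upwards [self_mem_nhdsWithin] with e he
    have hi := integrable_mul_kern (Module.finrank ℝ E) he
      (hφ.continuous.integrable_of_hasCompactSupport hφc)
    have hi2 := hi.indicator (measurable_snd (isClosed_coneTangent A).measurableSet)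
    rw [← integral_indicator hCm]
    have hsub := integral_sub (hi.indicator hCm) hi2
    rw [← eq_sub_iff_add_eq, ← hsub]
    congr 1 with p
    by_cases h1 : p ∈ cone A <;> by_cases h2 : p ∈ Prod.snd ⁻¹' coneTangent A <;>
      simp [h1, h2]

end Cone

section Polytope

variable {E : Type*} [NormedAddCommGroup E] [InnerProductSpace ℝ E]

/-- The defining function of a DH-half-space in the coordinates `ℝ × E`. -/
def quad (t : E × ℝ × ℝ) (p : ℝ × E) : ℝ :=
  inner ℝ t.1 p.2 + t.2.1 * (‖p.2‖ ^ 2 + p.1 ^ 2) + t.2.2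

/-- The gradient of `quad t` along the boundary hyperplane does not vanish on its zero set. -/
def IsRegular (t : E × ℝ × ℝ) : Prop :=
  ∀ y : E, quad t (0, y) = 0 → t.1 + (2 * t.2.1) • y ≠ 0

/-- The intersection of the half-spaces `0 ≤ quad t`. -/
def polySet (T : Finset (E × ℝ × ℝ)) : Set (ℝ × E) :=
  {p | ∀ t ∈ T, 0 ≤ quad t p}

open Classical in
/-- The constraints of `T` which are sharp at the boundary point `y`, recentred at `y`. -/
noncomputable def active (T : Finset (E × ℝ × ℝ)) (y : E) : Finset (E × ℝ) :=
  (T.filter fun t => quad t (0, y) = 0).image fun t => (t.1 + (2 * t.2.1) • y, t.2.1)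

lemma continuous_quad (t : E × ℝ × ℝ) : Continuous (quad t) := by
  unfold quad
  fun_prop

lemma isClosed_polySet (T : Finset (E × ℝ × ℝ)) : IsClosed (polySet T) := by
  simp only [polySet, Set.ofPred_forall]
  exact isClosed_iInter fun t => isClosed_iInter fun _ =>
    isClosed_le continuous_const (continuous_quad t)

lemma quad_add (t : E × ℝ × ℝ) (y : E) (q : ℝ × E) :
    quad t ((0, y) + q) = quad t (0, y) +
      (inner ℝ (t.1 + (2 * t.2.1) • y) q.2 + t.2.1 * (‖q.2‖ ^ 2 + q.1 ^ 2)) := by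
  simp only [quad, Prod.snd_add, Prod.fst_add, inner_add_right, inner_add_left,
    real_inner_smul_left, norm_add_sq_real]
  ring

lemma active_ne_zero {T : Finset (E × ℝ × ℝ)} (hT : ∀ t ∈ T, IsRegular t) {y : E} :
    ∀ s ∈ active T y, s.1 ≠ 0 := by
  intro s hs
  simp only [active, Finset.mem_image, Finset.mem_filter] at hs
  obtain ⟨t, ⟨ht, h0⟩, rfl⟩ := hs
  exact hT t ht y h0

lemma eventually_mem_polySet_iff {T : Finset (E × ℝ × ℝ)} {y : E}
    (hy : ((0 : ℝ), y) ∈ polySet T) :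
    ∀ᶠ q in 𝓝 (0 : ℝ × E), (0, y) + q ∈ polySet T ↔ q ∈ cone (active T y) := by
  have h : ∀ᶠ q in 𝓝 (0 : ℝ × E), ∀ t ∈ T, quad t (0, y) ≠ 0 → 0 < quad t ((0, y) + q) := by
    rw [eventually_all_finset]
    intro t ht
    by_cases h0 : quad t (0, y) = 0
    · simp [h0]
    · have h1 : 0 < quad t (0, y) := lt_of_le_of_ne (hy t ht) (Ne.symm h0)
      have h2 : Continuous fun q : ℝ × E => quad t ((0, y) + q) :=
        (continuous_quad t).comp (by fun_prop)
      filter_upwards [h2.continuousAt.eventually_const_lt (by simpa using h1)] with q hq _ using hq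
  filter_upwards [h] with q hq
  constructor
  · intro hP s hs
    simp only [active, Finset.mem_image, Finset.mem_filter] at hs
    obtain ⟨t, ⟨ht, h0⟩, rfl⟩ := hs
    have := hP t ht
    rwa [quad_add, h0, zero_add] at this
  · intro hC t ht
    by_cases h0 : quad t (0, y) = 0
    · rw [quad_add, h0, zero_add]
      refine hC (t.1 + (2 * t.2.1) • y, t.2.1) ?_
      simp only [active, Finset.mem_image, Finset.mem_filter]
      exact ⟨t, ⟨ht, h0⟩, rfl⟩
    · exact (hq t ht h0).le

variable [FiniteDimensional ℝ E]

lemma two_le_finrank_of_ne_zero (hN : Even (Module.finrank ℝ E)) {a : E} (ha : a ≠ 0) :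
    2 ≤ Module.finrank ℝ E := by
  have : Nontrivial E := ⟨a, 0, ha⟩
  have h : 0 < Module.finrank ℝ E := Module.finrank_pos
  obtain ⟨m, hm⟩ := hN
  omega

variable [MeasurableSpace E] [BorelSpace E]

lemma exists_tendsto_of_fst_ne_zero (k : ℕ) {P : Set (ℝ × E)} {φ : ℝ × E → ℂ}
    (hφ : Continuous φ) (hφc : HasCompactSupport φ) {ρ : ℝ} (hρ : 0 < ρ)
    (hsupp : ∀ p, φ p ≠ 0 → ρ ≤ |p.1|) :
    ∃ L, Tendsto (fun e => ∫ p in P, φ p * kern (k + 1) (phase 0 e p.1)) (𝓝[>] 0) (𝓝 L) := by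
  refine ⟨∫ p in P, φ p * ((p.1 : ℂ) ^ (k + 1))⁻¹, ?_⟩
  refine tendsto_integral_filter_of_dominated_convergence
    (fun p => ‖φ p‖ * (ρ ^ (k + 1))⁻¹) ?_ ?_ ?_ ?_
  · filter_upwards [self_mem_nhdsWithin] with e he
    exact (hφ.mul ((continuous_kern_phase le_rfl he (k + 1)).comp
      continuous_fst)).aestronglyMeasurable
  · refine Eventually.of_forall fun e => ae_of_all _ fun p => ?_
    by_cases h0 : φ p = 0
    · simp [h0]
    · have h1 := hsupp p h0
      have h2 : p.1 ≠ 0 := abs_pos.1 (hρ.trans_le h1)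
      rw [norm_mul]
      gcongr
      refine (norm_kern_phase_le_abs k h2).trans ?_
      gcongr
  · exact ((hφ.integrable_of_hasCompactSupport hφc).norm.mul_const _).integrableOn
  · refine ae_of_all _ fun p => ?_
    by_cases h0 : φ p = 0
    · simp [h0]
    · exact (tendsto_kern_phase k (abs_pos.1 (hρ.trans_le (hsupp p h0)))).const_mul _

lemma exists_tendsto_near {T : Finset (E × ℝ × ℝ)} (hT : ∀ t ∈ T, IsRegular t)
    (hN : Even (Module.finrank ℝ E)) {p₀ : ℝ × E} (hp₀ : p₀ ∈ polySet T) :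
    ∃ r > 0, ∀ φ : ℝ × E → ℂ, ContDiff ℝ ∞ φ → HasCompactSupport φ →
      (∀ p, φ p ≠ 0 → dist p p₀ < r) → ∃ L, Tendsto (fun e => ∫ p in polySet T,
        φ p * kern (Module.finrank ℝ E + 1) (phase 0 e p.1)) (𝓝[>] 0) (𝓝 L) := by
  obtain ⟨x, y⟩ := p₀
  rcases eq_or_ne x 0 with rfl | hx
  · obtain ⟨r, hr, hball⟩ := Metric.eventually_nhds_iff.1 (eventually_mem_polySet_iff hp₀)
    refine ⟨r, hr, fun φ hφ hφc hsupp => ?_⟩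
    have hA := active_ne_zero hT (y := y)
    have hφc' : HasCompactSupport fun q : ℝ × E => φ ((0, y) + q) :=
      hφc.comp_isClosedEmbedding (g := fun q => (0, y) + q)
        (Homeomorph.addLeft ((0 : ℝ), y)).isClosedEmbedding
    obtain ⟨L, hL⟩ := exists_tendsto_cone (A := active T y)
      (fun ⟨s, hs⟩ => two_le_finrank_of_ne_zero hN (hA s hs)) hA
      (φ := fun q => φ ((0, y) + q)) (hφ.comp (by fun_prop))
      hφc'
    refine ⟨L, hL.congr fun e => ?_⟩
    rw [← integral_indicator (isClosed_cone _).measurableSet,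
      ← integral_indicator (isClosed_polySet _).measurableSet]
    refine Eq.trans ?_ (integral_add_left_eq_self
      (μ := (volume : Measure ℝ).prod (volume : Measure E)) (fun p => (polySet T).indicator
      (fun p => φ p * kern (Module.finrank ℝ E + 1) (phase 0 e p.1)) p) ((0 : ℝ), y))
    refine integral_congr_ae (ae_of_all _ fun q => ?_)
    dsimp only
    by_cases h0 : φ ((0, y) + q) = 0
    · simp [Set.indicator, h0]
    · have h1 := hball (y := q) (by simpa [dist_eq_norm] using hsupp _ h0)
      by_cases h2 : q ∈ cone (active T y) <;> simp [h2, h1]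
  · have hx0 := abs_pos.2 hx
    refine ⟨|x| / 2, by positivity, fun φ hφ hφc hsupp => ?_⟩
    refine exists_tendsto_of_fst_ne_zero _ hφ.continuous hφc (ρ := |x| / 2) (by positivity)
      fun p hp => ?_
    have h1 : |p.1 - x| < |x| / 2 := (le_max_left _ _).trans_lt (hsupp p hp)
    have h2 := abs_sub_abs_le_abs_sub x p.1
    rw [abs_sub_comm] at h2
    linarith

/-- The regularised volume of a bounded polytope converges. -/
theorem exists_tendsto_polySet {T : Finset (E × ℝ × ℝ)} (hT : ∀ t ∈ T, IsRegular t)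
    (hN : Even (Module.finrank ℝ E)) (hb : Bornology.IsBounded (polySet T)) :
    ∃ L, Tendsto (fun e => ∫ p in polySet T, kern (Module.finrank ℝ E + 1) (phase 0 e p.1))
      (𝓝[>] 0) (𝓝 L) := by
  set N := Module.finrank ℝ E with hNdef
  have hc : IsCompact (polySet T) := isCompact_of_isClosed_isBounded (isClosed_polySet T) hb
  have hint : ∀ φ : ℝ × E → ℂ, Continuous φ → ∀ e, 0 < e →
      IntegrableOn (fun p => φ p * kern (N + 1) (phase 0 e p.1)) (polySet T) := fun φ hφ e he =>
    (hφ.mul ((continuous_kern_phase le_rfl he (N + 1)).comp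
      continuous_fst)).continuousOn.integrableOn_compact hc
  have key : ∃ ψ : ℝ × E → ℂ, ContDiff ℝ ∞ ψ ∧ (∀ p ∈ polySet T, ψ p = 1) ∧
      ∀ φ : ℝ × E → ℂ, ContDiff ℝ ∞ φ → ∃ L, Tendsto (fun e => ∫ p in polySet T,
        φ p * ψ p * kern (N + 1) (phase 0 e p.1)) (𝓝[>] 0) (𝓝 L) := by
    refine hc.induction_on (p := fun s => ∃ ψ : ℝ × E → ℂ, ContDiff ℝ ∞ ψ ∧ (∀ p ∈ s, ψ p = 1) ∧
      ∀ φ : ℝ × E → ℂ, ContDiff ℝ ∞ φ → ∃ L, Tendsto (fun e => ∫ p in polySet T,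
        φ p * ψ p * kern (N + 1) (phase 0 e p.1)) (𝓝[>] 0) (𝓝 L)) ?_ ?_ ?_ ?_
    · exact ⟨0, contDiff_const, by simp, fun φ _ => ⟨0, by simp⟩⟩
    · rintro s t hst ⟨ψ, h1, h2, h3⟩
      exact ⟨ψ, h1, fun p hp => h2 p (hst hp), h3⟩
    · rintro s t ⟨ψ₁, h1, h2, h3⟩ ⟨ψ₂, g1, g2, g3⟩
      refine ⟨ψ₁ + ψ₂ - ψ₁ * ψ₂, (h1.add g1).sub (h1.mul g1), ?_, fun φ hφ => ?_⟩
      · rintro p (hp | hp)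
        · simp [h2 p hp]
        · simp [g2 p hp]
      · obtain ⟨L₁, hL₁⟩ := h3 φ hφ
        obtain ⟨L₂, hL₂⟩ := g3 (fun p => φ p * (1 - ψ₁ p)) (hφ.mul (contDiff_const.sub h1))
        refine ⟨L₁ + L₂, (hL₁.add hL₂).congr' ?_⟩
        filter_upwards [self_mem_nhdsWithin] with e he
        rw [← integral_add]
        · congr 1 with p
          simp only [Pi.add_apply, Pi.sub_apply, Pi.mul_apply]
          ring
        · exact hint (fun p => φ p * ψ₁ p) (hφ.mul h1).continuous e he
        · exact hint (fun p => φ p * (1 - ψ₁ p) * ψ₂ p)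
            ((hφ.mul (contDiff_const.sub h1)).mul g1).continuous e he
    · intro p₀ hp₀
      obtain ⟨r, hr, hgood⟩ := exists_tendsto_near hT hN hp₀
      let χ : ContDiffBump p₀ := ⟨r / 2, r, by positivity, by linarith⟩
      have hχs : ContDiff ℝ ∞ fun p => (χ p : ℂ) := Complex.ofRealCLM.contDiff.comp χ.contDiff
      have hχc : HasCompactSupport fun p => (χ p : ℂ) :=
        χ.hasCompactSupport.comp_left Complex.ofReal_zero
      refine ⟨closedBall p₀ (r / 2), mem_nhdsWithin_of_mem_nhds
        (closedBall_mem_nhds _ (by positivity)), fun p => (χ p : ℂ), hχs, fun p hp => ?_,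
        fun φ hφ => hgood _ (hφ.mul hχs) hχc.mul_left fun p hp => ?_⟩
      · exact congrArg Complex.ofReal (χ.one_of_mem_closedBall hp)
      · by_contra h
        refine hp ?_
        dsimp only
        rw [χ.zero_of_le_dist (not_lt.1 h), Complex.ofReal_zero, mul_zero]
  obtain ⟨ψ, -, hψ, h⟩ := key
  obtain ⟨L, hL⟩ := h 1 contDiff_const
  refine ⟨L, hL.congr fun e => setIntegral_congr_fun (isClosed_polySet T).measurableSet ?_⟩
  intro p hp
  simp [hψ p hp]

end Polytope

section Comparison

variable {E : Type*} [NormedAddCommGroup E] [InnerProductSpace ℝ E]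

lemma mem_cone_iff_smul_mem {A : Finset (E × ℝ)} {x : ℝ} {z : E} (hz : z ≠ 0) :
    (x, z) ∈ cone A ↔ ((0 : ℝ), (1 + x ^ 2 / ‖z‖ ^ 2) • z) ∈ cone A := by
  refine forall₂_congr fun t _ => ?_
  have hz0 : ‖z‖ ≠ 0 := norm_ne_zero_iff.2 hz
  have h : 0 < 1 + x ^ 2 / ‖z‖ ^ 2 := by positivity
  rw [← mul_nonneg_iff_of_pos_left h (b := inner ℝ t.1 z + t.2 * (‖z‖ ^ 2 + x ^ 2))]
  simp only [inner_smul_right, norm_smul, Real.norm_of_nonneg h.le]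
  refine iff_of_eq (congrArg (0 ≤ ·) ?_)
  field_simp
  ring

/-- Two cones with the same trace near the origin of the boundary hyperplane agree outside a
paraboloid. -/
lemma norm_le_of_mem_cone_ne {A A' : Finset (E × ℝ)} {δ : ℝ} (hδ : 0 < δ)
    (hAA' : ∀ z : E, ‖z‖ < δ → (((0 : ℝ), z) ∈ cone A ↔ ((0 : ℝ), z) ∈ cone A')) {x : ℝ} {z : E}
    (hz : ‖z‖ < δ / 2) (h : ¬((x, z) ∈ cone A ↔ (x, z) ∈ cone A')) :
    ‖z‖ ≤ 2 / δ * x ^ 2 := by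
  rcases eq_or_ne z 0 with rfl | hz0
  · rw [norm_zero]
    positivity
  by_contra! hlt
  have hzn : 0 < ‖z‖ := norm_pos_iff.2 hz0
  rw [mem_cone_iff_smul_mem hz0, mem_cone_iff_smul_mem hz0] at h
  refine h (hAA' _ ?_)
  rw [norm_smul, Real.norm_of_nonneg (by positivity)]
  have h1 : x ^ 2 / ‖z‖ < δ / 2 := by
    rw [div_mul_eq_mul_div, div_lt_iff₀ hδ] at hlt
    rw [div_lt_div_iff₀ hzn two_pos]
    linarith
  have h2 : (1 + x ^ 2 / ‖z‖ ^ 2) * ‖z‖ = ‖z‖ + x ^ 2 / ‖z‖ := by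
    field_simp
  rw [h2]
  linarith

lemma neg_fst_mem_polySet {T : Finset (E × ℝ × ℝ)} (p : ℝ × E) :
    (-p.1, p.2) ∈ polySet T ↔ p ∈ polySet T := by
  simp [polySet, quad]

variable [FiniteDimensional ℝ E] [MeasurableSpace E] [BorelSpace E]

lemma integrableOn_paraboloid (hN : 1 ≤ Module.finrank ℝ E) {K : ℝ} (hK : 0 ≤ K) (y : E) :
    IntegrableOn (fun p : ℝ × E => (|p.1| ^ (Module.finrank ℝ E + 1))⁻¹)
      {p | |p.1| ≤ 1 ∧ ‖p.2 - y‖ ≤ K * p.1 ^ 2} := by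
  set N := Module.finrank ℝ E with hNdef
  set G : Set (ℝ × E) := {p | |p.1| ≤ 1 ∧ ‖p.2 - y‖ ≤ K * p.1 ^ 2} with hG
  have hGm : MeasurableSet G := by
    have h1 : IsClosed {p : ℝ × E | |p.1| ≤ 1} := isClosed_le (by fun_prop) (by fun_prop)
    have h2 : IsClosed {p : ℝ × E | ‖p.2 - y‖ ≤ K * p.1 ^ 2} :=
      isClosed_le (by fun_prop) (by fun_prop)
    exact (h1.inter h2).measurableSet
  have hmeas : Measurable fun p : ℝ × E => (|p.1| ^ (N + 1))⁻¹ := by fun_prop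
  set V := volume (closedBall (0 : E) 1) with hV
  have hVt : V < ⊤ := measure_closedBall_lt_top
  refine ⟨hmeas.aestronglyMeasurable, ?_⟩
  rw [hasFiniteIntegral_iff_enorm, ← lintegral_indicator hGm, Measure.volume_eq_prod,
    lintegral_prod _ (hmeas.enorm.indicator hGm).aemeasurable]
  have hslice : ∀ x : ℝ, ∫⁻ z : E, G.indicator (fun p => ‖(|p.1| ^ (N + 1))⁻¹‖ₑ) (x, z) ≤
      (Set.Icc (-1 : ℝ) 1).indicator (fun _ => ENNReal.ofReal (K ^ N) * V) x := by
    intro x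
    by_cases hx : x ∈ Set.Icc (-1 : ℝ) 1
    · rw [Set.indicator_of_mem hx]
      have hx1 : |x| ≤ 1 := abs_le.2 hx
      calc _ ≤ ∫⁻ z : E, (closedBall y (K * x ^ 2)).indicator
            (fun _ => ENNReal.ofReal ((|x| ^ (N + 1))⁻¹)) z := by
            refine lintegral_mono fun z => Set.indicator_apply_le' (fun h => ?_) fun _ => zero_le
            rw [Set.indicator_of_mem (by simpa [dist_eq_norm] using h.2),
              Real.enorm_of_nonneg (by positivity)]
        _ = ENNReal.ofReal ((|x| ^ (N + 1))⁻¹ * (K * x ^ 2) ^ N) * V := by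
            rw [lintegral_indicator_const measurableSet_closedBall,
              Measure.addHaar_closedBall' _ _ (by positivity), ← mul_assoc,
              ← ENNReal.ofReal_mul (by positivity)]
        _ ≤ ENNReal.ofReal (K ^ N) * V := by
            gcongr
            rcases eq_or_ne x 0 with rfl | hx0
            · simp only [abs_zero, ne_eq, Nat.add_eq_zero_iff, one_ne_zero, and_false,
                not_false_eq_true, zero_pow, inv_zero, zero_mul]
              positivity
            · have hx2 : 0 < |x| := abs_pos.2 hx0
              rw [inv_mul_le_iff₀ (by positivity), mul_pow, mul_comm (|x| ^ (N + 1)), ← sq_abs,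
                ← pow_mul]
              gcongr ?_ * ?_
              exact pow_le_pow_of_le_one hx2.le hx1 (by omega)
    · rw [Set.indicator_of_notMem hx]
      refine le_of_eq ((lintegral_congr fun z => ?_).trans lintegral_zero)
      exact Set.indicator_of_notMem (fun h => hx (abs_le.1 h.1)) _
  refine (lintegral_mono hslice).trans_lt ?_
  rw [lintegral_indicator_const measurableSet_Icc, Real.volume_Icc]
  exact ENNReal.mul_lt_top (ENNReal.mul_lt_top ENNReal.ofReal_lt_top hVt) ENNReal.ofReal_lt_top

variable {T T' : Finset (E × ℝ × ℝ)}

lemma integrableOn_symmDiff_near (hT : ∀ t ∈ T, IsRegular t) (hT' : ∀ t ∈ T', IsRegular t)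
    (hN : Even (Module.finrank ℝ E))
    (hTT' : ∀ y : E, ((0 : ℝ), y) ∈ polySet T ↔ ((0 : ℝ), y) ∈ polySet T') {y : E}
    (hy : ((0 : ℝ), y) ∈ polySet T) :
    ∃ r > 0, IntegrableOn (fun p : ℝ × E => (|p.1| ^ (Module.finrank ℝ E + 1))⁻¹)
      (ball (0, y) r ∩ symmDiff (polySet T) (polySet T')) := by
  obtain ⟨r, hr, hball⟩ := Metric.eventually_nhds_iff.1
    ((eventually_mem_polySet_iff hy).and (eventually_mem_polySet_iff ((hTT' y).1 hy)))
  have hmem : ∀ p : ℝ × E, dist p (0, y) < r →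
      ((p ∈ polySet T ↔ (p.1, p.2 - y) ∈ cone (active T y)) ∧
        (p ∈ polySet T' ↔ (p.1, p.2 - y) ∈ cone (active T' y))) := by
    intro p hp
    have h := hball (y := (p.1, p.2 - y))
      (by simpa [dist_eq_norm, Prod.norm_def] using hp)
    simpa using h
  by_cases hA : active T y = ∅ ∧ active T' y = ∅
  · refine ⟨r, hr, ?_⟩
    have : ball ((0 : ℝ), y) r ∩ symmDiff (polySet T) (polySet T') = ∅ := by
      refine Set.eq_empty_of_forall_notMem fun p hp => ?_
      obtain ⟨h1, h2⟩ := hmem p hp.1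
      rw [hA.1] at h1
      rw [hA.2] at h2
      have hc : (p.1, p.2 - y) ∈ cone (∅ : Finset (E × ℝ)) := by simp [cone]
      rcases hp.2 with h3 | h3
      · exact h3.2 (h2.2 hc)
      · exact h3.2 (h1.2 hc)
    rw [this]
    exact integrableOn_empty
  · have hN1 : 2 ≤ Module.finrank ℝ E := by
      by_cases h1 : active T y = ∅
      · obtain ⟨s, hs⟩ := Finset.nonempty_iff_ne_empty.2 fun h2 => hA ⟨h1, h2⟩
        exact two_le_finrank_of_ne_zero hN (active_ne_zero hT' s hs)
      · obtain ⟨s, hs⟩ := Finset.nonempty_iff_ne_empty.2 h1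
        exact two_le_finrank_of_ne_zero hN (active_ne_zero hT s hs)
    have htrace : ∀ z : E, ‖z‖ < r →
        (((0 : ℝ), z) ∈ cone (active T y) ↔ ((0 : ℝ), z) ∈ cone (active T' y)) := by
      intro z hz
      obtain ⟨h1, h2⟩ := hball (y := ((0 : ℝ), z))
        (by simpa [dist_eq_norm, Prod.norm_def] using hz)
      rw [← h1, ← h2]
      simpa using hTT' (y + z)
    refine ⟨min (r / 2) 1, by positivity, (integrableOn_paraboloid (by omega)
      (K := 2 / r) (by positivity) y).mono_set fun p hp => ?_⟩
    have hp1 : dist p (0, y) < min (r / 2) 1 := hp.1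
    obtain ⟨h1, h2⟩ := hmem p (hp1.trans_le ((min_le_left _ _).trans (by linarith)))
    have hp2 : |p.1| < min (r / 2) 1 := by
      simpa using (le_max_left _ _).trans_lt hp1
    have hp3 : ‖p.2 - y‖ < min (r / 2) 1 := by
      simpa [dist_eq_norm] using (le_max_right _ _).trans_lt hp1
    refine ⟨(hp2.trans_le (min_le_right _ _)).le, norm_le_of_mem_cone_ne hr htrace
      (hp3.trans_le (min_le_left _ _)) ?_⟩
    rw [← h1, ← h2]
    rcases hp.2 with h3 | h3
    · exact fun h => h3.2 (h.1 h3.1)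
    · exact fun h => h3.2 (h.2 h3.1)

lemma integrableOn_symmDiff (hT : ∀ t ∈ T, IsRegular t) (hT' : ∀ t ∈ T', IsRegular t)
    (hN : Even (Module.finrank ℝ E)) (hb : Bornology.IsBounded (polySet T))
    (hb' : Bornology.IsBounded (polySet T'))
    (hTT' : ∀ y : E, ((0 : ℝ), y) ∈ polySet T ↔ ((0 : ℝ), y) ∈ polySet T') :
    IntegrableOn (fun p : ℝ × E => (|p.1| ^ (Module.finrank ℝ E + 1))⁻¹)
      (symmDiff (polySet T) (polySet T')) := by
  set N := Module.finrank ℝ E with hNdef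
  set D := symmDiff (polySet T) (polySet T') with hD
  set s := polySet T ∪ polySet T' with hs
  have hDs : D ⊆ s := symmDiff_le_sup
  have hc : IsCompact s := (isCompact_of_isClosed_isBounded (isClosed_polySet T) hb).union
    (isCompact_of_isClosed_isBounded (isClosed_polySet T') hb')
  have hloc : LocallyIntegrableOn (fun p : ℝ × E => (|p.1| ^ (N + 1))⁻¹) s
      (volume.restrict D) := by
    rintro ⟨x, y⟩ hp
    suffices h : ∃ r > 0, IntegrableOn (fun p : ℝ × E => (|p.1| ^ (N + 1))⁻¹)
        (ball (x, y) r ∩ D) by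
      obtain ⟨r, hr, h⟩ := h
      refine ⟨ball (x, y) r, mem_nhdsWithin_of_mem_nhds (ball_mem_nhds _ hr), ?_⟩
      rwa [IntegrableOn, Measure.restrict_restrict measurableSet_ball]
    rcases eq_or_ne x 0 with rfl | hx
    · refine integrableOn_symmDiff_near hT hT' hN hTT' ?_
      rcases hp with hp | hp
      exacts [hp, (hTT' y).2 hp]
    · have hx0 := abs_pos.2 hx
      refine ⟨|x| / 2, by positivity, IntegrableOn.mono_set ?_ Set.inter_subset_left⟩
      have hmeas : Measurable fun p : ℝ × E => (|p.1| ^ (N + 1))⁻¹ := by fun_prop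
      refine Measure.integrableOn_of_bounded (M := ((|x| / 2) ^ (N + 1))⁻¹)
        measure_ball_lt_top.ne hmeas.aestronglyMeasurable
        ((ae_restrict_iff' measurableSet_ball).2 (ae_of_all _ fun p hp => ?_))
      have h1 : |p.1 - x| < |x| / 2 := (le_max_left _ _).trans_lt hp
      have h2 := abs_sub_abs_le_abs_sub x p.1
      rw [abs_sub_comm] at h2
      have h3 : |x| / 2 ≤ |p.1| := by linarith
      rw [Real.norm_of_nonneg (by positivity)]
      gcongr
  have := hloc.integrableOn_isCompact hc
  rwa [IntegrableOn, Measure.restrict_restrict hc.measurableSet, Set.inter_eq_right.2 hDs] at this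

/-- Bounded polytopes with the same boundary have the same volume. -/
theorem exists_common_limit (hT : ∀ t ∈ T, IsRegular t) (hT' : ∀ t ∈ T', IsRegular t)
    (hN : Even (Module.finrank ℝ E)) (hb : Bornology.IsBounded (polySet T))
    (hb' : Bornology.IsBounded (polySet T'))
    (hTT' : ∀ y : E, ((0 : ℝ), y) ∈ polySet T ↔ ((0 : ℝ), y) ∈ polySet T') :
    ∃ L,
      Tendsto (fun e => ∫ p in polySet T, kern (Module.finrank ℝ E + 1) (phase 0 e p.1))
        (𝓝[>] 0) (𝓝 L) ∧
      Tendsto (fun e => ∫ p in polySet T', kern (Module.finrank ℝ E + 1) (phase 0 e p.1))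
        (𝓝[>] 0) (𝓝 L) := by
  obtain ⟨L, hL⟩ := exists_tendsto_polySet hT hN hb
  refine ⟨L, hL, ?_⟩
  have hdom := integrableOn_symmDiff hT hT' hN hb hb' hTT'
  set N := Module.finrank ℝ E with hNdef
  have hm := (isClosed_polySet T).measurableSet
  have hm' := (isClosed_polySet T').measurableSet
  have hDm : MeasurableSet (symmDiff (polySet T) (polySet T')) := hm.symmDiff hm'
  set q : ℝ × E → ℂ := fun p => (polySet T).indicator 1 p - (polySet T').indicator 1 p with hq
  have hqm : AEStronglyMeasurable q :=
    (aestronglyMeasurable_one.indicator hm).sub (aestronglyMeasurable_one.indicator hm')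
  have hne : ∀ᵐ p : ℝ × E, p.1 ≠ 0 := by
    have h0 : ∀ᵐ x : ℝ, x ≠ 0 := by simp [ae_iff, measure_singleton]
    exact Measure.quasiMeasurePreserving_fst.ae h0
  have hlim : Tendsto (fun e => ∫ p, q p * kern (N + 1) (phase 0 e p.1)) (𝓝[>] 0)
      (𝓝 (∫ p, q p * ((p.1 : ℂ) ^ (N + 1))⁻¹)) := by
    refine tendsto_integral_filter_of_dominated_convergence _ ?_ ?_
      ((integrable_indicator_iff hDm).2 hdom) ?_
    · filter_upwards [self_mem_nhdsWithin] with e he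
      exact hqm.mul ((continuous_kern_phase le_rfl he (N + 1)).comp
        continuous_fst).aestronglyMeasurable
    · refine Eventually.of_forall fun e => ?_
      filter_upwards [hne] with p hp
      have hk := norm_kern_phase_le_abs N (c := 0) (e := e) hp
      by_cases h1 : p ∈ polySet T <;> by_cases h2 : p ∈ polySet T' <;>
        simp [hq, Set.mem_symmDiff, h1, h2, hk]
    · filter_upwards [hne] with p hp using (tendsto_kern_phase N hp).const_mul _
  have hzero : ∫ p, q p * ((p.1 : ℂ) ^ (N + 1))⁻¹ = 0 := by
    have hmp : MeasurePreserving (fun p : ℝ × E => (-p.1, p.2)) :=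
      (Measure.measurePreserving_neg (volume : Measure ℝ)).prod (MeasurePreserving.id volume)
    have h := hmp.integral_comp
      ((MeasurableEquiv.neg ℝ).prodCongr (MeasurableEquiv.refl E)).measurableEmbedding
      fun p => q p * ((p.1 : ℂ) ^ (N + 1))⁻¹
    have h2 : ∀ p : ℝ × E, q (-p.1, p.2) * ((((-p.1, p.2) : ℝ × E).1 : ℂ) ^ (N + 1))⁻¹ =
        -(q p * ((p.1 : ℂ) ^ (N + 1))⁻¹) := by
      intro p
      have hq2 : q (-p.1, p.2) = q p := by
        have e1 := neg_fst_mem_polySet (T := T) p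
        have e2 := neg_fst_mem_polySet (T := T') p
        by_cases h1 : p ∈ polySet T <;> by_cases h2 : p ∈ polySet T' <;> simp [hq, e1, e2, h1, h2]
      rw [hq2, Complex.ofReal_neg, (hN.add_one).neg_pow, inv_neg, mul_neg]
    simp only [h2] at h
    rw [integral_neg] at h
    exact self_eq_neg.1 h.symm
  rw [hzero] at hlim
  have hsub := hL.sub hlim
  rw [sub_zero] at hsub
  refine hsub.congr' ?_
  filter_upwards [self_mem_nhdsWithin] with e he
  have hcont : Continuous fun p : ℝ × E => kern (N + 1) (phase 0 e p.1) :=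
    (continuous_kern_phase le_rfl he (N + 1)).comp continuous_fst
  have hi : IntegrableOn (fun p : ℝ × E => kern (N + 1) (phase 0 e p.1)) (polySet T) :=
    hcont.continuousOn.integrableOn_compact
      (isCompact_of_isClosed_isBounded (isClosed_polySet T) hb)
  have hi' : IntegrableOn (fun p : ℝ × E => kern (N + 1) (phase 0 e p.1)) (polySet T') :=
    hcont.continuousOn.integrableOn_compact
      (isCompact_of_isClosed_isBounded (isClosed_polySet T') hb')
  rw [sub_eq_iff_eq_add, ← sub_eq_iff_eq_add', ← integral_indicator hm, ← integral_indicator hm',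
    ← integral_sub ((integrable_indicator_iff hm).2 hi) ((integrable_indicator_iff hm').2 hi')]
  congr 1 with p
  by_cases h1 : p ∈ polySet T <;> by_cases h2 : p ∈ polySet T' <;> simp [hq, h1, h2]

end Comparison

section Transfer

/-- Splitting off the first coordinate. -/
noncomputable def splitFst (N : ℕ) :
    EuclideanSpace ℝ (Fin (N + 1)) ≃ᵐ ℝ × EuclideanSpace ℝ (Fin N) :=
  (MeasurableEquiv.toLp 2 (Fin (N + 1) → ℝ)).symm.trans
    ((MeasurableEquiv.piFinSuccAbove (fun _ => ℝ) 0).trans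
      ((MeasurableEquiv.refl ℝ).prodCongr (MeasurableEquiv.toLp 2 (Fin N → ℝ))))

lemma splitFst_apply {N : ℕ} (x : EuclideanSpace ℝ (Fin (N + 1))) :
    splitFst N x = (x 0, WithLp.toLp 2 (Fin.tail x)) := rfl

lemma measurePreserving_splitFst (N : ℕ) : MeasurePreserving (splitFst N) :=
  ((MeasurePreserving.id volume).prod (PiLp.volume_preserving_toLp (Fin N))).comp
    ((volume_preserving_piFinSuccAbove (fun _ => ℝ) 0).comp
      (PiLp.volume_preserving_ofLp (Fin (N + 1))))

lemma inner_splitFst {N : ℕ} (x y : EuclideanSpace ℝ (Fin (N + 1))) :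
    inner ℝ x y = x 0 * y 0 + inner ℝ (splitFst N x).2 (splitFst N y).2 := by
  simp [splitFst_apply, PiLp.inner_apply, Fin.sum_univ_succ, Fin.tail, mul_comm]

lemma norm_sq_splitFst {N : ℕ} (x : EuclideanSpace ℝ (Fin (N + 1))) :
    ‖x‖ ^ 2 = x 0 ^ 2 + ‖(splitFst N x).2‖ ^ 2 := by
  rw [← real_inner_self_eq_norm_sq, ← real_inner_self_eq_norm_sq, inner_splitFst, sq]

lemma dist_sq_splitFst {N : ℕ} {c : EuclideanSpace ℝ (Fin (N + 1))} (hc : c 0 = 0)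
    (x : EuclideanSpace ℝ (Fin (N + 1))) :
    dist x c ^ 2 = ‖(splitFst N x).2‖ ^ 2 - 2 * inner ℝ (splitFst N c).2 (splitFst N x).2 +
      ‖(splitFst N c).2‖ ^ 2 + x 0 ^ 2 := by
  rw [dist_eq_norm, norm_sub_sq_real, real_inner_comm, inner_splitFst, norm_sq_splitFst x,
    norm_sq_splitFst c, hc]
  ring

lemma norm_splitFst_le {N : ℕ} (x : EuclideanSpace ℝ (Fin (N + 1))) : ‖splitFst N x‖ ≤ ‖x‖ := by
  have h := norm_sq_splitFst x
  refine max_le ?_ ?_ <;> refine abs_le_of_sq_le_sq' ?_ (norm_nonneg x) |>.2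
  · rw [splitFst_apply, Real.norm_eq_abs, sq_abs]
    nlinarith
  · nlinarith

lemma exists_isRegular_of_isDHHalfSpace {N : ℕ} {H : Set (EuclideanSpace ℝ (Fin (N + 1)))}
    (hH : IsDHHalfSpace H) :
    ∃ t : EuclideanSpace ℝ (Fin N) × ℝ × ℝ, IsRegular t ∧
      ∀ x, x ∈ H ↔ 0 ≤ quad t (splitFst N x) := by
  have hsphere : ∀ {a y : EuclideanSpace ℝ (Fin N)} {r : ℝ}, 0 < r → y = a →
      ‖y‖ ^ 2 - 2 * inner ℝ a y + ‖a‖ ^ 2 ≠ r ^ 2 := by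
    rintro a _ r hr rfl
    rw [real_inner_self_eq_norm_sq]
    nlinarith
  obtain ⟨c, r, hr, hc, rfl⟩ | ⟨c, r, hr, hc, rfl⟩ | ⟨v, s, hv, hv0, rfl⟩ := hH
  · refine ⟨((2 : ℝ) • (splitFst N c).2, -1, r ^ 2 - ‖(splitFst N c).2‖ ^ 2), ?_, fun x => ?_⟩
    · intro y hy h
      refine hsphere (a := (splitFst N c).2) hr (y := y) ?_ ?_
      · have h' : (2 : ℝ) • ((splitFst N c).2 - y) = 0 := by
          rw [← h]
          module
        exact (sub_eq_zero.1 ((smul_eq_zero.1 h').resolve_left two_ne_zero)).symm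
      · simp only [quad, inner_smul_left, RCLike.conj_to_real] at hy
        linarith
    · rw [mem_closedBall, ← pow_le_pow_iff_left₀ dist_nonneg hr.le two_ne_zero,
        dist_sq_splitFst hc, ← sub_nonneg]
      refine iff_of_eq (congrArg (0 ≤ ·) ?_)
      simp only [quad, inner_smul_left, RCLike.conj_to_real]
      rw [show (splitFst N x).1 = x 0 from rfl]
      ring
  · refine ⟨((-2 : ℝ) • (splitFst N c).2, 1, ‖(splitFst N c).2‖ ^ 2 - r ^ 2), ?_, fun x => ?_⟩
    · intro y hy h
      refine hsphere (a := (splitFst N c).2) hr (y := y) ?_ ?_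
      · have h' : (2 : ℝ) • (y - (splitFst N c).2) = 0 := by
          rw [← h]
          module
        exact sub_eq_zero.1 ((smul_eq_zero.1 h').resolve_left two_ne_zero)
      · simp only [quad, inner_smul_left, RCLike.conj_to_real] at hy
        linarith
    · rw [Set.mem_compl_iff, mem_ball, not_lt,
        ← pow_le_pow_iff_left₀ hr.le dist_nonneg two_ne_zero, dist_sq_splitFst hc, ← sub_nonneg]
      refine iff_of_eq (congrArg (0 ≤ ·) ?_)
      simp only [quad, inner_smul_left, RCLike.conj_to_real]
      rw [show (splitFst N x).1 = x 0 from rfl]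
      ring
  · refine ⟨((splitFst N v).2, 0, -s), ?_, fun x => ?_⟩
    · intro y _ h
      have h' : (splitFst N v).2 = 0 := by simpa using h
      have h2 := norm_sq_splitFst v
      rw [hv0, h'] at h2
      exact hv (by simpa using h2)
    · rw [Set.mem_ofPred_eq, inner_splitFst, hv0, ← sub_nonneg]
      refine iff_of_eq (congrArg (0 ≤ ·) ?_)
      simp only [quad]
      ring

lemma exists_polySet_of_isDHPolytope {N : ℕ} {P : Set (EuclideanSpace ℝ (Fin (N + 1)))}
    (hP : IsDHPolytope P) :
    ∃ T : Finset (EuclideanSpace ℝ (Fin N) × ℝ × ℝ), (∀ t ∈ T, IsRegular t) ∧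
      P = splitFst N ⁻¹' polySet T := by
  classical
  obtain ⟨S, hS, rfl⟩ := hP
  choose! f hf using fun H (hH : H ∈ S) => exists_isRegular_of_isDHHalfSpace (hS H hH)
  refine ⟨S.image f, by simpa using fun H hH => (hf H hH).1, ?_⟩
  ext x
  simp only [Set.mem_sInter, Finset.mem_coe, Set.mem_preimage, polySet, Set.mem_ofPred_eq,
    Finset.forall_mem_image]
  exact forall₂_congr fun H hH => (hf H hH).2 x

lemma isBounded_of_preimage_splitFst {N : ℕ} {A : Set (ℝ × EuclideanSpace ℝ (Fin N))}
    (hA : Bornology.IsBounded (splitFst N ⁻¹' A)) : Bornology.IsBounded A := by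
  obtain ⟨C, hC⟩ := isBounded_iff_forall_norm_le.1 hA
  refine isBounded_iff_forall_norm_le.2 ⟨C, fun p hp => ?_⟩
  obtain ⟨x, rfl⟩ := (splitFst N).surjective p
  exact (norm_splitFst_le x).trans (hC x hp)

lemma dhInt_preimage_splitFst {N : ℕ} (A : Set (ℝ × EuclideanSpace ℝ (Fin N))) (e : ℝ) :
    dhInt (N + 1) (splitFst N ⁻¹' A) e = ∫ p in A, kern (N + 1) (phase 0 e p.1) := by
  rw [← (measurePreserving_splitFst N).setIntegral_preimage_emb
    (splitFst N).measurableEmbedding, dhInt]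
  refine integral_congr_ae (ae_of_all _ fun x => ?_)
  dsimp only
  rw [zpow_neg, zpow_natCast]
  simp [splitFst_apply, kern, phase]

end Transfer

end DHVolume

/-- **Theorem 1.4, second part**: for odd `n`, the volume `V_n(P)` of a bounded DH-polytope
is completely determined by `P ∩ {x₀ = 0}`, the intersection of `P` with the boundary at
infinity `∂Hⁿ` in the upper half-space model. -/
theorem dh_volume_determined_by_boundary (n : ℕ) [NeZero n] (hodd : Odd n)
    (P P' : Set (EuclideanSpace ℝ (Fin n)))
    (hP : IsDHPolytope P) (hPb : Bornology.IsBounded P)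
    (hP' : IsDHPolytope P') (hP'b : Bornology.IsBounded P')
    (hPP' : P ∩ {x : EuclideanSpace ℝ (Fin n) | x 0 = 0}
          = P' ∩ {x : EuclideanSpace ℝ (Fin n) | x 0 = 0}) :
    ∃ L : ℂ, Tendsto (fun ε : ℝ => dhInt n P ε) (nhdsWithin 0 (Set.Ioi 0)) (nhds L) ∧
      Tendsto (fun ε : ℝ => dhInt n P' ε) (nhdsWithin 0 (Set.Ioi 0)) (nhds L) := by
  obtain ⟨k, rfl⟩ := hodd
  obtain ⟨T, hT, rfl⟩ := DHVolume.exists_polySet_of_isDHPolytope hP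
  obtain ⟨T', hT', rfl⟩ := DHVolume.exists_polySet_of_isDHPolytope hP'
  have hTT' : ∀ y, ((0 : ℝ), y) ∈ DHVolume.polySet T ↔ ((0 : ℝ), y) ∈ DHVolume.polySet T' := by
    intro y
    obtain ⟨x, hx⟩ := (DHVolume.splitFst (2 * k)).surjective (0, y)
    have hx0 : x 0 = 0 := congrArg Prod.fst hx
    simpa [hx, hx0] using Set.ext_iff.1 hPP' x
  have h := DHVolume.exists_common_limit hT hT' (by simp)
    (DHVolume.isBounded_of_preimage_splitFst hPb)
    (DHVolume.isBounded_of_preimage_splitFst hP'b) hTT'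
  rw [finrank_euclideanSpace_fin] at h
  simpa only [DHVolume.dhInt_preimage_splitFst] using h
end
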